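/- Let d ≥ 3, E > 0 and 0 < α < 1. Let V : ℝ^d → ℝ be bounded and measurable with V(x) ≤ p(|x|) for all x, where p : [0,∞) → (0,∞) is nonincreasing with p(r) → 0 as r → ∞, and assume there is C₁ > 0 such that |V(rw) − V(r′w)| ≤ C₁ (r+1)^{−4} |r − r′|^α for every unit vector w and all r, r′ ≥ 0 with 0 < |r − r′| ≤ 1. Fix s with 1/2 < s < 3/4 and ℓ > 2 with (2−2s)ℓ > 2. Then there exist constants τ₀ ≥ 1 and C > 0 such that the following holds for all 0 < h ≤ 1 and 0 < ε ≤ 1: with θ = h^{2/(α+3)}, τ = τ₀ θ^{2α/3} h^{−1/3}, a = τ₀^ℓ h^{−2}, and φ the phase function built from k = 1, τ, a as in the context, for every smooth compactly supported f : ℝ^d → ℂ and both choices of sign ±: ‖(|x|+1)^{−s} e^{φ(|x|)/h} f‖_{L²(ℝ^d)} + ‖(|x|+1)^{−s} e^{φ(|x|)/h} D_r f‖_{L²(ℝ^d)} ≤ C a² h^{−1} ‖(|x|+1)^{s} e^{φ(|x|)/h} (−h²Δf + (V − E ± iε) f)‖_{L²(ℝ^d)} + C τ a (ε/h)^{1/2}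 ‖e^{φ(|x|)/h} f‖_{L²(ℝ^d)}, where (D_r f)(x) = −ih (x/|x|)·∇f(x). -/

import Mathlib

open MeasureTheory

/-- The derivative φ′ of the phase function. -/
noncomputable def phiDeriv (k τ a r : ℝ) : ℝ :=
  if r ≤ a then τ * ((r + 1) ^ (-k) - (a + 1) ^ (-k)) else 0

/-- The phase function φ(r) = ∫₀^r φ′(t) dt. -/
noncomputable def phi (k τ a r : ℝ) : ℝ :=
  ∫ t in (0:ℝ)..r, phiDeriv k τ a t

/-- The Laplacian of a function on ℝ^d, as the sum of the second derivatives
along the coordinate directions. -/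
noncomputable def lap {d : ℕ} (f : EuclideanSpace ℝ (Fin d) → ℂ)
    (x : EuclideanSpace ℝ (Fin d)) : ℂ :=
  ∑ i : Fin d,
    fderiv ℝ (fun y => fderiv ℝ f y (EuclideanSpace.single i 1)) x (EuclideanSpace.single i 1)

/-- The radial semiclassical derivative D_r f = −ih (x/|x|)·∇f. -/
noncomputable def radialDeriv {d : ℕ} (h : ℝ) (f : EuclideanSpace ℝ (Fin d) → ℂ)
    (x : EuclideanSpace ℝ (Fin d)) : ℂ :=
  -Complex.I * (h:ℂ) * fderiv ℝ f x (‖x‖⁻¹ • x)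

theorem integral_nonneg_of_forall_ray {E : Type*} [NormedAddCommGroup E] [NormedSpace ℝ E]
    [MeasurableSpace E] [BorelSpace E] [FiniteDimensional ℝ E] [Nontrivial E]
    (μ : Measure E) [μ.IsAddHaarMeasure] (F : E → ℝ)
    (hF : ∀ ω : E, ‖ω‖ = 1 →
      IntegrableOn (fun r : ℝ => r ^ (Module.finrank ℝ E - 1) * F (r • ω)) (Set.Ioi 0) →
      0 ≤ ∫ r in Set.Ioi (0:ℝ), r ^ (Module.finrank ℝ E - 1) * F (r • ω)) :
    0 ≤ ∫ x, F x ∂μ := by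
  by_cases hint : Integrable F μ
  swap
  · rw [integral_undef hint]
  set n := Module.finrank ℝ E - 1 with hn
  have hmp := μ.measurePreserving_homeomorphUnitSphereProd
  have hemb := (homeomorphUnitSphereProd E).measurableEmbedding
  have hcomap : ∀ g : E → ℝ, ∫ x, g x ∂μ = ∫ x : ({(0)}ᶜ : Set E), g x ∂(μ.comap (↑)) := by
    intro g
    rw [integral_subtype_comap (measurableSet_singleton _).compl g, restrict_compl_singleton]
  have hG : ∀ x : ({(0)}ᶜ : Set E), F x =
      (fun y : Metric.sphere (0:E) 1 × Set.Ioi (0:ℝ) => F (y.2.1 • y.1.1))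
        (homeomorphUnitSphereProd E x) := by
    intro x
    have h0 : ‖(x:E)‖ ≠ 0 := norm_ne_zero_iff.2 x.2
    simp [smul_smul, h0]
  have hint2 : Integrable (fun y : Metric.sphere (0:E) 1 × Set.Ioi (0:ℝ) => F (y.2.1 • y.1.1))
      (μ.toSphere.prod (Measure.volumeIoiPow n)) := by
    rw [← hmp.integrable_comp_emb hemb]
    have : Integrable (fun x : ({(0)}ᶜ : Set E) => F x) (μ.comap (↑)) := by
      have h1 : IntegrableOn F ({(0)}ᶜ : Set E) μ := hint.integrableOn
      rwa [integrableOn_iff_comap_subtypeVal (measurableSet_singleton _).compl] at h1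
    exact this.congr (Filter.Eventually.of_forall hG)
  have hconv : ∀ g : ℝ → ℝ, (Integrable (fun r : Set.Ioi (0:ℝ) => g r) (Measure.volumeIoiPow n) ↔
      IntegrableOn (fun r => r ^ n * g r) (Set.Ioi 0)) := by
    intro g
    rw [Measure.volumeIoiPow, integrable_withDensity_iff_integrable_smul' (by fun_prop) (by simp),
      integrableOn_iff_comap_subtypeVal measurableSet_Ioi]
    apply integrable_congr
    refine Filter.Eventually.of_forall fun r => ?_
    have : (0:ℝ) < r := r.2
    simp [ENNReal.toReal_ofReal (pow_nonneg this.le n)]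
  have hconv2 : ∀ g : ℝ → ℝ, ∫ r : Set.Ioi (0:ℝ), g r ∂(Measure.volumeIoiPow n) =
      ∫ r in Set.Ioi (0:ℝ), r ^ n * g r := by
    intro g
    rw [Measure.volumeIoiPow, integral_withDensity_eq_integral_toReal_smul (by fun_prop) (by simp),
      ← integral_subtype_comap measurableSet_Ioi]
    refine integral_congr_ae (Filter.Eventually.of_forall fun r => ?_)
    have : (0:ℝ) < r := r.2
    simp [ENNReal.toReal_ofReal (pow_nonneg this.le n)]
  calc (0:ℝ) ≤ ∫ ω, ∫ r, F (r.1 • ω.1) ∂(Measure.volumeIoiPow n) ∂μ.toSphere := by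
        apply integral_nonneg_of_ae
        filter_upwards [hint2.prod_right_ae] with ω hω
        have h1 := (hconv fun r => F (r • ω.1)).1 hω
        have h2 := hconv2 fun r => F (r • ω.1)
        simp only [Pi.zero_apply]
        rw [h2]
        exact hF ω.1 (by simp) h1
    _ = ∫ y, F (y.2.1 • y.1.1) ∂(μ.toSphere.prod (Measure.volumeIoiPow n)) := by
        rw [integral_prod _ hint2]
    _ = ∫ x : ({(0)}ᶜ : Set E), F x ∂(μ.comap (↑)) := by
        rw [← hmp.integral_comp hemb]
        exact integral_congr_ae (Filter.Eventually.of_forall fun x => (hG x).symm)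
    _ = ∫ x, F x ∂μ := (hcomap F).symm

theorem integral_nonneg_of_radial_flux {E : Type*} [NormedAddCommGroup E] [NormedSpace ℝ E]
    [MeasurableSpace E] [BorelSpace E] [FiniteDimensional ℝ E] [Nontrivial E]
    (μ : Measure E) [μ.IsAddHaarMeasure] (F : E → ℝ) (R : ℝ) (hR : 0 < R)
    (hFR : ∀ x, R ≤ ‖x‖ → F x = 0)
    (hF : ∀ ω : E, ‖ω‖ = 1 → ∃ G G' : ℝ → ℝ,
      Filter.Tendsto G (nhdsWithin 0 (Set.Ioi 0)) (nhds 0) ∧ ContinuousOn G (Set.Ioi 0) ∧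
      (∀ r, 0 < r → HasDerivWithinAt G (G' r) (Set.Ioi r) r) ∧
      (∀ r, 0 < r → G' r ≤ r ^ (Module.finrank ℝ E - 1) * F (r • ω)) ∧ G R = 0) :
    0 ≤ ∫ x, F x ∂μ := by
  refine integral_nonneg_of_forall_ray μ F fun ω hω hint => ?_
  obtain ⟨G, G', h0, hc, hd, hle, hGR⟩ := hF ω hω
  set I : ℝ → ℝ := fun r => r ^ (Module.finrank ℝ E - 1) * F (r • ω) with hI
  have hIR : ∀ r, R ≤ r → I r = 0 := by
    intro r hr
    simp only [hI]
    rw [hFR (r • ω), mul_zero]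
    rw [norm_smul, hω, mul_one]
    exact hr.trans (le_abs_self r)
  have e1 : ∫ r in Set.Ioi (0:ℝ), I r = ∫ r in (0:ℝ)..R, I r := by
    rw [intervalIntegral.integral_of_le hR.le]
    refine (setIntegral_eq_of_subset_of_forall_sdiff_eq_zero measurableSet_Ioi
      Set.Ioc_subset_Ioi_self ?_)
    rintro x ⟨hx, hx'⟩
    apply hIR
    by_contra hcon
    exact hx' ⟨hx, (not_le.1 hcon).le⟩
  rw [e1]
  let G₀ : ℝ → ℝ := Function.update G 0 0
  have hG₀ : ∀ r, 0 < r → G₀ r = G r := fun r hr => Function.update_of_ne hr.ne' _ _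
  have hcont : ContinuousOn G₀ (Set.Icc 0 R) := by
    intro r hr
    rcases hr.1.eq_or_lt with h | h
    · subst h
      have : ContinuousWithinAt G₀ (Set.Ici 0) 0 := by
        rw [← Set.Ioi_insert, continuousWithinAt_insert_self]
        unfold ContinuousWithinAt
        simp only [G₀, Function.update_self]
        exact h0.congr' (by
          filter_upwards [self_mem_nhdsWithin] with r hr using (hG₀ r hr).symm)
      exact this.mono Set.Icc_subset_Ici_self
    · have h1 : ContinuousAt G r := hc.continuousAt (Ioi_mem_nhds h)
      exact (h1.congr (by
        filter_upwards [Ioi_mem_nhds h] with r hr using (hG₀ r hr).symm)).continuousWithinAt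
  have := intervalIntegral.sub_le_integral_of_hasDeriv_right_of_le hR.le hcont (g' := G') (φ := I)
    (fun r hr => (hd r hr.1).congr (fun y hy => hG₀ y (hr.1.trans hy)) (hG₀ r hr.1))
    (by
      rw [integrableOn_Icc_iff_integrableOn_Ioc]
      exact hint.mono_set Set.Ioc_subset_Ioi_self) (fun r hr => hle r hr.1)
  rw [hG₀ R hR, hGR] at this
  simpa [G₀] using this

/-- The rotation of angle `t` in the oriented plane spanned by the orthonormal pair `e`, `f`. -/
noncomputable def planeRotation {E : Type*} [NormedAddCommGroup E] [InnerProductSpace ℝ E]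
    (e f : E) (t : ℝ) (x : E) : E :=
  x + ((Real.cos t - 1) * inner ℝ e x - Real.sin t * inner ℝ f x) • e
    + ((Real.cos t - 1) * inner ℝ f x + Real.sin t * inner ℝ e x) • f

section
variable {E : Type*} [NormedAddCommGroup E] [InnerProductSpace ℝ E] {e f : E}

theorem norm_planeRotation (he : ‖e‖ = 1) (hf : ‖f‖ = 1) (hef : inner ℝ e f = (0:ℝ)) (t : ℝ)
    (x : E) : ‖planeRotation e f t x‖ = ‖x‖ := by
  have h : ‖planeRotation e f t x‖ ^ 2 = ‖x‖ ^ 2 := by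
    unfold planeRotation
    rw [norm_add_sq_real, norm_add_sq_real]
    simp only [inner_add_left, inner_smul_left, inner_smul_right, norm_smul, he, hf, hef,
      mul_one, Real.norm_eq_abs, sq_abs, RCLike.conj_to_real, mul_zero, add_zero]
    rw [real_inner_comm e x, real_inner_comm f x]
    have := Real.sin_sq_add_cos_sq t
    have hs : Real.sin t ^ 2 = 1 - Real.cos t ^ 2 := by linarith
    ring_nf
    rw [hs]
    ring
  exact (sq_eq_sq₀ (norm_nonneg _) (norm_nonneg _)).1 h

theorem planeRotation_add (t : ℝ) (x y : E) :
    planeRotation e f t (x + y) = planeRotation e f t x + planeRotation e f t y := by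
  unfold planeRotation
  simp only [inner_add_right]
  module

theorem planeRotation_smul (t c : ℝ) (x : E) :
    planeRotation e f t (c • x) = c • planeRotation e f t x := by
  unfold planeRotation
  simp only [inner_smul_right]
  module

theorem hasDerivAt_planeRotation (he : ‖e‖ = 1) (hf : ‖f‖ = 1) (hef : inner ℝ e f = (0:ℝ)) (t : ℝ)
    (x : E) : HasDerivAt (fun t => planeRotation e f t x)
      (inner ℝ e (planeRotation e f t x) • f - inner ℝ f (planeRotation e f t x) • e) t := by
  have hc := (Real.hasDerivAt_cos t).sub_const 1
  have hs := Real.hasDerivAt_sin t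
  have h := (((hc.mul_const (inner ℝ e x)).sub (hs.mul_const (inner ℝ f x))).smul_const e
    |>.const_add x).add
      (((hc.mul_const (inner ℝ f x)).add (hs.mul_const (inner ℝ e x))).smul_const f)
  have hee : inner ℝ e e = (1:ℝ) := by rw [real_inner_self_eq_norm_sq, he]; norm_num
  have hff : inner ℝ f f = (1:ℝ) := by rw [real_inner_self_eq_norm_sq, hf]; norm_num
  have hfe : inner ℝ f e = (0:ℝ) := by rw [real_inner_comm, hef]
  refine h.congr_deriv ?_
  simp only [planeRotation, inner_add_right, inner_smul_right, hee, hff, hfe, hef]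
  module

theorem continuous_planeRotation :
    Continuous fun p : ℝ × E => planeRotation e f p.1 p.2 := by
  unfold planeRotation
  fun_prop

theorem measurePreserving_planeRotation [FiniteDimensional ℝ E] [MeasurableSpace E] [BorelSpace E]
    (he : ‖e‖ = 1) (hf : ‖f‖ = 1) (hef : inner ℝ e f = (0:ℝ)) (t : ℝ) :
    MeasurePreserving (planeRotation e f t) (volume : Measure E) volume ∧
      MeasurableEmbedding (planeRotation e f t) := by
  let L : E →ₗᵢ[ℝ] E :=
    { toFun := planeRotation e f t
      map_add' := planeRotation_add t
      map_smul' := planeRotation_smul t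
      norm_map' := norm_planeRotation he hf hef t }
  exact ⟨(L.toLinearIsometryEquiv rfl).measurePreserving,
    (L.toLinearIsometryEquiv rfl).toHomeomorph.measurableEmbedding⟩

theorem integral_radial_mul_fderiv_rotation [FiniteDimensional ℝ E] [MeasurableSpace E]
    [BorelSpace E] (he : ‖e‖ = 1) (hf : ‖f‖ = 1) (hef : inner ℝ e f = (0:ℝ)) {W : ℝ → ℝ}
    (hW : Measurable W) {c : E → ℝ} (hc : ContDiff ℝ 1 c) :
    ∫ x : E, W ‖x‖ * fderiv ℝ c x (inner ℝ e x • f - inner ℝ f x • e) = 0 := by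
  set H : E → ℝ := fun x => W ‖x‖ * fderiv ℝ c x (inner ℝ e x • f - inner ℝ f x • e) with hH
  by_cases hint : Integrable H
  swap
  · exact integral_undef hint
  have hdc : Continuous (fderiv ℝ c) := hc.continuous_fderiv (by norm_num)
  have hHm : Measurable H := by
    refine (hW.comp measurable_norm).mul ?_
    exact (hdc.clm_apply (by fun_prop)).measurable
  have hcomp : ∀ t, ∫ x, H (planeRotation e f t x) = ∫ x, H x := fun t =>
    let h := measurePreserving_planeRotation he hf hef t
    h.1.integral_comp h.2 H
  have hcompn : ∀ t, ∫ x, ‖H (planeRotation e f t x)‖ = ∫ x, ‖H x‖ := fun t =>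
    let h := measurePreserving_planeRotation he hf hef t
    h.1.integral_comp h.2 fun x => ‖H x‖
  have hprod : Integrable (fun p : ℝ × E => H (planeRotation e f p.1 p.2))
      ((volume.restrict (Set.Ioc 0 (2 * Real.pi))).prod volume) := by
    have hm : Measurable fun p : ℝ × E => H (planeRotation e f p.1 p.2) :=
      hHm.comp continuous_planeRotation.measurable
    rw [integrable_prod_iff hm.aestronglyMeasurable]
    refine ⟨Filter.Eventually.of_forall fun t => ?_, ?_⟩
    · have h := measurePreserving_planeRotation he hf hef t
      exact (h.1.integrable_comp_emb h.2).2 hint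
    · simp only [hcompn]
      exact integrable_const _
  have hswap := integral_integral_swap (f := fun t x => H (planeRotation e f t x)) hprod
  simp only [hcomp] at hswap
  have hzero : ∀ x, ∫ t in Set.Ioc 0 (2 * Real.pi), H (planeRotation e f t x) = 0 := by
    intro x
    rw [← intervalIntegral.integral_of_le Real.two_pi_pos.le]
    have hd : ∀ t ∈ Set.uIcc 0 (2 * Real.pi),
        HasDerivAt (fun t => W ‖x‖ * c (planeRotation e f t x)) (H (planeRotation e f t x)) t := by
      intro t _
      have h1 := (hc.differentiable (by norm_num) (planeRotation e f t x)).hasFDerivAt.comp_hasDerivAt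
        t (hasDerivAt_planeRotation he hf hef t x)
      simp only [hH, norm_planeRotation he hf hef]
      exact h1.const_mul _
    rw [intervalIntegral.integral_eq_sub_of_hasDerivAt hd]
    · simp [planeRotation]
    · apply Continuous.intervalIntegrable
      simp only [hH, norm_planeRotation he hf hef]
      have hr : Continuous fun t => planeRotation e f t x :=
        continuous_planeRotation.comp (Continuous.prodMk_left x)
      exact continuous_const.mul ((hdc.comp hr).clm_apply (by fun_prop))
  simp only [hzero, integral_zero] at hswap
  rw [integral_const] at hswap
  have hne : (volume.restrict (Set.Ioc 0 (2 * Real.pi))).real Set.univ ≠ 0 := by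
    simp [Real.pi_pos.le, Real.pi_pos.ne']
  rw [smul_eq_mul] at hswap
  exact (mul_eq_zero.1 hswap).resolve_left hne
end

/-- The generator of rotations in the `(i, j)` coordinate plane. -/
noncomputable def rotGen {d : ℕ} (i j : Fin d) :
    EuclideanSpace ℝ (Fin d) →L[ℝ] EuclideanSpace ℝ (Fin d) :=
  (EuclideanSpace.proj i).smulRight (EuclideanSpace.single j 1)
    - (EuclideanSpace.proj j).smulRight (EuclideanSpace.single i 1)

/-- The derivative of `f` along the rotation field of the `(i, j)` coordinate plane. -/
noncomputable def angDeriv {d : ℕ} {F : Type*} [NormedAddCommGroup F] [NormedSpace ℝ F]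
    (i j : Fin d) (f : EuclideanSpace ℝ (Fin d) → F) (x : EuclideanSpace ℝ (Fin d)) : F :=
  fderiv ℝ f x (rotGen i j x)

/-- The Euler operator `x · ∇`. -/
noncomputable def eulerDeriv {d : ℕ} {F : Type*} [NormedAddCommGroup F] [NormedSpace ℝ F]
    (f : EuclideanSpace ℝ (Fin d) → F) (x : EuclideanSpace ℝ (Fin d)) : F :=
  fderiv ℝ f x x

/-- The spherical Laplacian, as a sum of squares of rotation fields. -/
noncomputable def angLap {d : ℕ} (f : EuclideanSpace ℝ (Fin d) → ℂ)
    (x : EuclideanSpace ℝ (Fin d)) : ℂ :=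
  (1 / 2) * ∑ i : Fin d, ∑ j : Fin d, angDeriv i j (angDeriv i j f) x

section
variable {d : ℕ} {F : Type*} [NormedAddCommGroup F] [NormedSpace ℝ F]

theorem rotGen_apply (i j : Fin d) (x : EuclideanSpace ℝ (Fin d)) :
    rotGen i j x = x i • EuclideanSpace.single j 1 - x j • EuclideanSpace.single i 1 := by
  simp [rotGen]

theorem ContDiff.fderiv_clm_apply_top {f : EuclideanSpace ℝ (Fin d) → F}
    (hf : ContDiff ℝ (⊤ : ℕ∞) f) : ContDiff ℝ (⊤ : ℕ∞) (fderiv ℝ f) :=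
  hf.fderiv_right (by simp)

theorem ContDiff.angDeriv {f : EuclideanSpace ℝ (Fin d) → F}
    (hf : ContDiff ℝ (⊤ : ℕ∞) f) (i j : Fin d) : ContDiff ℝ (⊤ : ℕ∞) (angDeriv i j f) :=
  hf.fderiv_clm_apply_top.clm_apply (rotGen i j).contDiff

theorem ContDiff.eulerDeriv {f : EuclideanSpace ℝ (Fin d) → F}
    (hf : ContDiff ℝ (⊤ : ℕ∞) f) : ContDiff ℝ (⊤ : ℕ∞) (eulerDeriv f) :=
  hf.fderiv_clm_apply_top.clm_apply contDiff_id

theorem fderiv_fderiv_clm_apply {f : EuclideanSpace ℝ (Fin d) → F}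
    (hf : ContDiff ℝ (⊤ : ℕ∞) f)
    (A : EuclideanSpace ℝ (Fin d) →L[ℝ] EuclideanSpace ℝ (Fin d)) (x v : EuclideanSpace ℝ (Fin d)) :
    fderiv ℝ (fun y => fderiv ℝ f y (A y)) x v
      = fderiv ℝ (fderiv ℝ f) x v (A x) + fderiv ℝ f x (A v) := by
  have h1 : DifferentiableAt ℝ (fderiv ℝ f) x :=
    hf.fderiv_clm_apply_top.differentiable (by simp) x
  rw [fderiv_clm_apply h1 A.differentiableAt]
  simp [add_comm]

theorem lap_eq_sum {f : EuclideanSpace ℝ (Fin d) → ℂ} (hf : ContDiff ℝ (⊤ : ℕ∞) f)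
    (x : EuclideanSpace ℝ (Fin d)) :
    lap f x = ∑ i, fderiv ℝ (fderiv ℝ f) x (EuclideanSpace.single i 1)
      (EuclideanSpace.single i 1) := by
  unfold lap
  refine Finset.sum_congr rfl fun i _ => ?_
  have h1 : DifferentiableAt ℝ (fderiv ℝ f) x :=
    hf.fderiv_clm_apply_top.differentiable (by simp) x
  rw [fderiv_clm_apply h1 (differentiableAt_const _)]
  simp

theorem angDeriv_eulerDeriv {f : EuclideanSpace ℝ (Fin d) → F} (hf : ContDiff ℝ (⊤ : ℕ∞) f)
    (i j : Fin d) (x : EuclideanSpace ℝ (Fin d)) :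
    angDeriv i j (eulerDeriv f) x = eulerDeriv (angDeriv i j f) x := by
  have h1 := fderiv_fderiv_clm_apply hf (ContinuousLinearMap.id ℝ _) x (rotGen i j x)
  have h2 := fderiv_fderiv_clm_apply hf (rotGen i j) x x
  have hs : IsSymmSndFDerivAt ℝ f x := hf.contDiffAt.isSymmSndFDerivAt
    (by simp only [minSmoothness_of_isRCLikeNormedField]; exact WithTop.coe_le_coe.2 (le_top : (2 : ℕ∞) ≤ ⊤))
  simp only [ContinuousLinearMap.coe_id', id_eq] at h1
  unfold angDeriv eulerDeriv
  rw [h1, h2, hs.eq]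

theorem sum_smul_single (x : EuclideanSpace ℝ (Fin d)) :
    ∑ i, x i • EuclideanSpace.single i (1:ℝ) = x := by
  ext k
  simp [Pi.single_apply]

theorem normSq_mul_lap {f : EuclideanSpace ℝ (Fin d) → ℂ} (hf : ContDiff ℝ (⊤ : ℕ∞) f)
    (x : EuclideanSpace ℝ (Fin d)) :
    (‖x‖ ^ 2 : ℝ) * lap f x
      = fderiv ℝ (fderiv ℝ f) x x x + ((d:ℂ) - 1) * fderiv ℝ f x x + angLap f x := by
  set H := fderiv ℝ (fderiv ℝ f) x with hH
  set D := fderiv ℝ f x with hD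
  set e : Fin d → EuclideanSpace ℝ (Fin d) := fun i => EuclideanSpace.single i 1 with he
  have hxx : H x x = ∑ i, ∑ j, (x i : ℂ) * (x j : ℂ) * H (e i) (e j) := by
    conv_lhs => rw [← sum_smul_single x]
    simp only [map_sum, map_smul, _root_.sum_apply, _root_.smul_apply,
      Complex.real_smul, Finset.mul_sum]
    rw [Finset.sum_comm]
    exact Finset.sum_congr rfl fun i _ => Finset.sum_congr rfl fun j _ => by ring
  have hDx : D x = ∑ i, (x i : ℂ) * D (e i) := by
    conv_lhs => rw [← sum_smul_single x]
    simp only [map_sum, map_smul, Complex.real_smul]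
    rfl
  have hn : ((‖x‖ ^ 2 : ℝ) : ℂ) = ∑ i, (x i : ℂ) ^ 2 := by
    rw [EuclideanSpace.real_norm_sq_eq]
    push_cast
    rfl
  have hang : ∀ i j, angDeriv i j (angDeriv i j f) x
      = (x i : ℂ) ^ 2 * H (e j) (e j) - (x i : ℂ) * (x j : ℂ) * H (e j) (e i)
        - (x j : ℂ) * (x i : ℂ) * H (e i) (e j) + (x j : ℂ) ^ 2 * H (e i) (e i)
        - (x j : ℂ) * D (e j) - (x i : ℂ) * D (e i)
        + (if i = j then (x i : ℂ) * D (e j) + (x j : ℂ) * D (e i) else 0) := by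
    intro i j
    have h := fderiv_fderiv_clm_apply hf (rotGen i j) x (rotGen i j x)
    have : angDeriv i j (angDeriv i j f) x
      = H (rotGen i j x) (rotGen i j x) + D (rotGen i j (rotGen i j x)) := h
    rw [this, rotGen_apply i j (rotGen i j x), rotGen_apply i j x]
    simp only [map_sub, map_smul, _root_.sub_apply, _root_.smul_apply,
      Complex.real_smul, PiLp.sub_apply, PiLp.smul_apply, PiLp.single_apply, smul_eq_mul]
    by_cases hij : i = j
    · subst hij
      simp
      ring
    · have hji : ¬ j = i := fun h => hij h.symm
      simp [hij, hji]
      simp only [he]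
      ring
  unfold angLap
  simp only [hang, Finset.sum_add_distrib, Finset.sum_sub_distrib, Finset.sum_ite_eq,
    Finset.mem_univ, if_true, Finset.sum_const, Finset.card_univ, Fintype.card_fin, nsmul_eq_mul]
  rw [hxx, hDx, hn, lap_eq_sum hf]
  have e1 : ∑ i, ∑ j, (x i : ℂ) ^ 2 * H (e j) (e j)
      = (∑ i, (x i : ℂ) ^ 2) * ∑ j, H (e j) (e j) := by
    rw [Finset.sum_mul_sum]
  have e2 : ∑ i, ∑ j, (x j : ℂ) ^ 2 * H (e i) (e i)
      = (∑ i, (x i : ℂ) ^ 2) * ∑ j, H (e j) (e j) := by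
    rw [Finset.sum_comm, e1]
  have e3 : ∑ i, ∑ j, (x i : ℂ) * (x j : ℂ) * H (e j) (e i)
      = ∑ i, ∑ j, (x i : ℂ) * (x j : ℂ) * H (e i) (e j) := by
    rw [Finset.sum_comm]
    exact Finset.sum_congr rfl fun i _ => Finset.sum_congr rfl fun j _ => by ring
  have e4 : ∑ i, ∑ j, (x j : ℂ) * (x i : ℂ) * H (e i) (e j)
      = ∑ i, ∑ j, (x i : ℂ) * (x j : ℂ) * H (e i) (e j) :=
    Finset.sum_congr rfl fun i _ => Finset.sum_congr rfl fun j _ => by ring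
  rw [e1, e2, e3, e4, ← Finset.mul_sum]
  simp only [he]
  ring
end

theorem integrable_of_abs_le_inv_sq {E : Type*} [NormedAddCommGroup E] [NormedSpace ℝ E]
    [MeasurableSpace E] [BorelSpace E] [FiniteDimensional ℝ E]
    (hd : 3 ≤ Module.finrank ℝ E) (μ : Measure E) [μ.IsAddHaarMeasure] {F : E → ℝ} {R K : ℝ}
    (hF : AEStronglyMeasurable F μ) (hR : ∀ x, R ≤ ‖x‖ → F x = 0)
    (hK : ∀ x, x ≠ 0 → ‖x‖ < R → |F x| ≤ K * (‖x‖ ^ 2)⁻¹) : Integrable F μ := by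
  have : Nontrivial E := Module.nontrivial_of_finrank_pos (R := ℝ) (by omega)
  have h1 : IntegrableOn (fun x : E => K * (‖x‖ ^ 2)⁻¹) (Metric.ball 0 R) μ := by
    rw [integrableOn_fun_norm_addHaar μ (f := fun r => K * (r ^ 2)⁻¹)]
    have h2 : IntegrableOn (fun y : ℝ => K * y ^ (Module.finrank ℝ E - 3)) (Set.Ioo 0 R) :=
      (Continuous.integrableOn_Icc (by fun_prop)).mono_set Set.Ioo_subset_Icc_self
    refine h2.congr_fun (fun y hy => ?_) measurableSet_Ioo
    have hy0 : y ≠ 0 := hy.1.ne'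
    have : Module.finrank ℝ E - 1 = (Module.finrank ℝ E - 3) + 2 := by omega
    simp only [this, pow_add, smul_eq_mul]
    field_simp
  rw [← integrable_indicator_iff Metric.isOpen_ball.measurableSet] at h1
  refine h1.mono' hF ?_
  have hne : ∀ᵐ x ∂μ, x ≠ 0 := by simp [ae_iff]
  filter_upwards [hne] with x hx
  by_cases hxR : R ≤ ‖x‖
  · rw [hR x hxR]
    simp [Set.indicator, not_lt.2 hxR]
  · simpa [Set.indicator, not_le.1 hxR] using hK x hx (not_le.1 hxR)

theorem HasCompactSupport.exists_radius {E F : Type*} [NormedAddCommGroup E]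
    [Zero F] {f : E → F} (hf : HasCompactSupport f) :
    ∃ R, 1 ≤ R ∧ ∀ x, R ≤ ‖x‖ → x ∉ tsupport f := by
  obtain ⟨R, hR⟩ := hf.isBounded.subset_ball 0
  refine ⟨max R 1, le_max_right _ _, fun x hx hmem => ?_⟩
  have := hR hmem
  rw [mem_ball_zero_iff] at this
  exact absurd this (not_lt.2 ((le_max_left _ _).trans hx))

theorem integrable_radial_mul {d : ℕ} (hd : 3 ≤ d) {w : ℝ → ℝ} (hw : Measurable w)
    (hwb : ∀ R, ∃ K, ∀ r, 0 < r → r ≤ R → |w r| ≤ K * (r ^ 2)⁻¹)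
    {g : EuclideanSpace ℝ (Fin d) → ℝ} (hg : Continuous g) (hgs : HasCompactSupport g) :
    Integrable fun x => w ‖x‖ * g x := by
  obtain ⟨R, -, hR⟩ := hgs.exists_radius
  obtain ⟨K, hK⟩ := hwb R
  obtain ⟨M, hM⟩ := hg.bounded_above_of_compact_support hgs
  refine integrable_of_abs_le_inv_sq (by simpa using hd) volume (R := R) (K := K * M)
    ((hw.comp measurable_norm).mul hg.measurable).aestronglyMeasurable
    (fun x hx => by rw [image_eq_zero_of_notMem_tsupport (hR x hx), mul_zero]) fun x hx hxR => ?_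
  have h1 := hK ‖x‖ (norm_pos_iff.2 hx) hxR.le
  have h2 : |g x| ≤ M := hM x
  rw [abs_mul]
  calc |w ‖x‖| * |g x| ≤ K * (‖x‖ ^ 2)⁻¹ * M :=
        mul_le_mul h1 h2 (abs_nonneg _) ((abs_nonneg _).trans h1)
    _ = K * M * (‖x‖ ^ 2)⁻¹ := by ring

section
variable {d : ℕ}

theorem HasCompactSupport.angDeriv {F : Type*} [NormedAddCommGroup F] [NormedSpace ℝ F]
    {f : EuclideanSpace ℝ (Fin d) → F} (hf : HasCompactSupport f)
    (i j : Fin d) : HasCompactSupport (angDeriv i j f) :=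
  hf.mono' ((Function.support_subset_iff'.2 fun x hx => by
    have : fderiv ℝ f x = 0 := by
      by_contra h
      exact hx (support_fderiv_subset ℝ h)
    simp [_root_.angDeriv, this]))

theorem HasCompactSupport.eulerDeriv {F : Type*} [NormedAddCommGroup F] [NormedSpace ℝ F]
    {f : EuclideanSpace ℝ (Fin d) → F} (hf : HasCompactSupport f) :
    HasCompactSupport (eulerDeriv f) :=
  hf.mono' ((Function.support_subset_iff'.2 fun x hx => by
    have : fderiv ℝ f x = 0 := by
      by_contra h
      exact hx (support_fderiv_subset ℝ h)
    simp [_root_.eulerDeriv, this]))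

theorem angDeriv_re_mul_conj {g b : EuclideanSpace ℝ (Fin d) → ℂ} (hg : ContDiff ℝ (⊤ : ℕ∞) g)
    (hb : ContDiff ℝ (⊤ : ℕ∞) b) (i j : Fin d) (x : EuclideanSpace ℝ (Fin d)) :
    angDeriv i j (fun y => (g y * (starRingEnd ℂ) (b y)).re) x
      = (angDeriv i j g x * (starRingEnd ℂ) (b x)).re
        + (g x * (starRingEnd ℂ) (angDeriv i j b x)).re := by
  have hg' : HasFDerivAt g (fderiv ℝ g x) x := (hg.differentiable (by simp) x).hasFDerivAt
  have hb' : HasFDerivAt b (fderiv ℝ b x) x := (hb.differentiable (by simp) x).hasFDerivAt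
  have h := Complex.reCLM.hasFDerivAt.comp x
    (hg'.mul (Complex.conjCLE.toContinuousLinearMap.hasFDerivAt.comp x hb'))
  have h' : HasFDerivAt (fun y => (g y * (starRingEnd ℂ) (b y)).re) _ x := h
  unfold angDeriv
  rw [h'.fderiv]
  simp
  ring

theorem contDiff_re_mul_conj {g b : EuclideanSpace ℝ (Fin d) → ℂ} (hg : ContDiff ℝ (⊤ : ℕ∞) g)
    (hb : ContDiff ℝ (⊤ : ℕ∞) b) :
    ContDiff ℝ (⊤ : ℕ∞) fun y => (g y * (starRingEnd ℂ) (b y)).re :=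
  Complex.reCLM.contDiff.comp (hg.mul (Complex.conjCLE.toContinuousLinearMap.contDiff.comp hb))

theorem hasCompactSupport_re_mul_conj {g b : EuclideanSpace ℝ (Fin d) → ℂ}
    (hg : HasCompactSupport g) :
    HasCompactSupport fun y => (g y * (starRingEnd ℂ) (b y)).re :=
  hg.mono (Function.support_subset_iff'.2 fun x hx => by
    simp [Function.notMem_support.1 hx])

theorem integral_radial_mul_angDeriv {W : ℝ → ℝ} (hW : Measurable W)
    {c : EuclideanSpace ℝ (Fin d) → ℝ} (hc : ContDiff ℝ (⊤ : ℕ∞) c) (i j : Fin d) :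
    ∫ x, W ‖x‖ * angDeriv i j c x = 0 := by
  by_cases hij : i = j
  · subst hij
    simp [angDeriv, rotGen_apply]
  · have h := integral_radial_mul_fderiv_rotation (e := EuclideanSpace.single i (1:ℝ))
      (f := EuclideanSpace.single j (1:ℝ)) (by simp) (by simp)
      (by rw [EuclideanSpace.inner_single_left]; simp [hij]) hW
      (hc.of_le (by simp))
    simpa [angDeriv, rotGen_apply, EuclideanSpace.inner_single_left] using h

theorem neg_angLap_re_mul_conj {f b : EuclideanSpace ℝ (Fin d) → ℂ} (hf : ContDiff ℝ (⊤ : ℕ∞) f)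
    (hb : ContDiff ℝ (⊤ : ℕ∞) b) (x : EuclideanSpace ℝ (Fin d)) :
    (-angLap f x * (starRingEnd ℂ) (b x)).re = (1 / 2) * ∑ i : Fin d, ∑ j : Fin d,
      ((angDeriv i j f x * (starRingEnd ℂ) (angDeriv i j b x)).re
        - angDeriv i j (fun y => (angDeriv i j f y * (starRingEnd ℂ) (b y)).re) x) := by
  simp only [angDeriv_re_mul_conj (hf.angDeriv _ _) hb]
  simp only [sub_add_cancel_right, Finset.sum_neg_distrib, angLap]
  have : -((1 / 2 : ℂ) * ∑ i : Fin d, ∑ j : Fin d, angDeriv i j (angDeriv i j f) x)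
      * (starRingEnd ℂ) (b x) = ((1 / 2 : ℝ) : ℂ) * -(∑ i : Fin d, ∑ j : Fin d,
        angDeriv i j (angDeriv i j f) x * (starRingEnd ℂ) (b x)) := by
    simp only [← Finset.sum_mul]
    push_cast
    ring
  rw [this, Complex.re_ofReal_mul, Complex.neg_re, Complex.re_sum]
  simp only [Complex.re_sum]

theorem integral_angLap_nonneg (hd : 3 ≤ d) {w₁ w₂ : ℝ → ℝ} (hw₁ : Measurable w₁)
    (hw₂ : Measurable w₂)
    (hb₁ : ∀ R, ∃ K, ∀ r, 0 < r → r ≤ R → |w₁ r| ≤ K * (r ^ 2)⁻¹)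
    (hb₂ : ∀ R, ∃ K, ∀ r, 0 < r → r ≤ R → |w₂ r| ≤ K * (r ^ 2)⁻¹)
    (hpos : ∀ ψ : EuclideanSpace ℝ (Fin d) → ℂ, ContDiff ℝ (⊤ : ℕ∞) ψ → HasCompactSupport ψ →
      0 ≤ ∫ x, (w₁ ‖x‖ * (ψ x * (starRingEnd ℂ) (eulerDeriv ψ x)).re
        + w₂ ‖x‖ * (ψ x * (starRingEnd ℂ) (ψ x)).re))
    {f : EuclideanSpace ℝ (Fin d) → ℂ} (hf : ContDiff ℝ (⊤ : ℕ∞) f) (hfs : HasCompactSupport f) :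
    0 ≤ ∫ x, (w₁ ‖x‖ * (-angLap f x * (starRingEnd ℂ) (eulerDeriv f x)).re
      + w₂ ‖x‖ * (-angLap f x * (starRingEnd ℂ) (f x)).re) := by
  set c₁ : Fin d → Fin d → EuclideanSpace ℝ (Fin d) → ℝ := fun i j y =>
    (angDeriv i j f y * (starRingEnd ℂ) (eulerDeriv f y)).re with hc₁
  set c₂ : Fin d → Fin d → EuclideanSpace ℝ (Fin d) → ℝ := fun i j y =>
    (angDeriv i j f y * (starRingEnd ℂ) (f y)).re with hc₂
  set J : Fin d → Fin d → EuclideanSpace ℝ (Fin d) → ℝ := fun i j x =>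
    w₁ ‖x‖ * (angDeriv i j f x * (starRingEnd ℂ) (eulerDeriv (angDeriv i j f) x)).re
      + w₂ ‖x‖ * (angDeriv i j f x * (starRingEnd ℂ) (angDeriv i j f x)).re with hJ
  have hA := fun i j => hf.angDeriv i j
  have hAs := fun i j => hfs.angDeriv i j
  have hc₁d : ∀ i j, ContDiff ℝ (⊤ : ℕ∞) (c₁ i j) := fun i j =>
    contDiff_re_mul_conj (hA i j) hf.eulerDeriv
  have hc₂d : ∀ i j, ContDiff ℝ (⊤ : ℕ∞) (c₂ i j) := fun i j => contDiff_re_mul_conj (hA i j) hf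
  have hi₁ : ∀ i j, Integrable fun x => w₁ ‖x‖ * angDeriv i j (c₁ i j) x := fun i j =>
    integrable_radial_mul hd hw₁ hb₁ ((hc₁d i j).angDeriv i j).continuous
      ((hasCompactSupport_re_mul_conj (hAs i j)).angDeriv i j)
  have hi₂ : ∀ i j, Integrable fun x => w₂ ‖x‖ * angDeriv i j (c₂ i j) x := fun i j =>
    integrable_radial_mul hd hw₂ hb₂ ((hc₂d i j).angDeriv i j).continuous
      ((hasCompactSupport_re_mul_conj (hAs i j)).angDeriv i j)
  have hiJ : ∀ i j, Integrable (J i j) := fun i j =>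
    (integrable_radial_mul hd hw₁ hb₁
      (contDiff_re_mul_conj (hA i j) (hA i j).eulerDeriv).continuous
      (hasCompactSupport_re_mul_conj (hAs i j))).add
    (integrable_radial_mul hd hw₂ hb₂
      (contDiff_re_mul_conj (hA i j) (hA i j)).continuous
      (hasCompactSupport_re_mul_conj (hAs i j)))
  have key : ∀ x, w₁ ‖x‖ * (-angLap f x * (starRingEnd ℂ) (eulerDeriv f x)).re
      + w₂ ‖x‖ * (-angLap f x * (starRingEnd ℂ) (f x)).re
      = (1 / 2) * ∑ i : Fin d, ∑ j : Fin d, (J i j x - w₁ ‖x‖ * angDeriv i j (c₁ i j) x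
        - w₂ ‖x‖ * angDeriv i j (c₂ i j) x) := by
    intro x
    rw [neg_angLap_re_mul_conj hf hf.eulerDeriv, neg_angLap_re_mul_conj hf hf]
    simp only [angDeriv_eulerDeriv hf, hJ, Finset.sum_sub_distrib, Finset.sum_add_distrib,
      ← Finset.mul_sum, hc₁, hc₂]
    ring
  have hi : ∀ i j, Integrable fun x => J i j x - w₁ ‖x‖ * angDeriv i j (c₁ i j) x
        - w₂ ‖x‖ * angDeriv i j (c₂ i j) x := fun i j => ((hiJ i j).sub (hi₁ i j)).sub (hi₂ i j)
  simp only [key]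
  rw [integral_const_mul, integral_finsetSum _ fun i _ => integrable_finsetSum _ fun j _ => hi i j]
  refine mul_nonneg (by norm_num) (Finset.sum_nonneg fun i _ => ?_)
  rw [integral_finsetSum _ fun j _ => hi i j]
  refine Finset.sum_nonneg fun j _ => ?_
  have hsub : Integrable fun x => J i j x - w₁ ‖x‖ * angDeriv i j (c₁ i j) x :=
    (hiJ i j).sub (hi₁ i j)
  rw [integral_sub hsub (hi₂ i j), integral_sub (hiJ i j) (hi₁ i j),
    integral_radial_mul_angDeriv hw₁ (hc₁d i j), integral_radial_mul_angDeriv hw₂ (hc₂d i j),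
    sub_zero, sub_zero]
  exact hpos _ (hA i j) (hAs i j)
end

section
open ComplexConjugate

theorem hasDerivWithinAt_re_mul_conj {u v : ℝ → ℂ} {u' v' : ℂ} {S : Set ℝ} {r : ℝ}
    (hu : HasDerivWithinAt u u' S r) (hv : HasDerivWithinAt v v' S r) :
    HasDerivWithinAt (fun t => (u t * conj (v t)).re)
      ((u' * conj (v r)).re + (u r * conj v').re) S r := by
  have h1 : HasDerivWithinAt (fun t => conj (v t)) (conj v') S r :=
    Complex.conjCLE.toContinuousLinearMap.hasFDerivAt.comp_hasDerivWithinAt r hv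
  have h2 := Complex.reCLM.hasFDerivAt.comp_hasDerivWithinAt r (hu.mul h1)
  convert! h2 using 1

theorem re_mul_conj_self (z : ℂ) : (z * conj z).re = ‖z‖ ^ 2 := by
  rw [Complex.mul_conj, Complex.ofReal_re, Complex.normSq_eq_norm_sq]

theorem re_mul_conj_le (z w : ℂ) : (z * conj w).re ≤ ‖z‖ * ‖w‖ := by
  simpa using Complex.re_le_norm (z * conj w)

theorem abs_re_mul_conj_le (z w : ℂ) : |(z * conj w).re| ≤ ‖z‖ * ‖w‖ := by
  simpa using Complex.abs_re_le_norm (z * conj w)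

theorem abs_im_mul_conj_le (z w : ℂ) : |(z * conj w).im| ≤ ‖z‖ * ‖w‖ := by
  simpa using Complex.abs_im_le_norm (z * conj w)

theorem re_mul_conj_comm (z w : ℂ) : (z * conj w).re = (w * conj z).re := by
  simp only [Complex.mul_re, Complex.conj_re, Complex.conj_im]
  ring

/-- The quadratic form inequality behind the Carleman estimate: `X`, `U`, `Q`, `D` stand for the
norms of the derivative of the conjugated function, the function, the right hand side, and the
undressed radial derivative. -/
theorem flux_quadratic_bound {μ h w w' r φ₁ c₀ ε Cμ a E M τ B m X U Q D Z S : ℝ}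
    (hh : 0 < h) (hw : 0 < w) (hw' : w' ≤ 0) (hr : 0 < r) (hφ₁ : 0 ≤ φ₁) (hφτ : φ₁ ≤ τ)
    (hτ : 1 ≤ τ) (hc₀ : 0 < c₀) (hε : 0 < ε) (hε1 : ε ≤ 1) (hμ : 0 ≤ μ) (hμa : μ ≤ Cμ * a ^ 2)
    (hB : B = ε * (Cμ * a ^ 2) / h) (hE : 0 ≤ E) (hM : 0 ≤ M) (hX : 0 ≤ X) (hU : 0 ≤ U)
    (hQ : 0 ≤ Q) (hD0 : 0 ≤ D) (hD : D ≤ h * X + (h * m / r + φ₁) * U)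
    (hS : |S| ≤ U * X)
    (hZ : Z ≤ -(c₀ * w * h ^ 2 * X ^ 2) - c₀ * (1 + φ₁ ^ 2) * w * U ^ 2
      + 2 * μ * (Q * X) + 2 * μ * ε * (U * X)
      + B * (Q * U - h ^ 2 * X ^ 2 + (φ₁ ^ 2 + E + M) * U ^ 2)
      + c₀ / 8 * h ^ 2 * ((w' / r - w / r ^ 2) * U ^ 2 + w / r * (2 * S))) :
    Z ≤ 5 / c₀ * Cμ ^ 2 * (a ^ 2 / h) ^ 2 * w⁻¹ * Q ^ 2
      + Cμ * (2 + E + M) * (ε / h) * (a * τ) ^ 2 * U ^ 2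
      - c₀ / (48 * (1 + m ^ 2)) * w * (U ^ 2 + D ^ 2) := by
  have hCa : 0 ≤ Cμ * a ^ 2 := hμ.trans hμa
  have hB0 : 0 ≤ B := by rw [hB]; positivity
  have hBh : B * h = ε * (Cμ * a ^ 2) := by rw [hB]; field_simp
  have e1 : 2 * μ * (Q * X) ≤ c₀ / 4 * w * h ^ 2 * X ^ 2
      + 4 / c₀ * (Cμ * a ^ 2 / h) ^ 2 * w⁻¹ * Q ^ 2 := by
    have h1 : 2 * μ * (Q * X) ≤ 2 * (Cμ * a ^ 2) * (Q * X) := by gcongr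
    have h2 : c₀ / 4 * w * h ^ 2 * X ^ 2 + 4 / c₀ * (Cμ * a ^ 2 / h) ^ 2 * w⁻¹ * Q ^ 2
        - 2 * (Cμ * a ^ 2) * (Q * X)
        = c₀ / 4 * w * (h * X - 4 / c₀ * w⁻¹ * (Cμ * a ^ 2 / h) * Q) ^ 2 := by
      field_simp
      ring
    have h3 : 0 ≤ c₀ / 4 * w * (h * X - 4 / c₀ * w⁻¹ * (Cμ * a ^ 2 / h) * Q) ^ 2 := by positivity
    linarith
  have e2 : B * (Q * U) ≤ c₀ / 4 * w * U ^ 2 + 1 / c₀ * (Cμ * a ^ 2 / h) ^ 2 * w⁻¹ * Q ^ 2 := by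
    have h0 : B ≤ Cμ * a ^ 2 / h := by
      rw [hB]
      exact div_le_div_of_nonneg_right (mul_le_of_le_one_left hCa hε1) hh.le
    have h1 : B * (Q * U) ≤ Cμ * a ^ 2 / h * (Q * U) := by gcongr
    have h2 : c₀ / 4 * w * U ^ 2 + 1 / c₀ * (Cμ * a ^ 2 / h) ^ 2 * w⁻¹ * Q ^ 2
        - Cμ * a ^ 2 / h * (Q * U)
        = c₀ / 4 * w * (U - 2 / c₀ * w⁻¹ * (Cμ * a ^ 2 / h) * Q) ^ 2 := by
      field_simp
      ring
    have h3 : 0 ≤ c₀ / 4 * w * (U - 2 / c₀ * w⁻¹ * (Cμ * a ^ 2 / h) * Q) ^ 2 := by positivity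
    linarith
  have e3 : 2 * μ * ε * (U * X) ≤ B * (U ^ 2 + h ^ 2 * X ^ 2) := by
    have h1 : 2 * μ * ε * (U * X) ≤ 2 * (B * h) * (U * X) := by
      rw [hBh, mul_assoc 2 μ ε, mul_comm μ ε]
      gcongr
    have h2 : 0 ≤ B * (U - h * X) ^ 2 := by positivity
    linarith
  have e4 : B * ((1 + φ₁ ^ 2 + E + M) * U ^ 2)
      ≤ Cμ * (2 + E + M) * (ε / h) * (a * τ) ^ 2 * U ^ 2 := by
    have h1 : 1 + φ₁ ^ 2 + E + M ≤ (2 + E + M) * τ ^ 2 := by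
      have : φ₁ ^ 2 ≤ τ ^ 2 := by gcongr
      nlinarith [one_le_pow₀ hτ (n := 2)]
    calc B * ((1 + φ₁ ^ 2 + E + M) * U ^ 2) ≤ B * ((2 + E + M) * τ ^ 2 * U ^ 2) := by gcongr
      _ = _ := by rw [hB]; field_simp
  have e5 : (w' / r - w / r ^ 2) * U ^ 2 + w / r * (2 * S)
      ≤ 2 * w * X ^ 2 - w / 2 * (U / r) ^ 2 := by
    have h1 : w' / r * U ^ 2 ≤ 0 :=
      mul_nonpos_of_nonpos_of_nonneg (div_nonpos_of_nonpos_of_nonneg hw' hr.le) (sq_nonneg _)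
    have h2 : w / r * (2 * S) ≤ w / r * (2 * (U * X)) := by
      gcongr; exact (le_abs_self S).trans hS
    have h3 : 2 * w * X ^ 2 - w / 2 * (U / r) ^ 2 + w / r ^ 2 * U ^ 2 - w / r * (2 * (U * X))
        = w / 2 * (U / r - 2 * X) ^ 2 := by
      field_simp
      ring
    have h4 : 0 ≤ w / 2 * (U / r - 2 * X) ^ 2 := by positivity
    linarith
  have e6 : D ^ 2 ≤ 3 * (h ^ 2 * X ^ 2 + m ^ 2 * (h ^ 2 * (U / r) ^ 2) + φ₁ ^ 2 * U ^ 2) := by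
    have h1 : D ^ 2 ≤ (h * X + (h * m / r + φ₁) * U) ^ 2 := by gcongr
    have h2 : h * X + (h * m / r + φ₁) * U = h * X + m * (h * (U / r)) + φ₁ * U := by
      ring
    rw [h2] at h1
    linarith [sq_nonneg (h * X - m * (h * (U / r))), sq_nonneg (h * X - φ₁ * U),
      sq_nonneg (m * (h * (U / r)) - φ₁ * U)]
  have e7 : c₀ / (48 * (1 + m ^ 2)) * w * (U ^ 2 + D ^ 2)
      ≤ w * (c₀ / 16 * (h ^ 2 * X ^ 2 + h ^ 2 * (U / r) ^ 2 + (1 + φ₁ ^ 2) * U ^ 2)) := by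
    have h1 : U ^ 2 + D ^ 2 ≤ 3 * (1 + m ^ 2)
        * (h ^ 2 * X ^ 2 + h ^ 2 * (U / r) ^ 2 + (1 + φ₁ ^ 2) * U ^ 2) := by
      have q1 : 0 ≤ m ^ 2 * (h ^ 2 * X ^ 2) := by positivity
      have q2 : 0 ≤ h ^ 2 * (U / r) ^ 2 := by positivity
      have q3 : 0 ≤ m ^ 2 * ((1 + φ₁ ^ 2) * U ^ 2) := by positivity
      linarith [sq_nonneg U]
    calc c₀ / (48 * (1 + m ^ 2)) * w * (U ^ 2 + D ^ 2)
        ≤ c₀ / (48 * (1 + m ^ 2)) * w * (3 * (1 + m ^ 2)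
        * (h ^ 2 * X ^ 2 + h ^ 2 * (U / r) ^ 2 + (1 + φ₁ ^ 2) * U ^ 2)) := by gcongr
      _ = _ := by field_simp; ring
  have e8 : 5 / c₀ * Cμ ^ 2 * (a ^ 2 / h) ^ 2 * w⁻¹ * Q ^ 2
      = 4 / c₀ * (Cμ * a ^ 2 / h) ^ 2 * w⁻¹ * Q ^ 2
        + 1 / c₀ * (Cμ * a ^ 2 / h) ^ 2 * w⁻¹ * Q ^ 2 := by ring
  have e9 : c₀ / 8 * h ^ 2 * ((w' / r - w / r ^ 2) * U ^ 2 + w / r * (2 * S))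
      ≤ c₀ / 8 * h ^ 2 * (2 * w * X ^ 2 - w / 2 * (U / r) ^ 2) := by gcongr
  have p1 : 0 ≤ c₀ * w * (h ^ 2 * X ^ 2) := by positivity
  have p2 : 0 ≤ c₀ * w * ((1 + φ₁ ^ 2) * U ^ 2) := by positivity
  have p3 : 0 ≤ c₀ * w * (φ₁ ^ 2 * U ^ 2) := by positivity
  linarith

theorem flux_derivative_bound {u u₁ u₂ q N : ℂ}
    {μ μ' κ κ' φ₁ φ₂ h w w' r c₀ ε σ E M B cd v vθ : ℝ}
    (hμ : 0 ≤ μ) (hε : 0 < ε) (hσ : σ = 1 ∨ σ = -1) (hB : 0 ≤ B) (hcd : 0 ≤ cd) (hr : 0 < r)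
    (hh : 0 < h) (hv : |v| ≤ M)
    (hκ : κ = -φ₁ ^ 2 + h ^ 2 * cd / r ^ 2 - E + vθ)
    (hode : -(h : ℂ) ^ 2 * u₂ = q - 2 * (h * φ₁ : ℝ) * u₁
      - (((h * φ₂ - φ₁ ^ 2 + h ^ 2 * cd / r ^ 2 + (v - E) : ℝ) : ℂ)
        + (σ : ℂ) * (ε : ℂ) * Complex.I) * u - (h ^ 2 / r ^ 2 : ℝ) * N)
    (hform : c₀ * w * h ^ 2 * ‖u₁‖ ^ 2 + c₀ * (1 + φ₁ ^ 2) * w * ‖u‖ ^ 2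
      ≤ (h ^ 2 * μ' + 4 * h * μ * φ₁) * ‖u₁‖ ^ 2 + (-μ' * κ - μ * κ') * ‖u‖ ^ 2
        - 2 * μ * (h * |φ₂| + |v - vθ|) * (‖u‖ * ‖u₁‖)) :
    (μ' * (-h ^ 2 * (u₁ * conj u₁).re + κ * (u * conj u).re)
      + μ * (-h ^ 2 * ((u₂ * conj u₁).re + (u₁ * conj u₂).re)
        + (κ' * (u * conj u).re + κ * ((u₁ * conj u).re + (u * conj u₁).re)))
      + B * (-h ^ 2 * ((u₂ * conj u).re + (u₁ * conj u₁).re)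
        + h * (φ₂ * (u * conj u).re + φ₁ * ((u₁ * conj u).re + (u * conj u₁).re)))
      + c₀ / 8 * h ^ 2 * ((w' / r - w / r ^ 2) * (u * conj u).re
        + w / r * ((u₁ * conj u).re + (u * conj u₁).re)))
      + h ^ 2 / r ^ 2 * (2 * μ * (N * conj u₁).re + B * (N * conj u).re)
      ≤ -(c₀ * w * h ^ 2 * ‖u₁‖ ^ 2) - c₀ * (1 + φ₁ ^ 2) * w * ‖u‖ ^ 2
      + 2 * μ * (‖q‖ * ‖u₁‖) + 2 * μ * ε * (‖u‖ * ‖u₁‖)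
      + B * (‖q‖ * ‖u‖ - h ^ 2 * ‖u₁‖ ^ 2 + (φ₁ ^ 2 + E + M) * ‖u‖ ^ 2)
      + c₀ / 8 * h ^ 2 * ((w' / r - w / r ^ 2) * ‖u‖ ^ 2
        + w / r * (2 * (u₁ * conj u).re)) := by
  have k1 : -h ^ 2 * (u₂ * conj u₁).re = (q * conj u₁).re - 2 * (h * φ₁) * (u₁ * conj u₁).re
      - (h * φ₂ - φ₁ ^ 2 + h ^ 2 * cd / r ^ 2 + (v - E)) * (u * conj u₁).re
      + σ * ε * (u * conj u₁).im - h ^ 2 / r ^ 2 * (N * conj u₁).re := by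
    have := congrArg (fun z => (z * conj u₁).re) hode
    simp only [← Complex.ofReal_pow, ← Complex.ofReal_neg, ← Complex.ofReal_ofNat,
      ← Complex.ofReal_mul, Complex.mul_re, Complex.sub_re, Complex.add_re, Complex.sub_im,
      Complex.add_im, Complex.mul_im, Complex.ofReal_re, Complex.ofReal_im, Complex.I_re,
      Complex.I_im, Complex.conj_re, Complex.conj_im] at this ⊢
    linear_combination this
  have k2 : -h ^ 2 * (u₂ * conj u).re = (q * conj u).re - 2 * (h * φ₁) * (u₁ * conj u).re
      - (h * φ₂ - φ₁ ^ 2 + h ^ 2 * cd / r ^ 2 + (v - E)) * (u * conj u).re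
      - h ^ 2 / r ^ 2 * (N * conj u).re := by
    have := congrArg (fun z => (z * conj u).re) hode
    simp only [← Complex.ofReal_pow, ← Complex.ofReal_neg, ← Complex.ofReal_ofNat,
      ← Complex.ofReal_mul, Complex.mul_re, Complex.sub_re, Complex.add_re, Complex.sub_im,
      Complex.add_im, Complex.mul_im, Complex.ofReal_re, Complex.ofReal_im, Complex.I_re,
      Complex.I_im, Complex.conj_re, Complex.conj_im] at this ⊢
    linear_combination this
  rw [re_mul_conj_comm u₁ u₂, re_mul_conj_comm u u₁] at *
  rw [re_mul_conj_self] at *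
  rw [re_mul_conj_self] at *
  have b1 := re_mul_conj_le q u₁
  have b2 := re_mul_conj_le q u
  have b3 := abs_re_mul_conj_le u u₁
  have b4 := abs_im_mul_conj_le u u₁
  rw [re_mul_conj_comm u u₁] at b3
  set S := (u₁ * conj u).re
  set T := (u * conj u₁).im
  have g1 : σ * ε * T ≤ ε * (‖u‖ * ‖u₁‖) := by
    have : σ * T ≤ |T| := by
      rcases hσ with h | h <;> rw [h]
      · rw [one_mul]; exact le_abs_self _
      · rw [neg_one_mul]; exact neg_le_abs _
    calc σ * ε * T = ε * (σ * T) := by ring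
      _ ≤ _ := mul_le_mul_of_nonneg_left (this.trans b4) hε.le
  have g2 : -((h * φ₂ + (v - vθ)) * S) ≤ (h * |φ₂| + |v - vθ|) * (‖u‖ * ‖u₁‖) := by
    calc -((h * φ₂ + (v - vθ)) * S) ≤ |(h * φ₂ + (v - vθ)) * S| := neg_le_abs _
      _ = |h * φ₂ + (v - vθ)| * |S| := abs_mul _ _
      _ ≤ _ := by
        gcongr
        refine (abs_add_le _ _).trans ?_
        rw [abs_mul, abs_of_pos hh]
  have g3 : 0 ≤ B * (h ^ 2 * cd / r ^ 2 * ‖u‖ ^ 2) := by positivity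
  have g4 : B * (-v * ‖u‖ ^ 2) ≤ B * (M * ‖u‖ ^ 2) := by
    gcongr; exact (neg_le_abs v).trans hv
  have g5 := mul_le_mul_of_nonneg_left b1 hμ
  have g6 := mul_le_mul_of_nonneg_left b2 hB
  have g7 := mul_le_mul_of_nonneg_left g1 hμ
  have g8 := mul_le_mul_of_nonneg_left g2 hμ
  have k1' : μ * (-h ^ 2 * (u₂ * conj u₁).re) = _ := congrArg (μ * ·) k1
  have k2' : B * (-h ^ 2 * (u₂ * conj u).re) = _ := congrArg (B * ·) k2
  have k3 : μ * κ * S = μ * (-φ₁ ^ 2 + h ^ 2 * cd / r ^ 2 - E + vθ) * S := by rw [hκ]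
  linarith
end

theorem carleman_form_inner_zeroth {r t b τ h E cd vθ vθ' κ κ' C₁ L : ℝ} (hr : 0 < r)
    (ht : (r + 1) * t = 1) (hE : 0 < E) (hcd : 0 ≤ cd) (hC₁ : 0 ≤ C₁) (hL : 0 ≤ L)
    (hvθ : (2 * r + 1) * vθ ≤ E / 8 * (2 * r + 1) + τ ^ 2 * t ^ 2 / 8)
    (hvθ' : |vθ'| ≤ C₁ * L * t ^ 4) (hbτ : 64 * (b * τ ^ 2) ≤ E) (hCL : C₁ * L ≤ τ ^ 2 / 8)
    (hκ : κ = -(τ * (t - b)) ^ 2 + h ^ 2 * cd / r ^ 2 - E + vθ)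
    (hκ' : κ' = -2 * (τ * (t - b)) * (-(τ * t ^ 2)) - 2 * h ^ 2 * cd / r ^ 3 + vθ') :
    3 / 4 * (τ ^ 2 * t ^ 2) + 13 / 16 * (E * (2 * r + 1))
      ≤ -(2 * r + 1) * κ - r * (r + 1) * κ' := by
  have ht0 : 0 < t := pos_of_mul_pos_right (ht ▸ one_pos) (by linarith)
  have e1 : r * (r + 1) * vθ' ≤ τ ^ 2 * t ^ 2 / 8 := by
    calc r * (r + 1) * vθ' ≤ (r + 1) * (r + 1) * (C₁ * L * t ^ 4) := by
          have : 0 ≤ C₁ * L * t ^ 4 := by positivity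
          calc r * (r + 1) * vθ' ≤ r * (r + 1) * (C₁ * L * t ^ 4) := by
                gcongr; exact (le_abs_self _).trans hvθ'
            _ ≤ _ := by gcongr; linarith
      _ = C₁ * L * t ^ 2 * ((r + 1) * t) ^ 2 := by ring
      _ = C₁ * L * t ^ 2 := by rw [ht]; ring
      _ ≤ τ ^ 2 / 8 * t ^ 2 := by gcongr
      _ = _ := by ring
  have e2 : -(2 * r + 1) * κ - r * (r + 1) * κ' = τ ^ 2 * t ^ 2 - 2 * (b * τ ^ 2)
      + (2 * r + 1) * (τ * b) ^ 2 + h ^ 2 * cd / r ^ 2 + E * (2 * r + 1) - (2 * r + 1) * vθ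
      - r * (r + 1) * vθ' := by
    have e3 : -(2 * r + 1) * (h ^ 2 * cd / r ^ 2) + r * (r + 1) * (2 * h ^ 2 * cd / r ^ 3)
        = h ^ 2 * cd / r ^ 2 := by field_simp; ring
    rw [hκ, hκ']
    linear_combination e3 + (-2 * (τ ^ 2 * r * t * (t - b)) - 2 * τ ^ 2 * b * 1
      + 0) * ht
  have e4 : 0 ≤ h ^ 2 * cd / r ^ 2 := by positivity
  have e5 : 0 ≤ (2 * r + 1) * (τ * b) ^ 2 := by positivity
  have e6 : 0 < E * r := by positivity
  rw [e2]
  linarith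

theorem carleman_cross_of_two_mul_le {r t b τ h E C₁ Θ X U : ℝ} (hr : 0 < r)
    (ht : (r + 1) * t = 1) (hh : 0 < h) (hh1 : h ≤ 1) (hτ : 1 ≤ τ) (hE : 0 < E)
    (hCΘ : C₁ ^ 2 * Θ ^ 2 ≤ h * τ ^ 3 / 8) (hEτ : 256 ≤ E * τ) (hcase : 2 * b ≤ t) :
    2 * (h * τ * r * t) * (U * X) + 2 * (C₁ * Θ * r * t ^ 3) * (U * X)
      ≤ 4 * h * (r * (r + 1)) * (τ * (t - b)) * X ^ 2
        + (1 / 4 * (τ ^ 2 * t ^ 2) + 1 / 8 * (E * (2 * r + 1))) * U ^ 2 := by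
  have ht0 : 0 < t := pos_of_mul_pos_right (ht ▸ one_pos) (by linarith)
  have hrt : r * t ≤ 1 := by linarith
  have ht1 : t ≤ 1 := by linarith [mul_pos hr ht0]
  have hrsq : r * (r + 1) * t = r := by rw [mul_assoc, ht, mul_one]
  have a1 : 2 * (h * τ * r * t) * (U * X) ≤ h * τ * r * X ^ 2 + h * τ * r * t ^ 2 * U ^ 2 := by
    have : 0 ≤ h * τ * r * (X - t * U) ^ 2 := by positivity
    linarith
  have a2 : 2 * (C₁ * Θ * r * t ^ 3) * (U * X)
      ≤ h * τ * r * X ^ 2 + 1 / 8 * (τ ^ 2 * t ^ 2) * U ^ 2 := by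
    have b1 : 0 ≤ h * τ * r * (X - C₁ * Θ * t ^ 3 / (h * τ) * U) ^ 2 := by positivity
    have b2 : h * τ * r * (X - C₁ * Θ * t ^ 3 / (h * τ) * U) ^ 2 = h * τ * r * X ^ 2
        - 2 * (C₁ * Θ * r * t ^ 3) * (U * X)
        + C₁ ^ 2 * Θ ^ 2 / (h * τ) * r * t ^ 6 * U ^ 2 := by
      field_simp
      ring
    have b3 : C₁ ^ 2 * Θ ^ 2 / (h * τ) ≤ τ ^ 2 / 8 := by
      rw [div_le_iff₀ (by positivity)]
      linarith
    have b4 : C₁ ^ 2 * Θ ^ 2 / (h * τ) * r * t ^ 6 ≤ τ ^ 2 / 8 * t ^ 2 := by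
      calc C₁ ^ 2 * Θ ^ 2 / (h * τ) * r * t ^ 6 = C₁ ^ 2 * Θ ^ 2 / (h * τ) * (r * t) * t ^ 3
            * t ^ 2 := by ring
        _ ≤ τ ^ 2 / 8 * 1 * 1 * t ^ 2 := by
          gcongr
          exact pow_le_one₀ ht0.le ht1
        _ = _ := by ring
    have b5 := mul_le_mul_of_nonneg_right b4 (sq_nonneg U)
    linarith
  have a3 : h * τ * r * t ^ 2 ≤ 1 / 8 * (τ ^ 2 * t ^ 2) + 1 / 8 * (E * (2 * r + 1)) := by
    have b1 : h * τ * r * t ^ 2 ≤ τ * r * t ^ 2 := by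
      have := mul_le_mul_of_nonneg_right hh1 (by positivity : 0 ≤ τ * r * t ^ 2)
      linarith
    have hE0 : 0 ≤ E * (2 * r + 1) := by positivity
    have hτt : 0 ≤ τ * t ^ 2 := by positivity
    rcases le_total (8 * r) τ with h8 | h8
    · have := mul_le_mul_of_nonneg_left h8 hτt
      linarith
    · have b2 : τ * r * t ^ 2 ≤ 8 := by
        have b3 : τ * (r * t ^ 2) ≤ 8 * r * (r * t ^ 2) := by gcongr
        have b4 := pow_le_one₀ (by positivity) hrt (n := 2)
        linarith
      have b3 := mul_le_mul_of_nonneg_left h8 hE.le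
      have b4 : 0 ≤ τ ^ 2 * t ^ 2 := by positivity
      linarith
  have a4 : 2 * (h * τ * r) ≤ 4 * h * (r * (r + 1)) * (τ * (t - b)) := by
    have : t / 2 ≤ t - b := by linarith
    calc 2 * (h * τ * r) = 4 * h * (r * (r + 1)) * (τ * (t / 2)) := by
          linear_combination -2 * h * τ * hrsq
      _ ≤ _ := by gcongr
  have a5 := mul_le_mul_of_nonneg_right a4 (sq_nonneg X)
  have a6 := mul_le_mul_of_nonneg_right a3 (sq_nonneg U)
  linarith

theorem carleman_cross_of_le_two_mul {r t b τ h E C₁ Θ X U : ℝ} (hr : 0 < r)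
    (ht : (r + 1) * t = 1) (hh : 0 < h) (hτ : 1 ≤ τ) (hE : 0 < E) (hC₁ : 0 ≤ C₁)
    (hΘ1 : Θ ≤ 1) (hX : 0 ≤ X) (hU : 0 ≤ U) (hbτ : 64 * (b * τ ^ 2) ≤ E)
    (hCb : 64 * C₁ ^ 2 * b ≤ E * h ^ 2) (hcase : t ≤ 2 * b) :
    2 * (h * τ * r * t) * (U * X) + 2 * (C₁ * Θ * r * t ^ 3) * (U * X)
      ≤ 1 / 2 * (h ^ 2 * (2 * r + 1)) * X ^ 2 + 1 / 4 * (E * (2 * r + 1)) * U ^ 2 := by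
  have ht0 : 0 < t := pos_of_mul_pos_right (ht ▸ one_pos) (by linarith)
  have hrt : r * t ≤ 1 := by linarith
  have ht1 : t ≤ 1 := by linarith [mul_pos hr ht0]
  have hr1 : r ^ 2 * t ^ 2 / (2 * r + 1) ≤ 2 * b := by
    rw [div_le_iff₀ (by positivity)]
    have : r ^ 2 * t ^ 2 ≤ 1 := by
      rw [← mul_pow]; exact pow_le_one₀ (by positivity) hrt
    have h2 : t * (2 * r + 1) ≤ 2 * b * (2 * r + 1) := by gcongr
    linarith [mul_pos hr ht0]
  have a1 : 2 * (h * τ * r * t) * (U * X) ≤ 1 / 4 * (h ^ 2 * (2 * r + 1)) * X ^ 2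
      + 1 / 8 * (E * (2 * r + 1)) * U ^ 2 := by
    have b1 : 1 / 4 * (h ^ 2 * (2 * r + 1)) * X ^ 2
        + 4 * τ ^ 2 * (r ^ 2 * t ^ 2 / (2 * r + 1)) * U ^ 2 - 2 * (h * τ * r * t) * (U * X)
        = 1 / 4 * (2 * r + 1) * (h * X - 4 * τ * (r * t) / (2 * r + 1) * U) ^ 2 := by
      field_simp
      ring
    have b2 : 0 ≤ 1 / 4 * (2 * r + 1) * (h * X - 4 * τ * (r * t) / (2 * r + 1) * U) ^ 2 := by
      positivity
    have b3 : 4 * τ ^ 2 * (r ^ 2 * t ^ 2 / (2 * r + 1)) ≤ 1 / 8 * (E * (2 * r + 1)) := by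
      have := mul_le_mul_of_nonneg_left hr1 (by positivity : 0 ≤ 4 * τ ^ 2)
      linarith [mul_pos hE hr]
    have b4 := mul_le_mul_of_nonneg_right b3 (sq_nonneg U)
    linarith
  have a2 : 2 * (C₁ * Θ * r * t ^ 3) * (U * X) ≤ 1 / 4 * (h ^ 2 * (2 * r + 1)) * X ^ 2
      + 1 / 8 * (E * (2 * r + 1)) * U ^ 2 := by
    have b0 : 2 * (C₁ * Θ * r * t ^ 3) * (U * X) ≤ 2 * (C₁ * (r * t)) * (U * X) := by
      have : C₁ * Θ * r * t ^ 3 ≤ C₁ * (r * t) := by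
        calc C₁ * Θ * r * t ^ 3 = C₁ * (r * t) * (Θ * t ^ 2) := by ring
          _ ≤ C₁ * (r * t) * (1 * 1) := by gcongr; exact pow_le_one₀ ht0.le ht1
          _ = _ := by ring
      gcongr
    have b1 : 1 / 4 * (h ^ 2 * (2 * r + 1)) * X ^ 2
        + 4 * (C₁ / h) ^ 2 * (r ^ 2 * t ^ 2 / (2 * r + 1)) * U ^ 2
          - 2 * (C₁ * (r * t)) * (U * X)
        = 1 / 4 * (2 * r + 1) * (h * X - 4 * (C₁ / h) * (r * t) / (2 * r + 1) * U) ^ 2 := by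
      field_simp
      ring
    have b2 : 0 ≤ 1 / 4 * (2 * r + 1)
        * (h * X - 4 * (C₁ / h) * (r * t) / (2 * r + 1) * U) ^ 2 := by
      positivity
    have b3 : 4 * (C₁ / h) ^ 2 * (r ^ 2 * t ^ 2 / (2 * r + 1)) ≤ 1 / 8 * (E * (2 * r + 1)) := by
      have c1 := mul_le_mul_of_nonneg_left hr1 (by positivity : 0 ≤ 4 * (C₁ / h) ^ 2)
      have c2 : (C₁ / h) ^ 2 * (64 * b) ≤ E := by
        rw [div_pow, div_mul_eq_mul_div, div_le_iff₀ (by positivity)]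
        linarith
      linarith [mul_pos hE hr]
    have b4 := mul_le_mul_of_nonneg_right b3 (sq_nonneg U)
    linarith
  linarith

theorem carleman_form_inner {r t b τ h E cd v vθ vθ' κ κ' w c₀ C₁ Θ L X U : ℝ} (hr : 0 < r)
    (ht : (r + 1) * t = 1) (hb : 0 ≤ b) (hbt : b ≤ t) (hh : 0 < h) (hh1 : h ≤ 1) (hτ : 1 ≤ τ)
    (hw : 0 < w) (hwt : w ≤ t) (hE : 0 < E) (hcd : 0 ≤ cd) (hC₁ : 0 ≤ C₁)
    (hΘ1 : Θ ≤ 1) (hL : 0 ≤ L) (hX : 0 ≤ X) (hU : 0 ≤ U) (hv : |v - vθ| ≤ C₁ * Θ * t ^ 4)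
    (hvθ : (2 * r + 1) * vθ ≤ E / 8 * (2 * r + 1) + τ ^ 2 * t ^ 2 / 8)
    (hvθ' : |vθ'| ≤ C₁ * L * t ^ 4) (hbτ : 64 * (b * τ ^ 2) ≤ E) (hCL : C₁ * L ≤ τ ^ 2 / 8)
    (hCΘ : C₁ ^ 2 * Θ ^ 2 ≤ h * τ ^ 3 / 8) (hEτ : 256 ≤ E * τ) (hCb : 64 * C₁ ^ 2 * b ≤ E * h ^ 2)
    (hc₁ : c₀ ≤ 1 / 2) (hc₂ : c₀ ≤ E / 2)
    (hκ : κ = -(τ * (t - b)) ^ 2 + h ^ 2 * cd / r ^ 2 - E + vθ)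
    (hκ' : κ' = -2 * (τ * (t - b)) * (-(τ * t ^ 2)) - 2 * h ^ 2 * cd / r ^ 3 + vθ') :
    c₀ * w * h ^ 2 * X ^ 2 + c₀ * (1 + (τ * (t - b)) ^ 2) * w * U ^ 2
      ≤ (h ^ 2 * (2 * r + 1) + 4 * h * (r * (r + 1)) * (τ * (t - b))) * X ^ 2
        + (-(2 * r + 1) * κ - r * (r + 1) * κ') * U ^ 2
        - 2 * (r * (r + 1)) * (h * |-(τ * t ^ 2)| + |v - vθ|) * (U * X) := by
  have ht0 : 0 < t := pos_of_mul_pos_right (ht ▸ one_pos) (by linarith)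
  have ht1 : t ≤ 1 := by linarith [mul_pos hr ht0]
  have hP := mul_le_mul_of_nonneg_right (carleman_form_inner_zeroth hr ht hE hcd hC₁ hL hvθ hvθ'
    hbτ hCL hκ hκ') (sq_nonneg U)
  have hcross : 2 * (r * (r + 1)) * (h * |-(τ * t ^ 2)| + |v - vθ|) * (U * X)
      ≤ 2 * (h * τ * r * t) * (U * X) + 2 * (C₁ * Θ * r * t ^ 3) * (U * X) := by
    rw [abs_neg, abs_of_nonneg (by positivity)]
    calc 2 * (r * (r + 1)) * (h * (τ * t ^ 2) + |v - vθ|) * (U * X)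
        ≤ 2 * (r * (r + 1)) * (h * (τ * t ^ 2) + C₁ * Θ * t ^ 4) * (U * X) := by gcongr
      _ = 2 * r * ((r + 1) * t) * (h * τ * t + C₁ * Θ * t ^ 3) * (U * X) := by ring
      _ = _ := by rw [ht]; ring
  have hlow : c₀ * w * h ^ 2 * X ^ 2 + c₀ * (1 + (τ * (t - b)) ^ 2) * w * U ^ 2
      ≤ 1 / 2 * (h ^ 2 * (2 * r + 1)) * X ^ 2
        + (1 / 2 * (τ ^ 2 * t ^ 2) + 1 / 2 * (E * (2 * r + 1))) * U ^ 2 := by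
    have hw1 : w ≤ 1 := hwt.trans ht1
    have hr2 : 1 ≤ 2 * r + 1 := by linarith
    have a1 : c₀ * w * h ^ 2 ≤ 1 / 2 * (h ^ 2 * (2 * r + 1)) := by
      calc c₀ * w * h ^ 2 ≤ 1 / 2 * (2 * r + 1) * h ^ 2 := by
            gcongr
            exact hw1.trans hr2
        _ = _ := by ring
    have a2 : c₀ * w ≤ 1 / 2 * (E * (2 * r + 1)) := by
      calc c₀ * w ≤ E / 2 * (2 * r + 1) := by
            gcongr
            exact hw1.trans hr2
        _ = _ := by ring
    have a3 : c₀ * w * (τ * (t - b)) ^ 2 ≤ 1 / 2 * (τ ^ 2 * t ^ 2) := by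
      have : (τ * (t - b)) ^ 2 ≤ (τ * t) ^ 2 := by
        have : 0 ≤ t - b := by linarith
        gcongr
        linarith
      calc c₀ * w * (τ * (t - b)) ^ 2 ≤ 1 / 2 * 1 * (τ * t) ^ 2 := by gcongr
        _ = _ := by ring
    have a4 := mul_le_mul_of_nonneg_right a1 (sq_nonneg X)
    have a5 := mul_le_mul_of_nonneg_right (add_le_add a2 a3) (sq_nonneg U)
    linarith
  have p1 : 0 ≤ h ^ 2 * (2 * r + 1) * X ^ 2 := by positivity
  have p2 : 0 ≤ E * (2 * r + 1) * U ^ 2 := by positivity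
  have p3 : 0 ≤ τ ^ 2 * t ^ 2 * U ^ 2 := by positivity
  have p4 : 0 ≤ 4 * h * (r * (r + 1)) * (τ * (t - b)) * X ^ 2 := by
    have : 0 ≤ t - b := by linarith
    positivity
  rcases le_total (2 * b) t with hcase | hcase
  · have := carleman_cross_of_two_mul_le (X := X) (U := U) hr ht hh hh1 hτ hE hCΘ hEτ hcase
    linarith
  · have := carleman_cross_of_le_two_mul hr ht hh hτ hE hC₁ hΘ1 hX hU hbτ hCb hcase
    linarith

theorem carleman_form_outer {r h E cd v vθ vθ' μ κ κ' w c₀ X U : ℝ} (hr : 0 < r)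
    (hh : 0 < h) (hw : 0 < w) (hcd : 0 ≤ cd) (hμ : 0 ≤ μ)
    (hμw : r * w ≤ 2 * μ) (hvθ : vθ ≤ E / 8)
    (hvθ' : μ * |vθ'| ≤ E / 8 * w) (hv : 8 * (μ * |v - vθ|) ^ 2 ≤ E * h ^ 2 * w ^ 2)
    (hc₁ : c₀ ≤ 1 / 2) (hc₂ : c₀ ≤ E / 2)
    (hκ : κ = h ^ 2 * cd / r ^ 2 - E + vθ)
    (hκ' : κ' = - 2 * h ^ 2 * cd / r ^ 3 + vθ') :
    c₀ * w * h ^ 2 * X ^ 2 + c₀ * w * U ^ 2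
      ≤ h ^ 2 * w * X ^ 2 + (-w * κ - μ * κ') * U ^ 2 - 2 * μ * |v - vθ| * (U * X) := by
  have e1 : 2 * μ * |v - vθ| * (U * X) ≤ 1 / 2 * h ^ 2 * w * X ^ 2
      + 1 / 4 * (E * w) * U ^ 2 := by
    have b1 : 1 / 2 * h ^ 2 * w * X ^ 2 + 2 * ((μ * |v - vθ|) ^ 2 / (h ^ 2 * w)) * U ^ 2
        - 2 * μ * |v - vθ| * (U * X)
        = 1 / 2 * w * (h * X - 2 * (μ * |v - vθ|) / (h * w) * U) ^ 2 := by
      field_simp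
      ring
    have b2 : 0 ≤ 1 / 2 * w * (h * X - 2 * (μ * |v - vθ|) / (h * w) * U) ^ 2 := by positivity
    have b3 : 2 * ((μ * |v - vθ|) ^ 2 / (h ^ 2 * w)) ≤ 1 / 4 * (E * w) := by
      rw [mul_div_assoc', div_le_iff₀ (by positivity)]
      linarith
    have b4 := mul_le_mul_of_nonneg_right b3 (sq_nonneg U)
    linarith
  have e2 : 3 / 4 * (E * w) ≤ -w * κ - μ * κ' := by
    have c1 : -w * (h ^ 2 * cd / r ^ 2) + μ * (2 * h ^ 2 * cd / r ^ 3)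
        = h ^ 2 * cd / r ^ 3 * (2 * μ - r * w) := by field_simp; ring
    have c2 : 0 ≤ h ^ 2 * cd / r ^ 3 * (2 * μ - r * w) :=
      mul_nonneg (by positivity) (by linarith)
    have c3 : μ * vθ' ≤ E / 8 * w := (mul_le_mul_of_nonneg_left (le_abs_self _) hμ).trans hvθ'
    have c4 : w * vθ ≤ w * (E / 8) := by gcongr
    have c5 : -2 * h ^ 2 * cd / r ^ 3 = -(2 * h ^ 2 * cd / r ^ 3) := by ring
    rw [hκ, hκ', c5]
    linarith
  have e3 := mul_le_mul_of_nonneg_right e2 (sq_nonneg U)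
  have e4 : c₀ * (w * h ^ 2 * X ^ 2) ≤ 1 / 2 * (w * h ^ 2 * X ^ 2) := by gcongr
  have e5 : c₀ * (w * U ^ 2) ≤ E / 2 * (w * U ^ 2) := by gcongr
  linarith

section
variable {τ a r s : ℝ}

theorem phiDeriv_one_of_le (hra : r ≤ a) :
    phiDeriv 1 τ a r = τ * ((r + 1)⁻¹ - (a + 1)⁻¹) := by
  rw [phiDeriv, if_pos hra, Real.rpow_neg_one, Real.rpow_neg_one]

theorem phiDeriv_one_of_ge (hra : a ≤ r) : phiDeriv 1 τ a r = 0 := by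
  rw [phiDeriv]
  split_ifs with h
  · rw [le_antisymm h hra]; ring
  · rfl

theorem phiDeriv_one_eq (r : ℝ) :
    phiDeriv 1 τ a r = τ * ((min r a + 1)⁻¹ - (a + 1)⁻¹) := by
  rcases le_total r a with h | h
  · rw [min_eq_left h, phiDeriv, if_pos h, Real.rpow_neg_one, Real.rpow_neg_one]
  · rw [min_eq_right h, phiDeriv_one_of_ge h]; ring

theorem phiDeriv_one_nonneg (hτ : 0 ≤ τ) (ha : 0 ≤ a) (hr : 0 ≤ r) : 0 ≤ phiDeriv 1 τ a r := by
  rw [phiDeriv_one_eq]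
  have h1 : 0 ≤ min r a := le_min hr ha
  have : (a + 1)⁻¹ ≤ (min r a + 1)⁻¹ := by gcongr; exact min_le_right _ _
  exact mul_nonneg hτ (by linarith)

theorem phiDeriv_one_le (hτ : 0 ≤ τ) (ha : 0 ≤ a) (hr : 0 ≤ r) : phiDeriv 1 τ a r ≤ τ := by
  rw [phiDeriv_one_eq]
  have h1 : 0 ≤ min r a := le_min hr ha
  have h2 : (min r a + 1)⁻¹ ≤ 1 := inv_le_one_of_one_le₀ (by linarith)
  have h3 : 0 ≤ (a + 1)⁻¹ := by positivity
  exact mul_le_of_le_one_right hτ (by linarith)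

theorem continuousAt_phiDeriv_one (ha : 0 ≤ a) (hr : 0 ≤ r) :
    ContinuousAt (phiDeriv 1 τ a) r := by
  have h1 : 0 ≤ min r a := le_min hr ha
  have h2 : min r a + 1 ≠ 0 := by positivity
  rw [show phiDeriv 1 τ a = fun r => τ * ((min r a + 1)⁻¹ - (a + 1)⁻¹) from
    funext phiDeriv_one_eq]
  fun_prop (disch := assumption)

theorem measurable_phiDeriv_one : Measurable (phiDeriv 1 τ a) := by
  rw [show phiDeriv 1 τ a = fun r => τ * ((min r a + 1)⁻¹ - (a + 1)⁻¹) from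
    funext phiDeriv_one_eq]
  fun_prop

theorem hasDerivAt_phi_one (ha : 0 ≤ a) (hr : 0 < r) :
    HasDerivAt (phi 1 τ a) (phiDeriv 1 τ a r) r := by
  refine intervalIntegral.integral_hasDerivAt_right ?_
    (measurable_phiDeriv_one.stronglyMeasurable.stronglyMeasurableAtFilter)
    (continuousAt_phiDeriv_one ha hr.le)
  apply ContinuousOn.intervalIntegrable
  intro t ht
  rw [Set.uIcc_of_le hr.le] at ht
  exact (continuousAt_phiDeriv_one ha ht.1).continuousWithinAt

theorem phi_one_le (hτ : 0 ≤ τ) (ha : 0 ≤ a) (hr : 0 ≤ r) : phi 1 τ a r ≤ τ * r := by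
  have h := intervalIntegral.norm_integral_le_of_norm_le_const (a := 0) (b := r) (C := τ)
    (f := phiDeriv 1 τ a) fun t ht => by
      rw [Set.uIoc_of_le hr] at ht
      rw [Real.norm_of_nonneg (phiDeriv_one_nonneg hτ ha ht.1.le)]
      exact phiDeriv_one_le hτ ha ht.1.le
  rw [sub_zero, abs_of_nonneg hr] at h
  exact (le_abs_self _).trans h

theorem continuousOn_phi_one (ha : 0 ≤ a) : ContinuousOn (phi 1 τ a) (Set.Ici 0) := by
  have key : ContinuousOn (phiDeriv 1 τ a) (Set.Ici 0) := fun t ht =>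
    (continuousAt_phiDeriv_one ha ht).continuousWithinAt
  intro r hr
  have h := intervalIntegral.continuousOn_primitive_interval' (f := phiDeriv 1 τ a)
    (μ := volume) (a := 0) (b₁ := 0) (b₂ := r + 1)
    ((key.mono (by
      rw [Set.uIcc_of_le (by linarith [Set.mem_Ici.1 hr])]
      exact Set.Icc_subset_Ici_self)).intervalIntegrable) (by simp)
  rw [Set.uIcc_of_le (by linarith [Set.mem_Ici.1 hr])] at h
  have h2 := h r ⟨hr, by linarith⟩
  refine h2.mono_of_mem_nhdsWithin ?_
  rw [mem_nhdsWithin]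
  exact ⟨Set.Iio (r + 1), isOpen_Iio, by simp, fun x hx => ⟨hx.2, (Set.mem_Iio.1 hx.1).le⟩⟩

/-- The right derivative of `phiDeriv 1 τ a`. -/
noncomputable def phiDerivRight (τ a r : ℝ) : ℝ :=
  if r < a then -(τ * (r + 1)⁻¹ ^ 2) else 0

theorem hasDerivWithinAt_phiDeriv_one (hr : 0 < r) :
    HasDerivWithinAt (phiDeriv 1 τ a) (phiDerivRight τ a r) (Set.Ioi r) r := by
  unfold phiDerivRight
  split_ifs with h
  · have h0 : r + 1 ≠ 0 := by positivity
    have h1 : HasDerivAt (fun r => τ * ((r + 1)⁻¹ - (a + 1)⁻¹)) (-(τ * (r + 1)⁻¹ ^ 2)) r := by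
      have := (((hasDerivAt_id r).add_const 1).fun_inv h0).sub_const (a + 1)⁻¹ |>.const_mul τ
      convert! this using 1
      simp [div_eq_mul_inv]
    refine (h1.congr_of_eventuallyEq ?_).hasDerivWithinAt
    filter_upwards [Ioo_mem_nhds hr h] with x hx using phiDeriv_one_of_le hx.2.le
  · exact (hasDerivWithinAt_const r (Set.Ioi r) (0:ℝ)).congr
      (fun y hy => phiDeriv_one_of_ge ((not_lt.1 h).trans (Set.mem_Ioi.1 hy).le))
      (phiDeriv_one_of_ge (not_lt.1 h))

/-- The radial multiplier of the Carleman estimate. -/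
noncomputable def carlemanMul (s a r : ℝ) : ℝ :=
  min r a * (min r a + 1) + ((a + 1) ^ (1 - 2 * s) - (max r a + 1) ^ (1 - 2 * s)) / (2 * s - 1)

/-- The right derivative of `carlemanMul`. -/
noncomputable def carlemanMulRight (s a r : ℝ) : ℝ :=
  if r < a then 2 * r + 1 else (r + 1) ^ (-(2 * s))

theorem carlemanMul_of_le (h : r ≤ a) : carlemanMul s a r = r * (r + 1) := by
  simp [carlemanMul, h]

theorem carlemanMul_of_ge (h : a ≤ r) : carlemanMul s a r
    = a * (a + 1) + ((a + 1) ^ (1 - 2 * s) - (r + 1) ^ (1 - 2 * s)) / (2 * s - 1) := by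
  simp [carlemanMul, h]

theorem measurable_carlemanMul : Measurable (carlemanMul s a) := by
  unfold carlemanMul
  fun_prop

theorem continuous_carlemanMul (ha : 0 < a) : Continuous (carlemanMul s a) := by
  unfold carlemanMul
  have : ∀ r, max r a + 1 ≠ 0 ∨ 0 ≤ 1 - 2 * s := fun r => Or.inl (by
    have := le_max_right r a
    positivity)
  have h2 : Continuous fun r => (max r a + 1) ^ (1 - 2 * s) :=
    Continuous.rpow_const (by fun_prop) this
  fun_prop

theorem hasDerivWithinAt_carlemanMul (hs : 1 / 2 < s) (hr : 0 < r) :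
    HasDerivWithinAt (carlemanMul s a) (carlemanMulRight s a r) (Set.Ioi r) r := by
  unfold carlemanMulRight
  split_ifs with h
  · have h1 : HasDerivAt (fun r : ℝ => r * (r + 1)) (2 * r + 1) r := by
      convert! (hasDerivAt_id r).mul ((hasDerivAt_id r).add_const 1) using 1
      simp; ring
    refine (h1.congr_of_eventuallyEq ?_).hasDerivWithinAt
    filter_upwards [Iio_mem_nhds h] with x hx using carlemanMul_of_le (Set.mem_Iio.1 hx).le
  · have h0 : r + 1 ≠ 0 := by positivity
    have h2 : 2 * s - 1 ≠ 0 := by linarith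
    have h1 : HasDerivAt (fun r : ℝ => a * (a + 1)
        + ((a + 1) ^ (1 - 2 * s) - (r + 1) ^ (1 - 2 * s)) / (2 * s - 1))
        ((r + 1) ^ (-(2 * s))) r := by
      have := ((((((hasDerivAt_id r).add_const 1).rpow_const (p := 1 - 2 * s)
        (Or.inl h0)).const_sub ((a + 1) ^ (1 - 2 * s))).div_const (2 * s - 1)).const_add
          (a * (a + 1)))
      convert! this using 1
      rw [show 1 - 2 * s - 1 = -(2 * s) by ring]
      simp only [id]
      field_simp
      ring
    exact h1.hasDerivWithinAt.congr
      (fun y hy => carlemanMul_of_ge ((not_lt.1 h).trans (Set.mem_Ioi.1 hy).le))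
      (carlemanMul_of_ge (not_lt.1 h))

theorem rpow_sub_div_nonneg (hs : 1 / 2 < s) (ha : 0 < a) (h : a ≤ r) :
    0 ≤ ((a + 1) ^ (1 - 2 * s) - (r + 1) ^ (1 - 2 * s)) / (2 * s - 1) := by
  have : (r + 1) ^ (1 - 2 * s) ≤ (a + 1) ^ (1 - 2 * s) :=
    Real.rpow_le_rpow_of_nonpos (by linarith) (by linarith) (by linarith)
  exact div_nonneg (by linarith) (by linarith)

theorem carlemanMul_nonneg (hs : 1 / 2 < s) (ha : 0 < a) (hr : 0 ≤ r) :
    0 ≤ carlemanMul s a r := by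
  rcases le_total r a with h | h
  · rw [carlemanMul_of_le h]; positivity
  · rw [carlemanMul_of_ge h]
    have := rpow_sub_div_nonneg hs ha h
    positivity

theorem mul_carlemanMulRight_le (hs : 1 / 2 < s) (ha : 1 ≤ a) (hr : 0 < r) :
    r * carlemanMulRight s a r ≤ 2 * carlemanMul s a r := by
  unfold carlemanMulRight
  split_ifs with h
  · rw [carlemanMul_of_le h.le]; nlinarith
  · rw [carlemanMul_of_ge (not_lt.1 h)]
    have h1 := rpow_sub_div_nonneg hs (by linarith) (not_lt.1 h)
    have h2 : r * (r + 1) ^ (-(2 * s)) ≤ 1 := by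
      calc r * (r + 1) ^ (-(2 * s)) ≤ (r + 1) * (r + 1) ^ (-(2 * s)) := by gcongr; linarith
        _ = (r + 1) ^ (1 + -(2 * s)) := by
          rw [Real.rpow_add (by linarith), Real.rpow_one]
        _ ≤ 1 := Real.rpow_le_one_of_one_le_of_nonpos (by linarith) (by linarith)
    nlinarith

theorem carlemanMul_le (hs : 1 / 2 < s) (ha : 1 ≤ a) (hr : 0 < r) :
    carlemanMul s a r ≤ (2 + 1 / (2 * s - 1)) * a ^ 2 := by
  have h0 : 0 < 1 / (2 * s - 1) := one_div_pos.2 (by linarith)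
  have h1 : 1 ≤ a ^ 2 := one_le_pow₀ ha
  rcases le_total r a with h | h
  · rw [carlemanMul_of_le h]; nlinarith
  · rw [carlemanMul_of_ge h]
    have h2 : ((a + 1) ^ (1 - 2 * s) - (r + 1) ^ (1 - 2 * s)) / (2 * s - 1)
        ≤ 1 / (2 * s - 1) := by
      have h3 : (a + 1) ^ (1 - 2 * s) ≤ 1 :=
        Real.rpow_le_one_of_one_le_of_nonpos (by linarith) (by linarith)
      have h4 : 0 ≤ (r + 1) ^ (1 - 2 * s) := by positivity
      gcongr
      · linarith
      · linarith
    nlinarith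

theorem carlemanMul_le_mul (hs : 1 / 2 < s) (ha : 1 ≤ a) (hr : 0 < r) :
    carlemanMul s a r ≤ (2 + 1 / (2 * s - 1)) * a ^ 2 * r := by
  have h0 : 0 < 1 / (2 * s - 1) := one_div_pos.2 (by linarith)
  have h1 : 1 ≤ a ^ 2 := one_le_pow₀ ha
  rcases le_total r 1 with h | h
  · rw [carlemanMul_of_le (h.trans ha)]
    have : 2 * 1 ≤ (2 + 1 / (2 * s - 1)) * a ^ 2 := by gcongr; linarith
    nlinarith
  · refine (carlemanMul_le hs ha hr).trans (le_mul_of_one_le_right (by positivity) h)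
end

section
variable {g : ℝ → ℝ} {θ r : ℝ}

/-- The average of `g` over `[r, r + θ]`. -/
noncomputable def forwardAverage (θ : ℝ) (g : ℝ → ℝ) (r : ℝ) : ℝ :=
  θ⁻¹ * ∫ t in r..r + θ, g t

theorem hasDerivAt_forwardAverage (hg : Continuous g) (θ r : ℝ) :
    HasDerivAt (forwardAverage θ g) (θ⁻¹ * (g (r + θ) - g r)) r := by
  have h1 : HasDerivAt (fun r => ∫ t in (0:ℝ)..r, g t) (g r) r :=
    hg.integral_hasStrictDerivAt 0 r |>.hasDerivAt
  have h2 : HasDerivAt (fun r => ∫ t in (0:ℝ)..r + θ, g t) (g (r + θ)) r :=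
    (hg.integral_hasStrictDerivAt 0 (r + θ)).hasDerivAt.comp_add_const r θ
  have h3 := (h2.sub h1).const_mul θ⁻¹
  refine h3.congr_of_eventuallyEq (Filter.Eventually.of_forall fun x => ?_)
  simp only [forwardAverage, Pi.sub_apply]
  rw [intervalIntegral.integral_interval_sub_left (hg.intervalIntegrable _ _)
    (hg.intervalIntegrable _ _)]

theorem forwardAverage_le {p : ℝ} (hg : Continuous g) (hθ : 0 < θ)
    (h : ∀ t, r ≤ t → g t ≤ p) : forwardAverage θ g r ≤ p := by
  have h1 : ∫ t in r..r + θ, g t ≤ ∫ t in r..r + θ, p :=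
    intervalIntegral.integral_mono_on (by linarith) (hg.intervalIntegrable _ _)
      (continuous_const.intervalIntegrable _ _) fun t ht => h t ht.1
  rw [intervalIntegral.integral_const, add_sub_cancel_left, smul_eq_mul] at h1
  calc forwardAverage θ g r ≤ θ⁻¹ * (θ * p) := by unfold forwardAverage; gcongr
    _ = p := by field_simp

theorem abs_sub_forwardAverage_le {K : ℝ} (hg : Continuous g) (hθ : 0 < θ)
    (h : ∀ t, r < t → t ≤ r + θ → |g r - g t| ≤ K) : |g r - forwardAverage θ g r| ≤ K := by
  have h1 : g r - forwardAverage θ g r = θ⁻¹ * ∫ t in r..r + θ, (g r - g t) := by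
    rw [intervalIntegral.integral_sub (continuous_const.intervalIntegrable _ _)
      (hg.intervalIntegrable _ _), intervalIntegral.integral_const, add_sub_cancel_left,
      smul_eq_mul, forwardAverage]
    field_simp
  have h2 := intervalIntegral.norm_integral_le_of_norm_le_const (a := r) (b := r + θ) (C := K)
    (f := fun t => g r - g t) fun t ht => by
      rw [Set.uIoc_of_le (by linarith)] at ht
      exact h t ht.1 ht.2
  rw [add_sub_cancel_left, abs_of_pos hθ, Real.norm_eq_abs] at h2
  rw [h1, abs_mul, abs_of_pos (inv_pos.2 hθ)]
  calc θ⁻¹ * |∫ t in r..r + θ, (g r - g t)| ≤ θ⁻¹ * (K * θ) := by gcongr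
    _ = K := by field_simp
end

section
open ComplexConjugate Asymptotics Topology

/-- The weight `r ^ m * exp (φ / h)` turning the conjugated radial Laplacian into a
one-dimensional operator. -/
noncomputable def rayWeight (m h τ a r : ℝ) : ℝ := r ^ m * Real.exp (phi 1 τ a r / h)

/-- The logarithmic derivative of `rayWeight`. -/
noncomputable def raySlope (m h τ a r : ℝ) : ℝ := m / r + phiDeriv 1 τ a r / h

noncomputable def dressed (m h τ a : ℝ) (F : ℝ → ℂ) (r : ℝ) : ℂ := rayWeight m h τ a r * F r

noncomputable def dressedDeriv (m h τ a : ℝ) (F F₁ : ℝ → ℂ) (r : ℝ) : ℂ :=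
  rayWeight m h τ a r * (F₁ r + raySlope m h τ a r * F r)

variable {m h τ a r : ℝ} {F F₁ : ℝ → ℂ} {F₂ : ℂ}

theorem hasDerivAt_rayWeight (ha : 0 ≤ a) (hr : 0 < r) :
    HasDerivAt (rayWeight m h τ a) (rayWeight m h τ a r * raySlope m h τ a r) r := by
  have h1 := (Real.hasDerivAt_rpow_const (x := r) (p := m) (Or.inl hr.ne')).mul
    ((hasDerivAt_phi_one (τ := τ) ha hr).div_const h).exp
  convert! h1 using 1
  rw [rayWeight, raySlope, Real.rpow_sub_one hr.ne']
  ring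

theorem hasDerivWithinAt_raySlope (hr : 0 < r) :
    HasDerivWithinAt (raySlope m h τ a) (-m / r ^ 2 + phiDerivRight τ a r / h)
      (Set.Ioi r) r := by
  have h1 := ((hasDerivAt_inv hr.ne').const_mul m).hasDerivWithinAt (s := Set.Ioi r)
  have h2 := h1.add ((hasDerivWithinAt_phiDeriv_one (τ := τ) (a := a) hr).div_const h)
  convert! h2 using 1
  ring

theorem hasDerivAt_dressed (ha : 0 ≤ a) (hr : 0 < r) (hF : HasDerivAt F (F₁ r) r) :
    HasDerivAt (dressed m h τ a F) (dressedDeriv m h τ a F F₁ r) r := by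
  have h1 := (hasDerivAt_rayWeight (m := m) (h := h) (τ := τ) ha hr).ofReal_comp.mul hF
  convert! h1 using 1
  rw [dressedDeriv]
  push_cast
  ring

theorem hasDerivWithinAt_dressedDeriv (ha : 0 ≤ a) (hr : 0 < r) (hF : HasDerivAt F (F₁ r) r)
    (hF₁ : HasDerivAt F₁ F₂ r) :
    HasDerivWithinAt (dressedDeriv m h τ a F F₁)
      (rayWeight m h τ a r * (F₂ + 2 * raySlope m h τ a r * F₁ r
        + ((raySlope m h τ a r ^ 2 + (-m / r ^ 2 + phiDerivRight τ a r / h) : ℝ) : ℂ) * F r))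
      (Set.Ioi r) r := by
  have h1 : HasDerivWithinAt (fun r => (rayWeight m h τ a r : ℂ)) _ (Set.Ioi r) r :=
    (hasDerivAt_rayWeight (m := m) (h := h) (τ := τ) ha hr).ofReal_comp.hasDerivWithinAt
  have h2 : HasDerivWithinAt (fun r => (raySlope m h τ a r : ℂ)) _ (Set.Ioi r) r :=
    (hasDerivWithinAt_raySlope (m := m) (h := h) (τ := τ) (a := a) hr).ofReal_comp
  have h3 := h1.mul (hF₁.hasDerivWithinAt.add (h2.mul hF.hasDerivWithinAt))
  convert! h3 using 1
  simp only [Pi.add_apply, Pi.mul_apply]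
  push_cast
  ring

theorem continuousAt_raySlope (ha : 0 ≤ a) (hr : 0 < r) :
    ContinuousAt (raySlope m h τ a) r := by
  have h1 := continuousAt_phiDeriv_one (τ := τ) ha hr.le
  exact (continuousAt_const.div continuousAt_id hr.ne').add (h1.div_const h)

theorem continuousAt_dressedDeriv (ha : 0 ≤ a) (hr : 0 < r) (hF : ContinuousAt F r)
    (hF₁ : ContinuousAt F₁ r) : ContinuousAt (dressedDeriv m h τ a F F₁) r :=
  (Complex.continuous_ofReal.continuousAt.comp (hasDerivAt_rayWeight ha hr).continuousAt).mul
    (hF₁.add ((Complex.continuous_ofReal.continuousAt.comp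
      (continuousAt_raySlope ha hr)).mul hF))

theorem isBigO_one_of_continuousAt {E : Type*} [NormedAddCommGroup E] {g : ℝ → E}
    (hg : ContinuousAt g 0) : g =O[𝓝[>] 0] fun _ => (1:ℝ) :=
  (hg.tendsto.isBigO_one ℝ).mono nhdsWithin_le_nhds

theorem isBigO_rayWeight (hm : 1 ≤ m) (ha : 0 ≤ a) :
    rayWeight m h τ a =O[𝓝[>] 0] fun r => r := by
  have h1 : (fun r : ℝ => r ^ m) =O[𝓝[>] 0] fun r => r := by
    refine IsBigO.of_bound 1 ?_
    filter_upwards [Ioo_mem_nhdsGT (zero_lt_one' ℝ)] with r hr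
    rw [Real.norm_of_nonneg (Real.rpow_nonneg hr.1.le _), Real.norm_of_nonneg hr.1.le, one_mul]
    simpa using Real.rpow_le_rpow_of_exponent_ge hr.1 hr.2.le hm
  have h2 : (fun r => Real.exp (phi 1 τ a r / h)) =O[𝓝[>] 0] fun _ => (1:ℝ) := by
    have : ContinuousWithinAt (fun r => Real.exp (phi 1 τ a r / h)) (Set.Ici 0) 0 :=
      (((continuousOn_phi_one ha) 0 (by simp)).div_const h).rexp
    exact (this.tendsto.isBigO_one ℝ).mono (nhdsWithin_mono _ Set.Ioi_subset_Ici_self)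
  refine (h1.mul h2).congr_right fun r => mul_one r

theorem isBigO_raySlope (ha : 0 ≤ a) : raySlope m h τ a =O[𝓝[>] 0] fun r => r⁻¹ := by
  have h1 : (fun r : ℝ => m / r) =O[𝓝[>] 0] fun r => r⁻¹ := by
    simp only [div_eq_mul_inv]
    exact (isBigO_refl _ _).const_mul_left m
  have h2 : (fun r => phiDeriv 1 τ a r / h) =O[𝓝[>] 0] fun _ => (1:ℝ) :=
    isBigO_one_of_continuousAt ((continuousAt_phiDeriv_one ha le_rfl).div_const h)
  refine h1.add (h2.trans (IsBigO.of_bound 1 ?_))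
  filter_upwards [Ioo_mem_nhdsGT (zero_lt_one' ℝ)] with r hr
  rw [norm_one, one_mul, Real.norm_of_nonneg (inv_nonneg.2 hr.1.le)]
  exact (one_le_inv₀ hr.1).2 hr.2.le

theorem isBigO_dressed (hm : 1 ≤ m) (ha : 0 ≤ a) (hF : ContinuousAt F 0) :
    dressed m h τ a F =O[𝓝[>] 0] fun r => r := by
  have h1 : (fun r => (rayWeight m h τ a r : ℂ)) =O[𝓝[>] 0] fun r => r :=
    (isBigO_rayWeight hm ha).norm_left.congr_left
      (fun r => (Complex.norm_real _).symm) |>.of_norm_left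
  exact (h1.mul (isBigO_one_of_continuousAt hF)).congr_right fun r => mul_one r

theorem isBigO_dressedDeriv (hm : 1 ≤ m) (ha : 0 ≤ a) (hF : ContinuousAt F 0)
    (hF₁ : ContinuousAt F₁ 0) : dressedDeriv m h τ a F F₁ =O[𝓝[>] 0] fun _ => (1:ℝ) := by
  have h1 := isBigO_dressed (h := h) (τ := τ) hm ha hF
  have h2 := isBigO_dressed (h := h) (τ := τ) hm ha hF₁
  have h3 : (fun r => (raySlope m h τ a r : ℂ)) =O[𝓝[>] 0] fun r => r⁻¹ :=
    (isBigO_raySlope ha).norm_left.congr_left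
      (fun r => (Complex.norm_real _).symm) |>.of_norm_left
  have h4 : (fun r : ℝ => r) =O[𝓝[>] 0] fun _ => (1:ℝ) :=
    isBigO_one_of_continuousAt continuousAt_id
  have h5 : (fun r : ℝ => r⁻¹ * r) =O[𝓝[>] 0] fun _ => (1:ℝ) :=
    IsBigO.of_bound 1 (by
      filter_upwards [self_mem_nhdsWithin] with r hr
      rw [inv_mul_cancel₀ (Set.mem_Ioi.1 hr).ne', one_mul])
  refine ((h2.trans h4).add ((h3.mul h1).trans h5)).congr_left fun r => ?_
  simp only [dressed, dressedDeriv]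
  ring

theorem isBigO_re_mul_conj {u v : ℝ → ℂ} {f g : ℝ → ℝ} {l : Filter ℝ} (hu : u =O[l] f)
    (hv : v =O[l] g) : (fun r => (u r * conj (v r)).re) =O[l] fun r => f r * g r := by
  refine IsBigO.trans (IsBigO.of_bound 1 (Filter.Eventually.of_forall fun r => ?_))
    (hu.norm_left.mul hv.norm_left)
  rw [one_mul, norm_mul, norm_norm, norm_norm]
  exact abs_re_mul_conj_le _ _

theorem isBigO_carlemanMul {s : ℝ} (ha : 0 < a) :
    carlemanMul s a =O[𝓝[>] 0] fun r => r := by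
  refine IsBigO.of_bound (a + 1) ?_
  filter_upwards [Ioo_mem_nhdsGT ha] with r hr
  have := hr.1
  rw [carlemanMul_of_le hr.2.le, Real.norm_of_nonneg (by positivity), Real.norm_of_nonneg hr.1.le]
  nlinarith [hr.2]
end

section
open ComplexConjugate Asymptotics Topology

/-- The potential of the flux functional on a ray, with the averaged potential `vθ`. -/
noncomputable def rayPotential (h τ a E cd : ℝ) (vθ : ℝ → ℝ) (r : ℝ) : ℝ :=
  -phiDeriv 1 τ a r ^ 2 + h ^ 2 * cd / r ^ 2 - E + vθ r

/-- The right derivative of `rayPotential`. -/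
noncomputable def rayPotentialRight (h τ a cd : ℝ) (vθ' : ℝ → ℝ) (r : ℝ) : ℝ :=
  -2 * phiDeriv 1 τ a r * phiDerivRight τ a r - 2 * h ^ 2 * cd / r ^ 3 + vθ' r

/-- Positivity of the quadratic form produced by differentiating the flux functional. -/
def CarlemanForm (s h τ a E c₀ cd : ℝ) (v vθ vθ' : ℝ → ℝ) : Prop :=
  ∀ r > 0, ∀ X U : ℝ, 0 ≤ X → 0 ≤ U →
    c₀ * (r + 1) ^ (-(2 * s)) * h ^ 2 * X ^ 2
      + c₀ * (1 + phiDeriv 1 τ a r ^ 2) * (r + 1) ^ (-(2 * s)) * U ^ 2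
    ≤ (h ^ 2 * carlemanMulRight s a r + 4 * h * carlemanMul s a r * phiDeriv 1 τ a r) * X ^ 2
      + (-carlemanMulRight s a r * rayPotential h τ a E cd vθ r
        - carlemanMul s a r * rayPotentialRight h τ a cd vθ' r) * U ^ 2
      - 2 * carlemanMul s a r * (h * |phiDerivRight τ a r| + |v r - vθ r|) * (U * X)

/-- The flux functional along a ray. -/
noncomputable def rayFlux (m s h τ a E c₀ cd B : ℝ) (vθ : ℝ → ℝ) (F F₁ : ℝ → ℂ) (r : ℝ) : ℝ :=
  carlemanMul s a r
      * (-h ^ 2 * (dressedDeriv m h τ a F F₁ r * conj (dressedDeriv m h τ a F F₁ r)).re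
        + rayPotential h τ a E cd vθ r
          * (dressed m h τ a F r * conj (dressed m h τ a F r)).re)
    + B * (-h ^ 2 * (dressedDeriv m h τ a F F₁ r * conj (dressed m h τ a F r)).re
        + h * (phiDeriv 1 τ a r * (dressed m h τ a F r * conj (dressed m h τ a F r)).re))
    + c₀ / 8 * h ^ 2 * ((r + 1) ^ (-(2 * s)) / r
        * (dressed m h τ a F r * conj (dressed m h τ a F r)).re)

variable {m s h τ a E c₀ cd B : ℝ} {vθ : ℝ → ℝ} {F F₁ : ℝ → ℂ}

theorem continuousAt_rayFlux {r : ℝ} (ha : 0 < a) (hr : 0 < r) (hvθ : ContinuousAt vθ r)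
    (hF : HasDerivAt F (F₁ r) r) (hF₁ : ContinuousAt F₁ r) :
    ContinuousAt (rayFlux m s h τ a E c₀ cd B vθ F F₁) r := by
  have h1 := (hasDerivAt_dressed (m := m) (h := h) (τ := τ) ha.le hr hF).continuousAt
  have h2 := continuousAt_dressedDeriv (m := m) (h := h) (τ := τ) ha.le hr hF.continuousAt hF₁
  have h3 := (continuous_carlemanMul (s := s) ha).continuousAt (x := r)
  have h4 := continuousAt_phiDeriv_one (τ := τ) ha.le hr.le
  have h5 : ContinuousAt (rayPotential h τ a E cd vθ) r :=
    (((h4.pow 2).neg.add (continuousAt_const.div (continuousAt_id.pow 2)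
      (pow_ne_zero 2 hr.ne'))).sub continuousAt_const).add hvθ
  have h6 : ContinuousAt (fun r : ℝ => (r + 1) ^ (-(2 * s)) / r) r :=
    ((continuousAt_id.add continuousAt_const).rpow_const (Or.inl (by
      show r + 1 ≠ 0
      positivity))).div continuousAt_id hr.ne'
  have hre : ∀ {u v : ℝ → ℂ}, ContinuousAt u r → ContinuousAt v r →
      ContinuousAt (fun r => (u r * conj (v r)).re) r := fun hu hv =>
    Complex.continuous_re.continuousAt.comp
      (hu.mul (Complex.continuous_conj.continuousAt.comp hv))
  exact ((h3.mul ((continuousAt_const.mul (hre h2 h2)).add (h5.mul (hre h1 h1)))).add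
    (continuousAt_const.mul ((continuousAt_const.mul (hre h2 h1)).add
      (continuousAt_const.mul (h4.mul (hre h1 h1)))))).add
    (continuousAt_const.mul (h6.mul (hre h1 h1)))

theorem tendsto_rayFlux (hm : 1 ≤ m) (ha : 0 < a) (hvθ : ContinuousAt vθ 0)
    (hF : ContinuousAt F 0) (hF₁ : ContinuousAt F₁ 0) :
    Filter.Tendsto (rayFlux m s h τ a E c₀ cd B vθ F F₁) (𝓝[>] 0) (𝓝 0) := by
  have h1 := isBigO_dressed (h := h) (τ := τ) hm ha.le hF
  have h2 := isBigO_dressedDeriv (h := h) (τ := τ) hm ha.le hF hF₁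
  have h3 := isBigO_carlemanMul (s := s) ha
  have h4 := isBigO_one_of_continuousAt (continuousAt_phiDeriv_one (τ := τ) ha.le le_rfl)
  have hr1 : (fun r : ℝ => r) =O[𝓝[>] 0] fun _ => (1:ℝ) :=
    isBigO_one_of_continuousAt continuousAt_id
  have hpos : ∀ᶠ r : ℝ in 𝓝[>] 0, r ∈ Set.Ioo (0:ℝ) 1 := Ioo_mem_nhdsGT zero_lt_one
  have h5 : rayPotential h τ a E cd vθ =O[𝓝[>] 0] fun r => (r ^ 2)⁻¹ := by
    have e1 : (fun _ : ℝ => (1:ℝ)) =O[𝓝[>] 0] fun r : ℝ => (r ^ 2)⁻¹ := by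
      refine IsBigO.of_bound 1 (hpos.mono fun r hr => ?_)
      rw [norm_one, one_mul, Real.norm_of_nonneg (by positivity)]
      exact (one_le_inv₀ (pow_pos hr.1 2)).2 (pow_le_one₀ hr.1.le hr.2.le)
    have e2 : (fun r : ℝ => h ^ 2 * cd / r ^ 2) =O[𝓝[>] 0] fun r : ℝ => (r ^ 2)⁻¹ := by
      simp only [div_eq_mul_inv]
      exact (isBigO_refl _ _).const_mul_left _
    have e3 : (fun r => phiDeriv 1 τ a r ^ 2) =O[𝓝[>] 0] fun _ => (1:ℝ) := by
      simpa using h4.pow 2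
    exact (((e3.neg_left.trans e1).add e2).sub ((isBigO_const_const E one_ne_zero _).trans e1)).add
      ((isBigO_one_of_continuousAt hvθ).trans e1)
  have h6 : (fun r : ℝ => (r + 1) ^ (-(2 * s)) / r) =O[𝓝[>] 0] fun r => r⁻¹ := by
    have : (fun r : ℝ => (r + 1) ^ (-(2 * s))) =O[𝓝[>] 0] fun _ => (1:ℝ) :=
      isBigO_one_of_continuousAt ((continuousAt_id.add continuousAt_const).rpow_const
        (Or.inl (by simp)))
    simpa [div_eq_mul_inv] using this.mul (isBigO_refl (fun r : ℝ => r⁻¹) _)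
  have h11 := isBigO_re_mul_conj h1 h1
  have h21 := isBigO_re_mul_conj h2 h1
  have h22 := isBigO_re_mul_conj h2 h2
  have c1 : (fun r : ℝ => (r ^ 2)⁻¹ * (r * r)) =O[𝓝[>] 0] fun _ => (1:ℝ) * 1 :=
    IsBigO.of_bound 1 (hpos.mono fun r hr => by
      have := hr.1.ne'
      rw [show (r ^ 2)⁻¹ * (r * r) = 1 by field_simp]; simp)
  have c2 : (fun r : ℝ => r⁻¹ * (r * r)) =O[𝓝[>] 0] fun r => r :=
    IsBigO.of_bound 1 (hpos.mono fun r hr => by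
      have := hr.1.ne'
      rw [show r⁻¹ * (r * r) = r by field_simp]; simp)
  have c3 : (fun r : ℝ => (1:ℝ) * (r * r)) =O[𝓝[>] 0] fun r => 1 * r := by
    simpa using hr1.mul (isBigO_refl (fun r : ℝ => r) _)
  have key : rayFlux m s h τ a E c₀ cd B vθ F F₁ =O[𝓝[>] 0] fun r => r := by
    have t1 := h3.mul ((h22.const_mul_left (-h ^ 2)).add ((h5.mul h11).trans c1))
    have t2 := ((h21.const_mul_left (-h ^ 2)).add
      (((h4.mul h11).trans c3).const_mul_left h)).const_mul_left B
    have t3 := ((h6.mul h11).trans c2).const_mul_left (c₀ / 8 * h ^ 2)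
    simp only [one_mul, mul_one] at t1 t2 t3
    exact (t1.add t2).add t3
  exact key.trans_tendsto (tendsto_nhdsWithin_of_tendsto_nhds Filter.tendsto_id)

theorem hasDerivWithinAt_rayFlux {vθ' : ℝ → ℝ} {u₂ : ℂ} {r : ℝ} (hs : 1 / 2 < s) (ha : 0 < a)
    (hr : 0 < r) (hvθ : HasDerivAt vθ (vθ' r) r) (hF : HasDerivAt F (F₁ r) r)
    (hu₂ : HasDerivWithinAt (dressedDeriv m h τ a F F₁) u₂ (Set.Ioi r) r) :
    HasDerivWithinAt (rayFlux m s h τ a E c₀ cd B vθ F F₁)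
      (carlemanMulRight s a r
        * (-h ^ 2 * (dressedDeriv m h τ a F F₁ r * conj (dressedDeriv m h τ a F F₁ r)).re
          + rayPotential h τ a E cd vθ r
            * (dressed m h τ a F r * conj (dressed m h τ a F r)).re)
      + carlemanMul s a r
        * (-h ^ 2 * ((u₂ * conj (dressedDeriv m h τ a F F₁ r)).re
            + (dressedDeriv m h τ a F F₁ r * conj u₂).re)
          + (rayPotentialRight h τ a cd vθ' r
              * (dressed m h τ a F r * conj (dressed m h τ a F r)).re
            + rayPotential h τ a E cd vθ r
              * ((dressedDeriv m h τ a F F₁ r * conj (dressed m h τ a F r)).re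
                + (dressed m h τ a F r * conj (dressedDeriv m h τ a F F₁ r)).re)))
      + B * (-h ^ 2 * ((u₂ * conj (dressed m h τ a F r)).re
            + (dressedDeriv m h τ a F F₁ r * conj (dressedDeriv m h τ a F F₁ r)).re)
          + h * (phiDerivRight τ a r * (dressed m h τ a F r * conj (dressed m h τ a F r)).re
            + phiDeriv 1 τ a r
              * ((dressedDeriv m h τ a F F₁ r * conj (dressed m h τ a F r)).re
                + (dressed m h τ a F r * conj (dressedDeriv m h τ a F F₁ r)).re)))
      + c₀ / 8 * h ^ 2 * ((-(2 * s) * (r + 1) ^ (-(2 * s) - 1) / r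
            - (r + 1) ^ (-(2 * s)) / r ^ 2)
              * (dressed m h τ a F r * conj (dressed m h τ a F r)).re
          + (r + 1) ^ (-(2 * s)) / r
            * ((dressedDeriv m h τ a F F₁ r * conj (dressed m h τ a F r)).re
              + (dressed m h τ a F r * conj (dressedDeriv m h τ a F F₁ r)).re)))
      (Set.Ioi r) r := by
  have h1 := (hasDerivAt_dressed (m := m) (h := h) (τ := τ) ha.le hr hF).hasDerivWithinAt
    (s := Set.Ioi r)
  have h3 := hasDerivWithinAt_carlemanMul (s := s) (a := a) hs hr
  have h4 := hasDerivWithinAt_phiDeriv_one (τ := τ) (a := a) hr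
  have h5 : HasDerivWithinAt (rayPotential h τ a E cd vθ) (rayPotentialRight h τ a cd vθ' r)
      (Set.Ioi r) r := by
    have e2 := (((hasDerivAt_pow 2 r).inv (pow_ne_zero 2 hr.ne')).const_mul
      (h ^ 2 * cd)).hasDerivWithinAt (s := Set.Ioi r)
    have := (((h4.pow 2).neg.add e2).sub_const E).add hvθ.hasDerivWithinAt
    convert! this using 1
    rw [rayPotentialRight]
    field_simp
    ring
  have h6 : HasDerivWithinAt (fun r : ℝ => (r + 1) ^ (-(2 * s)) / r)
      (-(2 * s) * (r + 1) ^ (-(2 * s) - 1) / r - (r + 1) ^ (-(2 * s)) / r ^ 2)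
      (Set.Ioi r) r := by
    have e1 := (((hasDerivAt_id r).add_const 1).rpow_const (p := -(2 * s))
      (Or.inl (by simp only [id]; positivity))).div (hasDerivAt_id r) hr.ne'
    convert! e1.hasDerivWithinAt using 1
    simp only [id]
    field_simp
  have h11 := hasDerivWithinAt_re_mul_conj h1 h1
  have h21 := hasDerivWithinAt_re_mul_conj hu₂ h1
  have h22 := hasDerivWithinAt_re_mul_conj hu₂ hu₂
  exact ((h3.mul ((h22.const_mul (-h ^ 2)).add (h5.mul h11))).add
    (((h21.const_mul (-h ^ 2)).add ((h4.mul h11).const_mul h)).const_mul B)).add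
    ((h6.mul h11).const_mul (c₀ / 8 * h ^ 2))

end

section
open ComplexConjugate Asymptotics Topology

variable {m s h τ a E c₀ M ε σ : ℝ} {v vθ vθ' : ℝ → ℝ} {F F₁ F₂ N q : ℝ → ℂ}

/-- Half-density form of the radial equation after conjugation by `rayWeight`. -/
theorem dressed_equation {r : ℝ} {φ₂ : ℝ} {F F₁ F₂ N q : ℂ} {ρ m φ₁ v E ε σ : ℝ} (hr : 0 < r)
    (hh : 0 < h)
    (hq : q = -(h : ℂ) ^ 2 * (F₂ + (2 * m / r : ℝ) * F₁ - N / (r : ℂ) ^ 2)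
      + ((v : ℂ) - E + (σ : ℂ) * ε * Complex.I) * F) :
    -(h : ℂ) ^ 2 * (ρ * (F₂ + 2 * (m / r + φ₁ / h : ℝ) * F₁
        + (((m / r + φ₁ / h) ^ 2 + (-m / r ^ 2 + φ₂ / h) : ℝ) : ℂ) * F))
      = ρ * q - 2 * (h * φ₁ : ℝ) * (ρ * (F₁ + (m / r + φ₁ / h : ℝ) * F))
        - (((h * φ₂ - φ₁ ^ 2 + h ^ 2 * (m * (m - 1)) / r ^ 2 + (v - E) : ℝ) : ℂ)
          + (σ : ℂ) * (ε : ℂ) * Complex.I) * (ρ * F) - (h ^ 2 / r ^ 2 : ℝ) * (ρ * N) := by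
  have h1 : (r : ℂ) ≠ 0 := by exact_mod_cast hr.ne'
  have h2 : (h : ℂ) ≠ 0 := by exact_mod_cast hh.ne'
  rw [hq]
  push_cast
  field_simp
  ring

theorem flux_derivative_le {u u₁ u₂ q N : ℂ}
    {μ μ' κ κ' φ₁ φ₂ h w w' r c₀ ε σ E M B cd v vθ τ a m Cμ D : ℝ}
    (hμ : 0 ≤ μ) (hμa : μ ≤ Cμ * a ^ 2) (hε : 0 < ε) (hε1 : ε ≤ 1) (hσ : σ = 1 ∨ σ = -1)
    (hB : B = ε * (Cμ * a ^ 2) / h) (hcd : 0 ≤ cd) (hr : 0 < r) (hh : 0 < h) (hw : 0 < w)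
    (hw' : w' ≤ 0) (hφ₁ : 0 ≤ φ₁) (hφτ : φ₁ ≤ τ) (hτ : 1 ≤ τ) (hc₀ : 0 < c₀) (hE : 0 ≤ E)
    (hv : |v| ≤ M) (hD0 : 0 ≤ D) (hD : D ≤ h * ‖u₁‖ + (h * m / r + φ₁) * ‖u‖)
    (hκ : κ = -φ₁ ^ 2 + h ^ 2 * cd / r ^ 2 - E + vθ)
    (hode : -(h : ℂ) ^ 2 * u₂ = q - 2 * (h * φ₁ : ℝ) * u₁
      - (((h * φ₂ - φ₁ ^ 2 + h ^ 2 * cd / r ^ 2 + (v - E) : ℝ) : ℂ)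
        + (σ : ℂ) * (ε : ℂ) * Complex.I) * u - (h ^ 2 / r ^ 2 : ℝ) * N)
    (hform : c₀ * w * h ^ 2 * ‖u₁‖ ^ 2 + c₀ * (1 + φ₁ ^ 2) * w * ‖u‖ ^ 2
      ≤ (h ^ 2 * μ' + 4 * h * μ * φ₁) * ‖u₁‖ ^ 2 + (-μ' * κ - μ * κ') * ‖u‖ ^ 2
        - 2 * μ * (h * |φ₂| + |v - vθ|) * (‖u‖ * ‖u₁‖)) :
    μ' * (-h ^ 2 * (u₁ * conj u₁).re + κ * (u * conj u).re)
      + μ * (-h ^ 2 * ((u₂ * conj u₁).re + (u₁ * conj u₂).re)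
        + (κ' * (u * conj u).re + κ * ((u₁ * conj u).re + (u * conj u₁).re)))
      + B * (-h ^ 2 * ((u₂ * conj u).re + (u₁ * conj u₁).re)
        + h * (φ₂ * (u * conj u).re + φ₁ * ((u₁ * conj u).re + (u * conj u₁).re)))
      + c₀ / 8 * h ^ 2 * ((w' / r - w / r ^ 2) * (u * conj u).re
        + w / r * ((u₁ * conj u).re + (u * conj u₁).re))
      ≤ 5 / c₀ * Cμ ^ 2 * (a ^ 2 / h) ^ 2 * w⁻¹ * ‖q‖ ^ 2
        + Cμ * (2 + E + M) * (ε / h) * (a * τ) ^ 2 * ‖u‖ ^ 2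
        - c₀ / (48 * (1 + m ^ 2)) * w * (‖u‖ ^ 2 + D ^ 2)
        - h ^ 2 / r ^ 2 * (2 * μ * (N * conj u₁).re + B * (N * conj u).re) := by
  have hB0 : 0 ≤ B := by
    have := hμ.trans hμa
    rw [hB]; positivity
  refine le_sub_iff_add_le.2 (flux_quadratic_bound hh hw hw' hr hφ₁ hφτ hτ hc₀ hε hε1 hμ hμa hB
    hE ((abs_nonneg v).trans hv) (norm_nonneg _) (norm_nonneg _) (norm_nonneg _) hD0 hD
    ((abs_re_mul_conj_le _ _).trans_eq (mul_comm _ _))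
    (flux_derivative_bound hμ hε hσ hB0 hcd hr hh hv hκ hode hform))

theorem exists_ray_flux {R : ℝ} (hm : 1 ≤ m) (hs : 1 / 2 < s) (hh : 0 < h) (hτ : 1 ≤ τ)
    (ha : 1 ≤ a) (hE : 0 < E) (hc₀ : 0 < c₀) (hε : 0 < ε) (hε1 : ε ≤ 1)
    (hσ : σ = 1 ∨ σ = -1) (hv : ∀ r > 0, |v r| ≤ M)
    (hvθ : ∀ r, HasDerivAt vθ (vθ' r) r)
    (hform : CarlemanForm s h τ a E c₀ (m * (m - 1)) v vθ vθ')
    (hF : ∀ r, HasDerivAt F (F₁ r) r) (hF₁ : ∀ r, HasDerivAt F₁ (F₂ r) r)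
    (hFR : F R = 0) (hF₁R : F₁ R = 0)
    (hq : ∀ r > 0, q r = -(h : ℂ) ^ 2 * (F₂ r + (2 * m / r : ℝ) * F₁ r - N r / (r : ℂ) ^ 2)
      + ((v r : ℂ) - E + (σ : ℂ) * ε * Complex.I) * F r) :
    ∃ G G' : ℝ → ℝ, Filter.Tendsto G (𝓝[>] 0) (𝓝 0) ∧ ContinuousOn G (Set.Ioi 0) ∧
      (∀ r > 0, HasDerivWithinAt G (G' r) (Set.Ioi r) r) ∧
      (∀ r > 0, G' r ≤ rayWeight m h τ a r ^ 2
        * (5 / c₀ * (2 + 1 / (2 * s - 1)) ^ 2 * (a ^ 2 / h) ^ 2 * (r + 1) ^ (2 * s) * ‖q r‖ ^ 2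
          + (2 + 1 / (2 * s - 1)) * (2 + E + M) * (ε / h) * (a * τ) ^ 2 * ‖F r‖ ^ 2
          - c₀ / (48 * (1 + m ^ 2)) * (r + 1) ^ (-(2 * s)) * (‖F r‖ ^ 2 + (h * ‖F₁ r‖) ^ 2)
          - h ^ 2 / r ^ 2 * (2 * carlemanMul s a r * (N r * conj (F₁ r)).re
            + (2 * carlemanMul s a r * raySlope m h τ a r
              + ε * ((2 + 1 / (2 * s - 1)) * a ^ 2) / h) * (N r * conj (F r)).re))) ∧
      G R = 0 := by
  have ha0 : 0 < a := zero_lt_one.trans_le ha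
  set Cμ := 2 + 1 / (2 * s - 1) with hCμ
  have hCμ0 : 0 ≤ Cμ := by
    have : 0 < 2 * s - 1 := by linarith
    positivity
  set B := ε * (Cμ * a ^ 2) / h with hB
  have hB0 : 0 ≤ B := by positivity
  refine ⟨rayFlux m s h τ a E c₀ (m * (m - 1)) B vθ F F₁, _,
    tendsto_rayFlux hm ha0 (hvθ 0).continuousAt (hF 0).continuousAt (hF₁ 0).continuousAt,
    fun r hr => (continuousAt_rayFlux ha0 hr (hvθ r).continuousAt (hF r)
      (hF₁ r).continuousAt).continuousWithinAt,
    fun r hr => hasDerivWithinAt_rayFlux hs ha0 hr (hvθ r) (hF r)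
      (hasDerivWithinAt_dressedDeriv ha0.le hr (hF r) (hF₁ r)), fun r hr => ?_, ?_⟩
  · have hw : 0 < (r + 1) ^ (-(2 * s)) := by positivity
    have hμ := carlemanMul_nonneg hs ha0 hr.le
    have hρ : 0 < rayWeight m h τ a r := by rw [rayWeight]; positivity
    have hφ₁ := phiDeriv_one_nonneg (zero_le_one.trans hτ) ha0.le hr.le
    set ρ := rayWeight m h τ a r with hρdef
    have hform' := hform r hr ‖dressedDeriv m h τ a F F₁ r‖ ‖dressed m h τ a F r‖
      (norm_nonneg _) (norm_nonneg _)
    have hode := dressed_equation (ρ := rayWeight m h τ a r) (φ₁ := phiDeriv 1 τ a r) (φ₂ := phiDerivRight τ a r)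
      hr hh (hq r hr)
    have hnu : ‖dressed m h τ a F r‖ = ρ * ‖F r‖ := by
      rw [dressed, norm_mul, Complex.norm_real, Real.norm_of_nonneg hρ.le]
    have hF₁u : (ρ : ℂ) * F₁ r
        = dressedDeriv m h τ a F F₁ r - raySlope m h τ a r * dressed m h τ a F r := by
      rw [dressed, dressedDeriv]; ring
    have hD : h * (ρ * ‖F₁ r‖) ≤ h * ‖dressedDeriv m h τ a F F₁ r‖
        + (h * m / r + phiDeriv 1 τ a r) * ‖dressed m h τ a F r‖ := by
      have : ρ * ‖F₁ r‖ = ‖(ρ : ℂ) * F₁ r‖ := by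
        rw [norm_mul, Complex.norm_real, Real.norm_of_nonneg hρ.le]
      rw [this, hF₁u]
      have hσ0 : 0 ≤ raySlope m h τ a r := by rw [raySlope]; positivity
      have e := norm_sub_le (dressedDeriv m h τ a F F₁ r)
        (raySlope m h τ a r * dressed m h τ a F r)
      rw [norm_mul, Complex.norm_real, Real.norm_of_nonneg hσ0] at e
      refine (mul_le_mul_of_nonneg_left e hh.le).trans_eq ?_
      rw [raySlope]
      field_simp
    have h1 := flux_derivative_le (w' := -(2 * s) * (r + 1) ^ (-(2 * s) - 1)) (τ := τ)
      hμ (carlemanMul_le hs ha hr) hε hε1 hσ hB (by nlinarith : 0 ≤ m * (m - 1)) hr hh hw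
      (by
        have : 0 < (r + 1) ^ (-(2 * s) - 1) := by positivity
        nlinarith) hφ₁ (phiDeriv_one_le (zero_le_one.trans hτ) ha0.le hr.le) hτ hc₀ hE.le
      (hv r hr) (by positivity) hD
      (rfl : rayPotential h τ a E (m * (m - 1)) vθ r = _) hode hform'
    refine h1.trans_eq ?_
    have hN1 : (ρ * N r * conj (dressedDeriv m h τ a F F₁ r)).re
        = ρ ^ 2 * ((N r * conj (F₁ r)).re + raySlope m h τ a r * (N r * conj (F r)).re) := by
      rw [dressedDeriv, ← hρdef]
      simp only [map_mul, map_add, Complex.conj_ofReal, Complex.mul_re, Complex.mul_im,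
        Complex.add_re, Complex.add_im, Complex.ofReal_re, Complex.ofReal_im]
      ring
    have hN0 : (ρ * N r * conj (dressed m h τ a F r)).re = ρ ^ 2 * (N r * conj (F r)).re := by
      rw [dressed, ← hρdef]
      simp only [map_mul, Complex.conj_ofReal, Complex.mul_re, Complex.mul_im,
        Complex.ofReal_re, Complex.ofReal_im]
      ring
    rw [hN1, hN0, hnu, norm_mul, Complex.norm_real, Real.norm_of_nonneg hρ.le,
      Real.rpow_neg (by positivity), inv_inv]
    ring
  · have e1 : dressed m h τ a F R = 0 := by rw [dressed, hFR, mul_zero]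
    have e2 : dressedDeriv m h τ a F F₁ R = 0 := by
      rw [dressedDeriv, hFR, hF₁R, mul_zero, add_zero, mul_zero]
    simp [rayFlux, e1, e2]

end

section
open ComplexConjugate Asymptotics Topology

/-- The exponential weight of the Carleman estimate, extended evenly. -/
noncomputable def expWeight (h τ a r : ℝ) : ℝ := Real.exp (2 * phi 1 τ a |r| / h)

/-- The radial weight of the angular energy paired with the Euler derivative. -/
noncomputable def angWeight (s h τ a r : ℝ) : ℝ :=
  2 * carlemanMul s a r * h ^ 2 * expWeight h τ a r / r ^ 3

/-- The radial weight of the angular energy paired with the function. -/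
noncomputable def angWeightZero (m s h τ a B r : ℝ) : ℝ :=
  h ^ 2 * expWeight h τ a r / r ^ 2 * (2 * carlemanMul s a r * raySlope m h τ a r + B)

variable {d : ℕ} {m s h τ a B : ℝ}

theorem continuous_expWeight (ha : 0 ≤ a) : Continuous (expWeight h τ a) := by
  have h1 : Continuous fun r : ℝ => phi 1 τ a |r| :=
    (continuousOn_phi_one ha).comp_continuous continuous_abs fun r => abs_nonneg r
  exact ((h1.const_mul 2).div_const h).rexp

theorem expWeight_pos (r : ℝ) : 0 < expWeight h τ a r := Real.exp_pos _

theorem expWeight_le {r R : ℝ} (hh : 0 < h) (hτ : 0 ≤ τ) (ha : 0 ≤ a) (hr : 0 < r) (hrR : r ≤ R) :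
    expWeight h τ a r ≤ Real.exp (2 * (τ * R) / h) := by
  rw [expWeight, abs_of_pos hr]
  have := phi_one_le hτ ha hr.le
  gcongr
  exact this.trans (by gcongr)

theorem rayWeight_sq {r : ℝ} (hd : 1 ≤ d) (hr : 0 < r) :
    rayWeight (((d : ℝ) - 1) / 2) h τ a r ^ 2 = r ^ (d - 1) * expWeight h τ a r := by
  rw [rayWeight, expWeight, mul_pow, ← Real.exp_nat_mul, abs_of_pos hr,
    ← Real.rpow_mul_natCast hr.le, ← Real.rpow_natCast r (d - 1), Nat.cast_sub hd]
  congr 2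
  · push_cast; ring
  · push_cast; ring

theorem measurable_angWeight (ha : 0 ≤ a) : Measurable (angWeight s h τ a) :=
  ((((measurable_carlemanMul).const_mul 2).mul_const _).mul
    (continuous_expWeight ha).measurable).div (measurable_id.pow_const 3)

theorem measurable_angWeightZero (ha : 0 ≤ a) : Measurable (angWeightZero m s h τ a B) :=
  (((continuous_expWeight ha).measurable.const_mul _).div (measurable_id.pow_const 2)).mul
    (((measurable_carlemanMul.const_mul 2).mul ((measurable_const.div measurable_id).add
      (measurable_phiDeriv_one.div_const h))).add_const B)

theorem exists_abs_angWeight_le (hs : 1 / 2 < s) (hh : 0 < h) (hτ : 0 ≤ τ) (ha : 1 ≤ a) (R : ℝ) :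
    ∃ K, ∀ r, 0 < r → r ≤ R → |angWeight s h τ a r| ≤ K * (r ^ 2)⁻¹ := by
  refine ⟨2 * ((2 + 1 / (2 * s - 1)) * a ^ 2) * h ^ 2 * Real.exp (2 * (τ * R) / h),
    fun r hr hrR => ?_⟩
  have ha0 : 0 < a := zero_lt_one.trans_le ha
  have h1 := carlemanMul_nonneg hs ha0 hr.le
  have h2 := carlemanMul_le_mul hs ha hr
  have h3 := expWeight_le hh hτ ha0.le hr hrR
  have h4 := expWeight_pos (h := h) (τ := τ) (a := a) r
  rw [angWeight, abs_of_nonneg (by positivity)]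
  have h0 : 0 ≤ 1 / (2 * s - 1) := (one_div_pos.2 (by linarith)).le
  calc 2 * carlemanMul s a r * h ^ 2 * expWeight h τ a r / r ^ 3
      ≤ 2 * ((2 + 1 / (2 * s - 1)) * a ^ 2 * r) * h ^ 2 * Real.exp (2 * (τ * R) / h) / r ^ 3 := by
        gcongr
    _ = _ := by field_simp

theorem exists_abs_angWeightZero_le (hm : 0 ≤ m) (hB : 0 ≤ B) (hs : 1 / 2 < s) (hh : 0 < h)
    (hτ : 0 ≤ τ) (ha : 1 ≤ a) (R : ℝ) :
    ∃ K, ∀ r, 0 < r → r ≤ R → |angWeightZero m s h τ a B r| ≤ K * (r ^ 2)⁻¹ := by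
  refine ⟨h ^ 2 * Real.exp (2 * (τ * R) / h) * (2 * ((2 + 1 / (2 * s - 1)) * a ^ 2) * m
    + 2 * ((2 + 1 / (2 * s - 1)) * a ^ 2) * (τ / h) + B), fun r hr hrR => ?_⟩
  have ha0 : 0 < a := zero_lt_one.trans_le ha
  have h1 := carlemanMul_nonneg hs ha0 hr.le
  have h2 := carlemanMul_le_mul hs ha hr
  have h2' := carlemanMul_le hs ha hr
  have h3 := expWeight_le hh hτ ha0.le hr hrR
  have h4 := expWeight_pos (h := h) (τ := τ) (a := a) r
  have h5 := phiDeriv_one_nonneg hτ ha0.le hr.le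
  have h6 := phiDeriv_one_le hτ ha0.le hr.le
  have h0 : 0 ≤ 1 / (2 * s - 1) := (one_div_pos.2 (by linarith)).le
  rw [angWeightZero, raySlope, abs_of_nonneg (by positivity)]
  calc h ^ 2 * expWeight h τ a r / r ^ 2
        * (2 * carlemanMul s a r * (m / r + phiDeriv 1 τ a r / h) + B)
      = h ^ 2 * expWeight h τ a r * (r ^ 2)⁻¹
        * (2 * carlemanMul s a r * (m / r) + 2 * carlemanMul s a r * (phiDeriv 1 τ a r / h) + B) := by
        ring
    _ ≤ h ^ 2 * Real.exp (2 * (τ * R) / h) * (r ^ 2)⁻¹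
        * (2 * ((2 + 1 / (2 * s - 1)) * a ^ 2 * r) * (m / r)
          + 2 * ((2 + 1 / (2 * s - 1)) * a ^ 2) * (τ / h) + B) := by gcongr
    _ = _ := by field_simp

/-! ### Restriction of smooth functions to rays -/

theorem hasDerivAt_comp_ray {F : Type*} [NormedAddCommGroup F] [NormedSpace ℝ F]
    {f : EuclideanSpace ℝ (Fin d) → F} (hf : ContDiff ℝ (⊤ : ℕ∞) f)
    (ω : EuclideanSpace ℝ (Fin d)) (r : ℝ) :
    HasDerivAt (fun t : ℝ => f (t • ω)) (fderiv ℝ f (r • ω) ω) r := by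
  have h1 : HasDerivAt (fun t : ℝ => t • ω) ω r := by
    simpa using (hasDerivAt_id r).smul_const ω
  exact ((hf.differentiable (by simp)) (r • ω)).hasFDerivAt.comp_hasDerivAt r h1

theorem hasDerivAt_fderiv_comp_ray {F : Type*} [NormedAddCommGroup F] [NormedSpace ℝ F]
    {f : EuclideanSpace ℝ (Fin d) → F} (hf : ContDiff ℝ (⊤ : ℕ∞) f)
    (ω : EuclideanSpace ℝ (Fin d)) (r : ℝ) :
    HasDerivAt (fun t : ℝ => fderiv ℝ f (t • ω) ω)
      (fderiv ℝ (fderiv ℝ f) (r • ω) ω ω) r :=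
  (ContinuousLinearMap.apply ℝ F ω).hasFDerivAt.comp_hasDerivAt r
    (hasDerivAt_comp_ray hf.fderiv_clm_apply_top ω r)

theorem eulerDeriv_ray {F : Type*} [NormedAddCommGroup F] [NormedSpace ℝ F]
    (f : EuclideanSpace ℝ (Fin d) → F) (ω : EuclideanSpace ℝ (Fin d)) (r : ℝ) :
    eulerDeriv f (r • ω) = r • fderiv ℝ f (r • ω) ω := by
  rw [eulerDeriv, map_smul]

theorem norm_radialDeriv_ray (f : EuclideanSpace ℝ (Fin d) → ℂ) {ω : EuclideanSpace ℝ (Fin d)}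
    (hω : ‖ω‖ = 1) {r : ℝ} (hr : 0 < r) (hh : 0 < h) :
    ‖radialDeriv h f (r • ω)‖ = h * ‖fderiv ℝ f (r • ω) ω‖ := by
  have : ‖r • ω‖⁻¹ • r • ω = ω := by
    rw [norm_smul, hω, mul_one, Real.norm_of_nonneg hr.le, smul_smul, inv_mul_cancel₀ hr.ne',
      one_smul]
  rw [radialDeriv, this]
  simp [abs_of_pos hh]

theorem lap_ray {f : EuclideanSpace ℝ (Fin d) → ℂ} (hf : ContDiff ℝ (⊤ : ℕ∞) f)
    {ω : EuclideanSpace ℝ (Fin d)} (hω : ‖ω‖ = 1) {r : ℝ} (hr : 0 < r) :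
    lap f (r • ω) = fderiv ℝ (fderiv ℝ f) (r • ω) ω ω
      + (2 * (((d : ℝ) - 1) / 2) / r : ℝ) * fderiv ℝ f (r • ω) ω
      - (-angLap f (r • ω)) / (r : ℂ) ^ 2 := by
  have h1 := normSq_mul_lap hf (r • ω)
  have h2 : (r : ℂ) ≠ 0 := by exact_mod_cast hr.ne'
  rw [norm_smul, hω, mul_one, Real.norm_of_nonneg hr.le] at h1
  simp only [map_smul, smul_apply, Complex.real_smul] at h1
  rw [eq_sub_iff_add_eq, ← mul_right_inj' (pow_ne_zero 2 h2)]
  push_cast at h1 ⊢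
  field_simp
  linear_combination h1

/-- A weighted angular-momentum-free energy is nonnegative. -/
theorem integral_angWeight_nonneg (hd : 3 ≤ d) (hB : 0 ≤ B) (hs : 1 / 2 < s)
    (ha : 1 ≤ a) (ψ : EuclideanSpace ℝ (Fin d) → ℂ)
    (hψ : ContDiff ℝ (⊤ : ℕ∞) ψ) (hψs : HasCompactSupport ψ) :
    0 ≤ ∫ x, (angWeight s h τ a ‖x‖ * (ψ x * conj (eulerDeriv ψ x)).re
        + angWeightZero (((d : ℝ) - 1) / 2) s h τ a B ‖x‖ * (ψ x * conj (ψ x)).re) := by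
  have ha0 : 0 < a := zero_lt_one.trans_le ha
  have hm : (1:ℝ) ≤ ((d : ℝ) - 1) / 2 := by
    have : (3:ℝ) ≤ d := by exact_mod_cast hd
    linarith
  set m := ((d : ℝ) - 1) / 2 with hmdef
  have : Nontrivial (EuclideanSpace ℝ (Fin d)) :=
    Module.nontrivial_of_finrank_pos (R := ℝ) (by simp; omega)
  obtain ⟨R, hR1, hR⟩ := hψs.exists_radius
  have hψ0 : ∀ x, R ≤ ‖x‖ → ψ x = 0 := fun x hx => image_eq_zero_of_notMem_tsupport (hR x hx)
  refine integral_nonneg_of_radial_flux volume _ R (by linarith)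
    (fun x hx => by rw [hψ0 x hx]; simp) fun ω hω => ?_
  set F : ℝ → ℂ := fun t => ψ (t • ω) with hF
  set F₁ : ℝ → ℂ := fun t => fderiv ℝ ψ (t • ω) ω with hF₁
  have hd1 : ∀ r, HasDerivAt F (F₁ r) r := hasDerivAt_comp_ray hψ ω
  set u := dressed m h τ a F with hu
  set u₁ := dressedDeriv m h τ a F F₁ with hu₁
  have hu' : ∀ r > 0, HasDerivAt u (u₁ r) r := fun r hr => hasDerivAt_dressed ha0.le hr (hd1 r)
  refine ⟨fun r => h ^ 2 * (carlemanMul s a r * (r ^ 2)⁻¹ * (u r * conj (u r)).re),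
    fun r => h ^ 2 * ((carlemanMulRight s a r * (r ^ 2)⁻¹
      + carlemanMul s a r * (-(2 * r) / (r ^ 2) ^ 2)) * (u r * conj (u r)).re
      + carlemanMul s a r * (r ^ 2)⁻¹ * ((u₁ r * conj (u r)).re + (u r * conj (u₁ r)).re)),
    ?_, fun r hr => ?_, fun r hr => ?_, fun r hr => ?_, ?_⟩
  · have h1 := isBigO_dressed (h := h) (τ := τ) hm ha0.le (hd1 0).continuousAt
    have key : (fun r => h ^ 2 * (carlemanMul s a r * (r ^ 2)⁻¹ * (u r * conj (u r)).re))
        =O[𝓝[>] 0] fun r => r := by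
      refine ((((isBigO_carlemanMul (s := s) ha0).mul (isBigO_refl (fun r : ℝ => (r ^ 2)⁻¹) _)).mul
        (isBigO_re_mul_conj h1 h1)).const_mul_left (h ^ 2)).trans (IsBigO.of_bound 1 ?_)
      filter_upwards [self_mem_nhdsWithin] with r hr
      have := (Set.mem_Ioi.1 hr).ne'
      rw [show r * (r ^ 2)⁻¹ * (r * r) = r by field_simp, one_mul]
    exact key.trans_tendsto (tendsto_nhdsWithin_of_tendsto_nhds Filter.tendsto_id)
  · have hr' : (r ^ 2) ≠ 0 := pow_ne_zero 2 (Set.mem_Ioi.1 hr).ne'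
    have hc := (hu' r hr).continuousAt
    exact (continuousAt_const.mul (((continuous_carlemanMul ha0).continuousAt.mul
      ((continuousAt_id.pow 2).inv₀ hr')).mul (Complex.continuous_re.continuousAt.comp
      (hc.mul (Complex.continuous_conj.continuousAt.comp hc))))).continuousWithinAt
  · have e1 := (((hasDerivAt_pow 2 r).inv (pow_ne_zero 2 hr.ne'))).hasDerivWithinAt
      (s := Set.Ioi r)
    have e2 := (hu' r hr).hasDerivWithinAt (s := Set.Ioi r)
    have e3 := (((hasDerivWithinAt_carlemanMul (s := s) (a := a) hs hr).mul e1).mul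
      (hasDerivWithinAt_re_mul_conj e2 e2)).const_mul (h ^ 2)
    convert! e3 using 1
    simp
  · have hμ := carlemanMul_nonneg hs ha0 hr.le
    have hμ' := mul_carlemanMulRight_le hs ha hr
    have hnorm : ‖r • ω‖ = r := by rw [norm_smul, hω, mul_one, Real.norm_of_nonneg hr.le]
    rw [hnorm, finrank_euclideanSpace, Fintype.card_fin, eulerDeriv_ray, angWeight, angWeightZero,
      Complex.real_smul]
    have hρ2 := rayWeight_sq (d := d) (h := h) (τ := τ) (a := a) (by omega) hr
    rw [← hmdef] at hρ2
    set ρ := rayWeight m h τ a r with hρdef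
    have hN1 : (u r * conj (u₁ r)).re
        = ρ ^ 2 * ((F r * conj (F₁ r)).re + raySlope m h τ a r * (F r * conj (F r)).re) := by
      rw [hu, hu₁, dressed, dressedDeriv, ← hρdef]
      simp only [map_mul, map_add, Complex.conj_ofReal, Complex.mul_re, Complex.mul_im,
        Complex.add_re, Complex.add_im, Complex.ofReal_re, Complex.ofReal_im]
      ring
    have hN0 : (u r * conj (u r)).re = ρ ^ 2 * (F r * conj (F r)).re := by
      rw [hu, dressed, ← hρdef]
      simp only [map_mul, Complex.conj_ofReal, Complex.mul_re, Complex.mul_im,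
        Complex.ofReal_re, Complex.ofReal_im]
      ring
    have hP : 0 ≤ (F r * conj (F r)).re := by rw [re_mul_conj_self]; positivity
    have hC : (F r * conj ((r : ℂ) * F₁ r)).re = r * (F r * conj (F₁ r)).re := by
      simp only [map_mul, Complex.conj_ofReal, Complex.mul_re, Complex.mul_im,
        Complex.ofReal_re, Complex.ofReal_im]
      ring
    change _ ≤ _ * (_ * (F r * conj ((r : ℂ) * F₁ r)).re + _ * (F r * conj (F r)).re)
    beta_reduce
    rw [re_mul_conj_comm (u₁ r), hN1, hN0, hC, hρ2]
    have he := expWeight_pos (h := h) (τ := τ) (a := a) r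
    set P := (F r * conj (F r)).re
    set S := (F r * conj (F₁ r)).re
    have hdiff : 0 ≤ r ^ (d - 1) * expWeight h τ a r * h ^ 2 * P / r ^ 3
        * (2 * carlemanMul s a r - r * carlemanMulRight s a r + r * B) :=
      mul_nonneg (by positivity) (by nlinarith)
    refine sub_nonneg.1 (hdiff.trans_eq ?_)
    field_simp
    ring
  · have : F R = 0 := hψ0 _ (by rw [norm_smul, hω, mul_one]; exact le_abs_self R)
    simp [hu, dressed, this]

end

section
open ComplexConjugate Topology

variable {d : ℕ} {f : EuclideanSpace ℝ (Fin d) → ℂ} {x : EuclideanSpace ℝ (Fin d)}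

theorem fderiv_eq_zero_of_notMem_tsupport (hx : x ∉ tsupport f) : fderiv ℝ f x = 0 :=
  image_eq_zero_of_notMem_tsupport fun h => hx (tsupport_fderiv_subset ℝ h)

theorem lap_eq_zero_of_notMem_tsupport (hf : ContDiff ℝ (⊤ : ℕ∞) f) (hx : x ∉ tsupport f) :
    lap f x = 0 := by
  have : fderiv ℝ (fderiv ℝ f) x = 0 := image_eq_zero_of_notMem_tsupport fun h =>
    hx (tsupport_fderiv_subset ℝ (tsupport_fderiv_subset ℝ h))
  rw [lap_eq_sum hf]
  simp [this]

theorem continuous_lap (hf : ContDiff ℝ (⊤ : ℕ∞) f) : Continuous (lap f) := by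
  have : lap f = fun x => ∑ i, fderiv ℝ (fderiv ℝ f) x (EuclideanSpace.single i 1)
      (EuclideanSpace.single i 1) := funext fun x => lap_eq_sum hf x
  rw [this]
  have h := hf.fderiv_clm_apply_top.fderiv_clm_apply_top.continuous
  exact continuous_finsetSum _ fun i _ =>
    (h.clm_apply continuous_const).clm_apply continuous_const

theorem contDiff_angLap (hf : ContDiff ℝ (⊤ : ℕ∞) f) : ContDiff ℝ (⊤ : ℕ∞) (angLap f) :=
  contDiff_const.mul (ContDiff.sum fun i _ => ContDiff.sum fun j _ => (hf.angDeriv i j).angDeriv i j)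

theorem hasCompactSupport_norm_sq {F : Type*} [NormedAddCommGroup F]
    {g : EuclideanSpace ℝ (Fin d) → F} (hg : HasCompactSupport g) :
    HasCompactSupport fun x => ‖g x‖ ^ 2 :=
  hg.mono (Function.support_subset_iff'.2 fun x hx => by simp [Function.notMem_support.1 hx])

theorem integrable_mul_norm_sq {F : Type*} [NormedAddCommGroup F]
    {g : EuclideanSpace ℝ (Fin d) → F} {W : ℝ → ℝ} (hW : ContinuousOn W (Set.Ici 0))
    (hg : Continuous g) (hgs : HasCompactSupport g) : Integrable fun x => W ‖x‖ * ‖g x‖ ^ 2 := by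
  have hc : Continuous fun x : EuclideanSpace ℝ (Fin d) => W ‖x‖ :=
    hW.comp_continuous continuous_norm fun x => norm_nonneg x
  exact (hc.mul (hg.norm.pow 2)).integrable_of_hasCompactSupport
    (hasCompactSupport_norm_sq hgs).mul_left

theorem norm_radialDeriv_sq (h : ℝ) (f : EuclideanSpace ℝ (Fin d) → ℂ)
    (x : EuclideanSpace ℝ (Fin d)) :
    ‖radialDeriv h f x‖ ^ 2 = h ^ 2 * (‖x‖ ^ 2)⁻¹ * ‖eulerDeriv f x‖ ^ 2 := by
  rw [radialDeriv, eulerDeriv, map_smul]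
  simp [mul_pow, mul_assoc]

theorem integrable_mul_norm_radialDeriv_sq (hd : 3 ≤ d) {W : ℝ → ℝ} (hW : Continuous W)
    (hf : ContDiff ℝ (⊤ : ℕ∞) f) (hfs : HasCompactSupport f) (h : ℝ) :
    Integrable fun x => W ‖x‖ * ‖radialDeriv h f x‖ ^ 2 := by
  have h1 := integrable_radial_mul hd (w := fun r => h ^ 2 * (W r * (r ^ 2)⁻¹))
    ((hW.measurable.mul (measurable_id.pow_const 2).inv).const_mul _) (fun R => by
      obtain ⟨K, hK⟩ := (isCompact_Icc (a := (0:ℝ)) (b := R)).exists_bound_of_continuousOn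
        hW.continuousOn
      refine ⟨h ^ 2 * K, fun r hr hrR => ?_⟩
      have h2 : |W r| ≤ K := hK r ⟨hr.le, hrR⟩
      rw [abs_mul, abs_mul, abs_of_nonneg (sq_nonneg h), abs_of_pos (by positivity : 0 < (r ^ 2)⁻¹),
        mul_assoc]
      gcongr)
    (g := fun x => ‖eulerDeriv f x‖ ^ 2) (hf.eulerDeriv.continuous.norm.pow 2)
    (hasCompactSupport_norm_sq hfs.eulerDeriv)
  refine h1.congr (Filter.Eventually.of_forall fun x => ?_)
  simp only [norm_radialDeriv_sq]
  ring

theorem integrable_mul_norm_schrodinger_sq {W : ℝ → ℝ} (hW : ContinuousOn W (Set.Ici 0))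
    (hW0 : ∀ r, 0 ≤ r → 0 ≤ W r)
    {q : EuclideanSpace ℝ (Fin d) → ℂ} (hq : Measurable q) {M : ℝ} (hqM : ∀ x, ‖q x‖ ≤ M)
    (hf : ContDiff ℝ (⊤ : ℕ∞) f) (hfs : HasCompactSupport f) (h : ℝ) :
    Integrable fun x => W ‖x‖ * ‖-(h : ℂ) ^ 2 * lap f x + q x * f x‖ ^ 2 := by
  have hls : HasCompactSupport (lap f) := hfs.mono' (Function.support_subset_iff'.2 fun x hx =>
    lap_eq_zero_of_notMem_tsupport hf hx)
  have i1 := (integrable_mul_norm_sq hW (continuous_lap hf) hls).const_mul (2 * (h ^ 2) ^ 2)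
  have i2 := (integrable_mul_norm_sq hW hf.continuous hfs).const_mul (2 * M ^ 2)
  have hWc : Continuous fun x : EuclideanSpace ℝ (Fin d) => W ‖x‖ :=
    hW.comp_continuous continuous_norm fun x => norm_nonneg x
  refine (i1.add i2).mono' ?_ (Filter.Eventually.of_forall fun x => ?_)
  · exact (hWc.measurable.mul ((((continuous_lap hf).measurable.const_mul _).add
      (hq.mul hf.continuous.measurable)).norm.pow_const 2)).aestronglyMeasurable
  · have hx := hW0 ‖x‖ (norm_nonneg x)
    rw [Real.norm_of_nonneg (by positivity)]
    have e1 : ‖-(h : ℂ) ^ 2 * lap f x + q x * f x‖ ≤ h ^ 2 * ‖lap f x‖ + M * ‖f x‖ := by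
      refine (norm_add_le _ _).trans ?_
      rw [norm_mul, norm_mul, norm_neg, norm_pow, Complex.norm_real, Real.norm_eq_abs, sq_abs]
      gcongr
      exact hqM x
    calc W ‖x‖ * ‖-(h : ℂ) ^ 2 * lap f x + q x * f x‖ ^ 2
        ≤ W ‖x‖ * (2 * ((h ^ 2 * ‖lap f x‖) ^ 2 + (M * ‖f x‖) ^ 2)) := by
          gcongr
          refine (pow_le_pow_left₀ (norm_nonneg _) e1 2).trans ?_
          linarith [sq_nonneg (h ^ 2 * ‖lap f x‖ - M * ‖f x‖)]
      _ = _ := by simp only [Pi.add_apply]; ring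

theorem integral_carleman {s h τ a E c₀ M ε σ : ℝ} {V : EuclideanSpace ℝ (Fin d) → ℝ}
    (hd : 3 ≤ d) (hs : 1 / 2 < s) (hh : 0 < h) (hτ : 1 ≤ τ)
    (ha : 1 ≤ a) (hE : 0 < E) (hc₀ : 0 < c₀) (hε : 0 < ε) (hε1 : ε ≤ 1)
    (hσ : σ = 1 ∨ σ = -1) (hVm : Measurable V) (hVM : ∀ x, |V x| ≤ M)
    (hform : ∀ ω : EuclideanSpace ℝ (Fin d), ‖ω‖ = 1 → ∃ vθ vθ' : ℝ → ℝ,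
      (∀ r, HasDerivAt vθ (vθ' r) r) ∧ CarlemanForm s h τ a E c₀
        (((d : ℝ) - 1) / 2 * (((d : ℝ) - 1) / 2 - 1)) (fun r => V (r • ω)) vθ vθ')
    (hf : ContDiff ℝ (⊤ : ℕ∞) f) (hfs : HasCompactSupport f) :
    c₀ / (48 * (1 + (((d : ℝ) - 1) / 2) ^ 2)) *
      ((∫ x, (‖x‖ + 1) ^ (-(2*s)) * Real.exp (2 * phi 1 τ a ‖x‖ / h) * ‖f x‖ ^ 2)
        + ∫ x, (‖x‖ + 1) ^ (-(2*s)) * Real.exp (2 * phi 1 τ a ‖x‖ / h) * ‖radialDeriv h f x‖ ^ 2)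
    ≤ 5 / c₀ * (2 + 1 / (2 * s - 1)) ^ 2 * (a ^ 2 / h) ^ 2
        * (∫ x, (‖x‖ + 1) ^ (2*s) * Real.exp (2 * phi 1 τ a ‖x‖ / h) *
            ‖-(h:ℂ)^2 * lap f x
              + ((V x : ℂ) - (E:ℂ) + (σ:ℂ) * (ε:ℂ) * Complex.I) * f x‖ ^ 2)
      + (2 + 1 / (2 * s - 1)) * (2 + E + M) * (ε / h) * (a * τ) ^ 2
        * (∫ x, Real.exp (2 * phi 1 τ a ‖x‖ / h) * ‖f x‖ ^ 2) := by
  have ha0 : 0 < a := zero_lt_one.trans_le ha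
  have hτ0 : 0 ≤ τ := zero_le_one.trans hτ
  have hm : (1:ℝ) ≤ ((d : ℝ) - 1) / 2 := by
    have : (3:ℝ) ≤ d := by exact_mod_cast hd
    linarith
  set m := ((d : ℝ) - 1) / 2 with hmdef
  have : Nontrivial (EuclideanSpace ℝ (Fin d)) :=
    Module.nontrivial_of_finrank_pos (R := ℝ) (by simp; omega)
  set B := ε * ((2 + 1 / (2 * s - 1)) * a ^ 2) / h with hB
  have hB0 : 0 ≤ B := by
    have : 0 ≤ 1 / (2 * s - 1) := (one_div_pos.2 (by linarith)).le
    positivity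
  set P : EuclideanSpace ℝ (Fin d) → ℂ := fun x => -(h:ℂ)^2 * lap f x
    + ((V x : ℂ) - (E:ℂ) + (σ:ℂ) * (ε:ℂ) * Complex.I) * f x with hP
  set e : ℝ → ℝ := fun r => Real.exp (2 * phi 1 τ a r / h) with he
  have hec : ContinuousOn e (Set.Ici 0) :=
    (((continuousOn_phi_one ha0.le).const_mul 2).div_const h).rexp
  have hpow : ∀ p : ℝ, ContinuousOn (fun r : ℝ => (r + 1) ^ p) (Set.Ici 0) := fun p r hr =>
    ((continuousAt_id.add continuousAt_const).rpow_const (Or.inl (by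
      have : (0:ℝ) ≤ r := hr
      show r + 1 ≠ 0
      positivity))).continuousWithinAt
  have i0 : Integrable fun x => e ‖x‖ * ‖f x‖ ^ 2 :=
    integrable_mul_norm_sq hec hf.continuous hfs
  have i1 : Integrable fun x => (‖x‖ + 1) ^ (-(2*s)) * e ‖x‖ * ‖f x‖ ^ 2 :=
    integrable_mul_norm_sq ((hpow _).mul hec) hf.continuous hfs
  have i2 : Integrable fun x => (‖x‖ + 1) ^ (-(2*s)) * e ‖x‖ * ‖radialDeriv h f x‖ ^ 2 := by
    have hc : Continuous fun r : ℝ => (|r| + 1) ^ (-(2*s)) * expWeight h τ a r :=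
      ((hpow _).comp_continuous continuous_abs fun r => abs_nonneg r).mul
        (continuous_expWeight ha0.le)
    have := integrable_mul_norm_radialDeriv_sq hd hc hf hfs h
    simpa only [abs_norm, expWeight] using this
  have i3 : Integrable fun x => (‖x‖ + 1) ^ (2*s) * e ‖x‖ * ‖P x‖ ^ 2 := by
    refine integrable_mul_norm_schrodinger_sq (M := M + E + ε) ((hpow _).mul hec)
      (fun r hr => mul_nonneg (Real.rpow_nonneg (by linarith) _) (Real.exp_pos _).le)
      (((Complex.measurable_ofReal.comp hVm).sub_const _).add_const _) (fun x => ?_) hf hfs h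
    refine (norm_add_le _ _).trans (add_le_add ((norm_sub_le _ _).trans (add_le_add ?_ ?_)) ?_)
    · simpa using hVM x
    · simp [abs_of_pos hE]
    · rcases hσ with h | h <;> simp [h, abs_of_pos hε]
  have j1 : Integrable fun x => angWeight s h τ a ‖x‖ * (-angLap f x * conj (eulerDeriv f x)).re := by
    simp only [re_mul_conj_comm (-angLap f _)]
    exact integrable_radial_mul hd (measurable_angWeight ha0.le)
      (exists_abs_angWeight_le hs hh hτ0 ha)
      (contDiff_re_mul_conj hf.eulerDeriv (contDiff_angLap hf).neg).continuous
      (hasCompactSupport_re_mul_conj hfs.eulerDeriv)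
  have j2 : Integrable fun x => angWeightZero m s h τ a B ‖x‖ * (-angLap f x * conj (f x)).re := by
    simp only [re_mul_conj_comm (-angLap f _)]
    exact integrable_radial_mul hd (measurable_angWeightZero ha0.le)
      (exists_abs_angWeightZero_le (zero_le_one.trans hm) hB0 hs hh hτ0 ha)
      (contDiff_re_mul_conj hf (contDiff_angLap hf).neg).continuous
      (hasCompactSupport_re_mul_conj hfs)
  have hang := integral_angLap_nonneg hd (measurable_angWeight ha0.le)
    (measurable_angWeightZero (m := m) (B := B) ha0.le) (exists_abs_angWeight_le hs hh hτ0 ha)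
    (exists_abs_angWeightZero_le (zero_le_one.trans hm) hB0 hs hh hτ0 ha)
    (integral_angWeight_nonneg hd hB0 hs ha) hf hfs
  obtain ⟨R, hR1, hR⟩ := hfs.exists_radius
  have hflux := integral_nonneg_of_radial_flux volume (fun x : EuclideanSpace ℝ (Fin d) =>
    5 / c₀ * (2 + 1 / (2 * s - 1)) ^ 2 * (a ^ 2 / h) ^ 2
        * ((‖x‖ + 1) ^ (2*s) * e ‖x‖ * ‖P x‖ ^ 2)
      + (2 + 1 / (2 * s - 1)) * (2 + E + M) * (ε / h) * (a * τ) ^ 2 * (e ‖x‖ * ‖f x‖ ^ 2)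
      - c₀ / (48 * (1 + m ^ 2)) * ((‖x‖ + 1) ^ (-(2*s)) * e ‖x‖ * ‖f x‖ ^ 2
        + (‖x‖ + 1) ^ (-(2*s)) * e ‖x‖ * ‖radialDeriv h f x‖ ^ 2)
      - (angWeight s h τ a ‖x‖ * (-angLap f x * conj (eulerDeriv f x)).re
        + angWeightZero m s h τ a B ‖x‖ * (-angLap f x * conj (f x)).re))
    R (by linarith) (fun x hx => by
      have h1 := hR x hx
      have h2 : f x = 0 := image_eq_zero_of_notMem_tsupport h1
      have h3 := fderiv_eq_zero_of_notMem_tsupport h1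
      have h4 := lap_eq_zero_of_notMem_tsupport hf h1
      simp [hP, radialDeriv, eulerDeriv, h2, h3, h4]) fun ω hω => by
    obtain ⟨vθ, vθ', hvθ, hform⟩ := hform ω hω
    have hRn : R ≤ ‖R • ω‖ := by rw [norm_smul, hω, mul_one]; exact le_abs_self R
    obtain ⟨G, G', g1, g2, g3, g4, g5⟩ := exists_ray_flux (M := M) (σ := σ) (R := R)
      (F := fun t => f (t • ω)) (F₁ := fun t => fderiv ℝ f (t • ω) ω)
      (F₂ := fun t => fderiv ℝ (fderiv ℝ f) (t • ω) ω ω) (N := fun t => -angLap f (t • ω))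
      (q := fun t => P (t • ω)) hm hs hh hτ ha hE hc₀ hε hε1 hσ
      (fun r _ => hVM (r • ω)) hvθ hform
      (hasDerivAt_comp_ray hf ω) (hasDerivAt_fderiv_comp_ray hf ω)
      (image_eq_zero_of_notMem_tsupport (hR _ hRn))
      (by simp [fderiv_eq_zero_of_notMem_tsupport (hR _ hRn)])
      (fun r hr => by
        simp only [hP]
        rw [lap_ray hf hω hr])
    refine ⟨G, G', g1, g2, g3, fun r hr => (g4 r hr).trans_eq ?_, g5⟩
    have hnorm : ‖r • ω‖ = r := by rw [norm_smul, hω, mul_one, Real.norm_of_nonneg hr.le]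
    have hew : expWeight h τ a r = e r := by rw [expWeight, abs_of_pos hr]
    rw [finrank_euclideanSpace, Fintype.card_fin, hmdef, rayWeight_sq (by omega) hr, ← hmdef,
      norm_radialDeriv_ray f hω hr hh, hnorm, eulerDeriv_ray, angWeight, angWeightZero, hew,
      Complex.real_smul]
    have hC : ∀ z w : ℂ, (z * conj ((r : ℂ) * w)).re = r * (z * conj w).re := fun z w => by
      simp only [map_mul, Complex.conj_ofReal, Complex.mul_re, Complex.mul_im,
        Complex.ofReal_re, Complex.ofReal_im]
      ring
    rw [hC, ← hB]
    generalize 2 + 1 / (2 * s - 1) = K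
    field_simp
  have k1 : Integrable fun x => 5 / c₀ * (2 + 1 / (2 * s - 1)) ^ 2 * (a ^ 2 / h) ^ 2
        * ((‖x‖ + 1) ^ (2*s) * e ‖x‖ * ‖P x‖ ^ 2)
      + (2 + 1 / (2 * s - 1)) * (2 + E + M) * (ε / h) * (a * τ) ^ 2 * (e ‖x‖ * ‖f x‖ ^ 2) :=
    (i3.const_mul _).add (i0.const_mul _)
  have k2 : Integrable fun x => c₀ / (48 * (1 + m ^ 2)) *
      ((‖x‖ + 1) ^ (-(2*s)) * e ‖x‖ * ‖f x‖ ^ 2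
        + (‖x‖ + 1) ^ (-(2*s)) * e ‖x‖ * ‖radialDeriv h f x‖ ^ 2) :=
    (i1.add i2).const_mul _
  have e1 := integral_sub (k1.sub k2) (j1.add j2)
  have e2 := integral_sub k1 k2
  simp only [Pi.sub_apply, Pi.add_apply] at e1 e2
  rw [e1, e2, integral_add (i3.const_mul _) (i0.const_mul _), integral_const_mul, integral_const_mul,
    integral_const_mul, integral_add i1 i2] at hflux
  linarith

end

section
variable {h α θ : ℝ}

theorem holder_scale_eq (hh : 0 < h) (hα : 0 < α) (hθ : θ = h ^ (2 / (α + 3))) :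
    θ ^ (2 * α / 3) * h ^ (-(1 / 3) : ℝ) = h ^ ((α - 1) / (α + 3)) := by
  rw [hθ, ← Real.rpow_mul hh.le, ← Real.rpow_add hh]
  congr 1
  field_simp
  ring

theorem one_le_holder_scale (hh : 0 < h) (hh1 : h ≤ 1) (hα : 0 < α) (hα1 : α < 1) :
    1 ≤ h ^ ((α - 1) / (α + 3)) :=
  Real.one_le_rpow_of_pos_of_le_one_of_nonpos hh hh1
    (div_nonpos_of_nonpos_of_nonneg (by linarith) (by linarith))

theorem holder_scale_sq_mul_le (hh : 0 < h) (hh1 : h ≤ 1) (hα : 0 < α) :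
    (h ^ ((α - 1) / (α + 3))) ^ 2 * h ≤ 1 := by
  rw [← Real.rpow_mul_natCast hh.le, ← Real.rpow_add_one hh.ne']
  refine Real.rpow_le_one hh.le hh1 ?_
  have : (α - 1) / (α + 3) * (2 : ℕ) + 1 = (3 * α + 1) / (α + 3) := by
    push_cast
    field_simp
    ring
  rw [this]
  positivity

theorem rpow_sub_one_eq_holder_scale (hh : 0 < h) (hθ : θ = h ^ (2 / (α + 3))) :
    θ ^ (α - 1) = (h ^ ((α - 1) / (α + 3))) ^ 2 := by
  rw [hθ, ← Real.rpow_mul_natCast hh.le, ← Real.rpow_mul hh.le]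
  congr 1
  push_cast
  ring

theorem rpow_sq_eq_holder_scale (hh : 0 < h) (hα : 0 < α) (hθ : θ = h ^ (2 / (α + 3))) :
    (θ ^ α) ^ 2 = (h ^ ((α - 1) / (α + 3))) ^ 3 * h := by
  rw [hθ, ← Real.rpow_mul hh.le, ← Real.rpow_mul_natCast hh.le, ← Real.rpow_mul_natCast hh.le,
    ← Real.rpow_add_one hh.ne']
  congr 1
  push_cast
  field_simp
  ring

end

section
variable {s h τ a E c₀ cd C₁ Θ L : ℝ} {v vθ vθ' : ℝ → ℝ}

theorem carlemanForm_of_bounds (hs1 : 1 / 2 < s) (hs2 : s < 3 / 4) (hh : 0 < h) (hh1 : h ≤ 1)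
    (hτ : 1 ≤ τ) (ha : 1 ≤ a) (hE : 0 < E) (hcd : 0 ≤ cd) (hC₁ : 0 ≤ C₁) (hΘ0 : 0 ≤ Θ)
    (hΘ1 : Θ ≤ 1) (hL : 0 ≤ L) (hc₁ : c₀ ≤ 1 / 2) (hc₂ : c₀ ≤ E / 2)
    (hv : ∀ r > 0, |v r - vθ r| ≤ C₁ * Θ * (r + 1)⁻¹ ^ 4)
    (hvθ' : ∀ r > 0, |vθ' r| ≤ C₁ * L * (r + 1)⁻¹ ^ 4)
    (hin : ∀ r > 0, (2 * r + 1) * vθ r ≤ E / 8 * (2 * r + 1) + τ ^ 2 * (r + 1)⁻¹ ^ 2 / 8)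
    (hout : ∀ r, a ≤ r → vθ r ≤ E / 8)
    (haτ : 64 * τ ^ 2 ≤ E * a) (hCL : C₁ * L ≤ τ ^ 2 / 8) (hCΘ : C₁ ^ 2 * Θ ^ 2 ≤ h * τ ^ 3 / 8)
    (hEτ : 256 ≤ E * τ) (hCa : 8 * ((2 + 1 / (2 * s - 1)) * C₁) ^ 2 ≤ E * h ^ 2 * a)
    (hLa : 8 * ((2 + 1 / (2 * s - 1)) * (C₁ * L)) ≤ E * √a) :
    CarlemanForm s h τ a E c₀ cd v vθ vθ' := by
  intro r hr X U hX hU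
  have hr1 : 0 < r + 1 := by positivity
  have ha0 : 0 < a := zero_lt_one.trans_le ha
  have hw : 0 < (r + 1) ^ (-(2 * s)) := Real.rpow_pos_of_pos hr1 _
  have hK : 4 ≤ 2 + 1 / (2 * s - 1) := by
    have : 2 ≤ 1 / (2 * s - 1) := by
      rw [le_div_iff₀ (by linarith)]
      linarith
    linarith
  rcases lt_or_ge r a with hra | hra
  · have hb : (a + 1)⁻¹ * a ≤ 1 := by
      rw [inv_mul_le_iff₀ (by positivity)]
      linarith
    have key := carleman_form_inner (X := X) (U := U) (c₀ := c₀) (w := (r + 1) ^ (-(2 * s)))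
      (κ := rayPotential h τ a E cd vθ r) (κ' := rayPotentialRight h τ a cd vθ' r)
      (t := (r + 1)⁻¹) (b := (a + 1)⁻¹) hr (mul_inv_cancel₀ hr1.ne') (by positivity)
      (by gcongr) hh hh1 hτ hw (by
        rw [← Real.rpow_neg_one]
        exact Real.rpow_le_rpow_of_exponent_le (by linarith) (by linarith)) hE hcd hC₁ hΘ1 hL hX hU
      (hv r hr) (hin r hr) (hvθ' r hr)
      (by
        calc 64 * ((a + 1)⁻¹ * τ ^ 2) = (a + 1)⁻¹ * (64 * τ ^ 2) := by ring
          _ ≤ (a + 1)⁻¹ * (E * a) := by gcongr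
          _ = E * ((a + 1)⁻¹ * a) := by ring
          _ ≤ E * 1 := by gcongr
          _ = E := mul_one E) hCL hCΘ hEτ
      (by
        have h1 : 8 * (4 * C₁) ^ 2 ≤ E * h ^ 2 * a := le_trans (by gcongr) hCa
        calc 64 * C₁ ^ 2 * (a + 1)⁻¹ ≤ (8 * (4 * C₁) ^ 2) * (a + 1)⁻¹ :=
              mul_le_mul_of_nonneg_right (by linarith [sq_nonneg C₁]) (by positivity)
          _ ≤ E * h ^ 2 * a * (a + 1)⁻¹ := by gcongr
          _ = E * h ^ 2 * ((a + 1)⁻¹ * a) := by ring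
          _ ≤ E * h ^ 2 * 1 := by gcongr
          _ = _ := mul_one _) hc₁ hc₂
      (by rw [rayPotential, phiDeriv_one_of_le hra.le])
      (by rw [rayPotentialRight, phiDeriv_one_of_le hra.le, phiDerivRight, if_pos hra])
    rwa [carlemanMulRight, if_pos hra, carlemanMul_of_le hra.le, phiDeriv_one_of_le hra.le,
      phiDerivRight, if_pos hra]
  · have hμ0 := carlemanMul_nonneg hs1 ha0 hr.le
    have hμ1 := carlemanMul_le hs1 ha hr
    have hrw := mul_carlemanMulRight_le hs1 ha hr
    have hR : carlemanMulRight s a r = (r + 1) ^ (-(2 * s)) := if_neg (not_lt.2 hra)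
    have hR' : phiDerivRight τ a r = 0 := if_neg (not_lt.2 hra)
    have hpos : 0 < √a := Real.sqrt_pos.2 ha0
    have hsq : √a ^ 2 = a := Real.sq_sqrt ha0.le
    have hdec : a ^ 2 * √a * (r + 1)⁻¹ ^ 4 ≤ (r + 1) ^ (-(2 * s)) := by
      have e1 : a ^ 2 * √a = a ^ (5 / 2 : ℝ) := by
        rw [Real.sqrt_eq_rpow, ← Real.rpow_natCast, ← Real.rpow_add ha0]
        norm_num
      have e2 : (r + 1)⁻¹ ^ 4 = (r + 1) ^ (-(4 : ℝ)) := by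
        rw [Real.rpow_neg hr1.le, inv_pow]
        norm_cast
      calc a ^ 2 * √a * (r + 1)⁻¹ ^ 4 ≤ (r + 1) ^ (5 / 2 : ℝ) * (r + 1) ^ (-(4 : ℝ)) := by
            rw [e1, e2]
            gcongr
            linarith
        _ = (r + 1) ^ (-(3 / 2) : ℝ) := by
            rw [← Real.rpow_add hr1]
            norm_num
        _ ≤ _ := Real.rpow_le_rpow_of_exponent_le (by linarith) (by linarith)
    have hmul : ∀ q, 0 ≤ q → carlemanMul s a r * (q * (r + 1)⁻¹ ^ 4) * √a
        ≤ (2 + 1 / (2 * s - 1)) * q * (r + 1) ^ (-(2 * s)) := fun q hq => by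
      calc carlemanMul s a r * (q * (r + 1)⁻¹ ^ 4) * √a
          ≤ (2 + 1 / (2 * s - 1)) * a ^ 2 * (q * (r + 1)⁻¹ ^ 4) * √a := by gcongr
        _ = (2 + 1 / (2 * s - 1)) * q * (a ^ 2 * √a * (r + 1)⁻¹ ^ 4) := by ring
        _ ≤ _ := by gcongr
    have key := carleman_form_outer (X := X) (U := U) (c₀ := c₀) (w := (r + 1) ^ (-(2 * s)))
      (v := v r) (κ := rayPotential h τ a E cd vθ r) (κ' := rayPotentialRight h τ a cd vθ' r)
      hr hh hw hcd hμ0 (hR ▸ hrw) (hout r hra)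
      (by
        have h1 := hmul _ (mul_nonneg hC₁ hL)
        have h2 : carlemanMul s a r * |vθ' r| * √a ≤ E / 8 * (r + 1) ^ (-(2 * s)) * √a := by
          calc carlemanMul s a r * |vθ' r| * √a
              ≤ carlemanMul s a r * (C₁ * L * (r + 1)⁻¹ ^ 4) * √a := by
                gcongr
                exact hvθ' r hr
            _ ≤ _ := h1
            _ ≤ (E / 8 * √a) * (r + 1) ^ (-(2 * s)) :=
                mul_le_mul_of_nonneg_right (by linarith) hw.le
            _ = _ := by ring
        exact le_of_mul_le_mul_right h2 hpos)
      (by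
        have h1 := hmul _ (mul_nonneg hC₁ hΘ0)
        have h2 : carlemanMul s a r * |v r - vθ r| * √a
            ≤ (2 + 1 / (2 * s - 1)) * C₁ * (r + 1) ^ (-(2 * s)) := by
          calc carlemanMul s a r * |v r - vθ r| * √a
              ≤ carlemanMul s a r * (C₁ * Θ * (r + 1)⁻¹ ^ 4) * √a := by
                gcongr
                exact hv r hr
            _ ≤ _ := h1
            _ ≤ (2 + 1 / (2 * s - 1)) * (C₁ * 1) * (r + 1) ^ (-(2 * s)) := by gcongr
            _ = _ := by ring
        have h3 := pow_le_pow_left₀ (by positivity) h2 2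
        rw [mul_pow, hsq] at h3
        refine le_of_mul_le_mul_right ?_ ha0
        calc 8 * (carlemanMul s a r * |v r - vθ r|) ^ 2 * a
            ≤ 8 * ((2 + 1 / (2 * s - 1)) * C₁ * (r + 1) ^ (-(2 * s))) ^ 2 := by linarith
          _ = 8 * ((2 + 1 / (2 * s - 1)) * C₁) ^ 2 * ((r + 1) ^ (-(2 * s))) ^ 2 := by ring
          _ ≤ E * h ^ 2 * a * ((r + 1) ^ (-(2 * s))) ^ 2 := by gcongr
          _ = _ := by ring) hc₁ hc₂
      (by rw [rayPotential, phiDeriv_one_of_ge hra]; ring)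
      (by rw [rayPotentialRight, phiDeriv_one_of_ge hra, hR']; ring)
    rw [hR, hR', phiDeriv_one_of_ge hra]
    simp only [abs_zero, mul_zero, zero_add, add_zero, mul_one, ne_eq, OfNat.ofNat_ne_zero,
      not_false_eq_true, zero_pow]
    exact key

end

section
variable {E α C₁ : ℝ} {p : ℝ → ℝ}

theorem continuous_of_holder_ray {v : ℝ → ℝ} (hα : 0 < α) (hC₁ : 0 ≤ C₁)
    (hv : ∀ r r' : ℝ, 0 ≤ r → 0 ≤ r' → 0 < |r - r'| → |r - r'| ≤ 1 →
      |v r - v r'| ≤ C₁ * (r + 1) ^ (-(4:ℝ)) * |r - r'| ^ α) :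
    Continuous fun r => v (max r 0) := by
  have h1 : ∀ r r' : ℝ, |r - r'| ≤ 1 → |v (max r 0) - v (max r' 0)| ≤ C₁ * |r - r'| ^ α := by
    intro r r' hrr
    have h2 : |max r 0 - max r' 0| ≤ |r - r'| := abs_max_sub_max_le_abs r r' 0
    rcases (abs_nonneg (max r 0 - max r' 0)).eq_or_lt with h0 | h0
    · rw [sub_eq_zero.1 (abs_eq_zero.1 h0.symm), sub_self, abs_zero]
      positivity
    · have h3 : 0 ≤ max r 0 := le_max_right _ _
      refine (hv _ _ h3 (le_max_right _ _) h0 (h2.trans hrr)).trans ?_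
      calc C₁ * (max r 0 + 1) ^ (-(4:ℝ)) * |max r 0 - max r' 0| ^ α
          ≤ C₁ * 1 * |r - r'| ^ α := by
            gcongr
            exact Real.rpow_le_one_of_one_le_of_nonpos (by linarith) (by norm_num)
        _ = _ := by rw [mul_one]
  refine continuous_iff_continuousAt.2 fun r₀ => ?_
  rw [ContinuousAt, tendsto_iff_dist_tendsto_zero]
  have h4 : Filter.Tendsto (fun r => C₁ * |r - r₀| ^ α) (nhds r₀) (nhds 0) := by
    have : Continuous fun r : ℝ => C₁ * |r - r₀| ^ α :=
      continuous_const.mul ((continuous_abs.comp (continuous_sub_right r₀)).rpow_const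
        fun _ => Or.inr hα.le)
    simpa [Real.zero_rpow hα.ne'] using this.tendsto r₀
  refine squeeze_zero' (Filter.Eventually.of_forall fun _ => dist_nonneg) ?_ h4
  filter_upwards [Metric.closedBall_mem_nhds r₀ one_pos] with r hr using h1 r r₀ hr

/-- The smallness conditions on the parameters of the phase, in terms of the large constant `T`. -/
structure PhaseConstant (E C₁ K ℓ : ℝ) (p : ℝ → ℝ) (T : ℝ) : Prop where
  one_le : 1 ≤ T
  sq_le : 64 * T ^ 2 ≤ E * T ^ ℓ
  le_sq : 8 * C₁ ≤ T ^ 2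
  le_cube : 8 * C₁ ^ 2 ≤ T ^ 3
  le_self : 256 ≤ E * T
  le_rpow : 8 * (K * C₁) ^ 2 ≤ E * T ^ ℓ
  le_sqrt : 8 * (K * C₁) ≤ E * √(T ^ ℓ)
  exists_radius : ∃ R, 0 ≤ R ∧ R ≤ T ∧ p R ≤ E / 8 ∧ 8 * ((2 * R + 1) * p 0) * (R + 1) ^ 2 ≤ T ^ 2

theorem eventually_phaseConstant {K ℓ : ℝ} (hE : 0 < E) (hℓ : 2 < ℓ)
    (hp : Filter.Tendsto p Filter.atTop (nhds 0)) :
    ∀ᶠ T in Filter.atTop, PhaseConstant E C₁ K ℓ p T := by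
  have t2 : Filter.Tendsto (fun T : ℝ => T ^ 2) Filter.atTop Filter.atTop :=
    Filter.tendsto_pow_atTop two_ne_zero
  have t3 : Filter.Tendsto (fun T : ℝ => T ^ 3) Filter.atTop Filter.atTop :=
    Filter.tendsto_pow_atTop three_ne_zero
  have tℓ : Filter.Tendsto (fun T : ℝ => T ^ ℓ) Filter.atTop Filter.atTop :=
    tendsto_rpow_atTop (by linarith)
  have tℓ2 : Filter.Tendsto (fun T : ℝ => T ^ (ℓ - 2)) Filter.atTop Filter.atTop :=
    tendsto_rpow_atTop (by linarith)
  obtain ⟨R, hR, hR0⟩ := ((hp.eventually_le_const (by positivity : 0 < E / 8)).and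
    (Filter.eventually_ge_atTop 0)).exists
  filter_upwards [Filter.eventually_ge_atTop 1, (tℓ2.const_mul_atTop hE).eventually_ge_atTop 64,
    t2.eventually_ge_atTop (8 * C₁), t3.eventually_ge_atTop (8 * C₁ ^ 2),
    (Filter.tendsto_id.const_mul_atTop hE).eventually_ge_atTop 256,
    (tℓ.const_mul_atTop hE).eventually_ge_atTop (8 * (K * C₁) ^ 2),
    ((Real.tendsto_sqrt_atTop.comp tℓ).const_mul_atTop hE).eventually_ge_atTop (8 * (K * C₁)),
    Filter.eventually_ge_atTop R,
    t2.eventually_ge_atTop (8 * ((2 * R + 1) * p 0) * (R + 1) ^ 2)]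
    with T h1 h2 h3 h4 h5 h6 h7 h8 h9
  refine ⟨h1, ?_, h3, h4, h5, h6, h7, R, hR0, h8, hR, h9⟩
  have hT : 0 < T := by linarith
  calc 64 * T ^ 2 ≤ E * T ^ (ℓ - 2) * T ^ 2 := by gcongr
    _ = E * T ^ ℓ := by
      rw [mul_assoc, ← Real.rpow_natCast, ← Real.rpow_add hT]
      norm_num

theorem exists_carlemanForm {s ℓ T h θ τ a c₀ cd : ℝ} {v : ℝ → ℝ} (hE : 0 < E) (hα : 0 < α)
    (hα1 : α < 1) (hp_pos : ∀ r : ℝ, 0 ≤ r → 0 < p r)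
    (hp_mono : ∀ r r' : ℝ, 0 ≤ r → r ≤ r' → p r' ≤ p r) (hC₁ : 0 < C₁)
    (hvp : ∀ r, 0 ≤ r → v r ≤ p r)
    (hv : ∀ r r' : ℝ, 0 ≤ r → 0 ≤ r' → 0 < |r - r'| → |r - r'| ≤ 1 →
      |v r - v r'| ≤ C₁ * (r + 1) ^ (-(4:ℝ)) * |r - r'| ^ α)
    (hs1 : 1 / 2 < s) (hs2 : s < 3 / 4) (hℓ : 2 < ℓ)
    (hT : PhaseConstant E C₁ (2 + 1 / (2 * s - 1)) ℓ p T) (hh : 0 < h) (hh1 : h ≤ 1)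
    (hcd : 0 ≤ cd) (hc₁ : c₀ ≤ 1 / 2) (hc₂ : c₀ ≤ E / 2)
    (hθ : θ = h ^ (2 / (α + 3))) (hτ : τ = T * θ ^ (2 * α / 3) * h ^ (-(1 / 3) : ℝ))
    (ha : a = T ^ ℓ * h ^ (-(2:ℝ))) :
    1 ≤ τ ∧ 1 ≤ a ∧ ∃ vθ vθ' : ℝ → ℝ, (∀ r, HasDerivAt vθ (vθ' r) r) ∧
      CarlemanForm s h τ a E c₀ cd v vθ vθ' := by
  have hT1 := hT.one_le
  have hT0 : 0 < T := by linarith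
  have hθ0 : 0 < θ := hθ ▸ Real.rpow_pos_of_pos hh _
  have hθ1 : θ ≤ 1 := hθ ▸ Real.rpow_le_one hh.le hh1 (by positivity)
  rw [mul_assoc, holder_scale_eq hh hα hθ] at hτ
  have hq1 := one_le_holder_scale hh hh1 hα hα1
  have hq2 := holder_scale_sq_mul_le hh hh1 hα
  have hL := rpow_sub_one_eq_holder_scale hh hθ
  have hΘ := rpow_sq_eq_holder_scale hh hα hθ
  set q := h ^ ((α - 1) / (α + 3))
  have hTτ : T ≤ τ := hτ ▸ le_mul_of_one_le_right hT0.le hq1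
  have hτ1 : 1 ≤ τ := hT1.trans hTτ
  have hA : 0 < T ^ ℓ := Real.rpow_pos_of_pos hT0 _
  have hTA : T ≤ T ^ ℓ := Real.self_le_rpow_of_one_le hT1 (by linarith)
  have hah : a * h ^ 2 = T ^ ℓ := by
    rw [ha, Real.rpow_neg hh.le, mul_assoc, Real.rpow_two, inv_mul_cancel₀ (by positivity), mul_one]
  have ha0 : 0 < a := ha ▸ mul_pos hA (Real.rpow_pos_of_pos hh _)
  have hAa : T ^ ℓ ≤ a := by
    rw [← hah]
    exact mul_le_of_le_one_right ha0.le (pow_le_one₀ hh.le hh1)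
  have ha1 : 1 ≤ a := hT1.trans (hTA.trans hAa)
  refine ⟨hτ1, ha1, ?_⟩
  have hc := continuous_of_holder_ray hα hC₁.le hv
  obtain ⟨R, hR0, hRT, hpR, hR⟩ := hT.exists_radius
  have havg : ∀ r, 0 ≤ r → forwardAverage θ (fun r => v (max r 0)) r ≤ p r := fun r hr =>
    forwardAverage_le hc hθ0 fun t ht => by
      rw [max_eq_left (hr.trans ht)]
      exact (hvp t (hr.trans ht)).trans (hp_mono r t hr ht)
  have hpow : ∀ r : ℝ, 0 ≤ r → (r + 1) ^ (-(4:ℝ)) = (r + 1)⁻¹ ^ 4 := fun r hr => by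
    rw [Real.rpow_neg (by positivity), inv_pow]
    norm_cast
  have hdiff : ∀ r t, 0 < r → r < t → t ≤ r + θ →
      |v (max r 0) - v (max t 0)| ≤ C₁ * θ ^ α * (r + 1)⁻¹ ^ 4 := fun r t hr hrt ht => by
    have h1 : |r - t| = t - r := by rw [abs_sub_comm, abs_of_pos (by linarith)]
    rw [max_eq_left hr.le, max_eq_left (hr.trans hrt).le]
    refine (hv r t hr.le (hr.trans hrt).le (by rw [h1]; linarith)
      (by rw [h1]; linarith)).trans ?_
    rw [hpow r hr.le, h1, mul_right_comm]
    gcongr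
    linarith
  refine ⟨_, _, hasDerivAt_forwardAverage hc θ, carlemanForm_of_bounds (C₁ := C₁) (Θ := θ ^ α)
    (L := θ ^ (α - 1)) hs1 hs2 hh hh1 hτ1 ha1 hE hcd hC₁.le (by positivity)
    (Real.rpow_le_one hθ0.le hθ1 hα.le) (by positivity) hc₁ hc₂ ?_ ?_ ?_ ?_ ?_ ?_ ?_ ?_ ?_ ?_⟩
  · intro r hr
    have := abs_sub_forwardAverage_le hc hθ0 fun t h1 h2 => hdiff r t hr h1 h2
    simpa only [max_eq_left hr.le] using this
  · intro r hr
    have h1 := hdiff r (r + θ) hr (by linarith) le_rfl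
    rw [abs_mul, abs_of_pos (inv_pos.2 hθ0), abs_sub_comm, Real.rpow_sub_one hθ0.ne']
    calc θ⁻¹ * |v (max r 0) - v (max (r + θ) 0)|
        ≤ θ⁻¹ * (C₁ * θ ^ α * (r + 1)⁻¹ ^ 4) := by gcongr
      _ = _ := by ring
  · intro r hr
    rcases le_total R r with h1 | h1
    · have h2 := (havg r hr.le).trans ((hp_mono R r hR0 h1).trans hpR)
      have h3 : 0 ≤ τ ^ 2 * (r + 1)⁻¹ ^ 2 / 8 := by positivity
      have h4 := mul_le_mul_of_nonneg_left h2 (by linarith : 0 ≤ 2 * r + 1)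
      linarith
    · have hp0 := hp_pos 0 le_rfl
      have h2 := (havg r hr.le).trans (hp_mono 0 r le_rfl hr.le)
      have h3 : (2 * r + 1) * p 0 ≤ τ ^ 2 * (r + 1)⁻¹ ^ 2 / 8 := by
        rw [inv_pow, ← div_eq_mul_inv, div_div, le_div_iff₀ (by positivity)]
        calc (2 * r + 1) * p 0 * ((r + 1) ^ 2 * 8)
            ≤ (2 * R + 1) * p 0 * ((R + 1) ^ 2 * 8) := by gcongr
          _ = 8 * ((2 * R + 1) * p 0) * (R + 1) ^ 2 := by ring
          _ ≤ T ^ 2 := hR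
          _ ≤ τ ^ 2 := by gcongr
      have h4 := mul_le_mul_of_nonneg_left h2 (by linarith : 0 ≤ 2 * r + 1)
      have h5 : 0 ≤ E / 8 * (2 * r + 1) := by positivity
      linarith
  · intro r hr
    exact (havg r (ha0.le.trans hr)).trans
      ((hp_mono R r hR0 (hRT.trans (hTA.trans (hAa.trans hr)))).trans hpR)
  · refine le_of_mul_le_mul_right ?_ hh
    calc 64 * τ ^ 2 * h = 64 * T ^ 2 * (q ^ 2 * h) := by rw [hτ]; ring
      _ ≤ 64 * T ^ 2 * 1 := by gcongr
      _ ≤ E * T ^ ℓ := by linarith [hT.sq_le]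
      _ = E * a * h * h := by rw [← hah]; ring
      _ ≤ E * a * h * 1 := by gcongr
      _ = _ := by ring
  · rw [hL, hτ]
    linarith [mul_le_mul_of_nonneg_right hT.le_sq (sq_nonneg q)]
  · rw [hΘ, hτ]
    have : 0 ≤ q ^ 3 * h := by positivity
    linarith [mul_le_mul_of_nonneg_right hT.le_cube this]
  · exact hT.le_self.trans (by gcongr)
  · rw [mul_assoc E, mul_comm (h ^ 2), hah]
    exact hT.le_rpow
  · have h1 : √a * h = √(T ^ ℓ) := by
      rw [← hah, Real.sqrt_mul ha0.le, Real.sqrt_sq hh.le]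
    refine le_of_mul_le_mul_right ?_ hh
    have hK : 0 ≤ 1 / (2 * s - 1) := (one_div_pos.2 (by linarith)).le
    calc 8 * ((2 + 1 / (2 * s - 1)) * (C₁ * θ ^ (α - 1))) * h
        = 8 * ((2 + 1 / (2 * s - 1)) * C₁) * (q ^ 2 * h) := by rw [hL]; ring
      _ ≤ 8 * ((2 + 1 / (2 * s - 1)) * C₁) * 1 := by gcongr
      _ ≤ E * √(T ^ ℓ) := by linarith [hT.le_sqrt]
      _ = _ := by rw [← h1]; ring

end

theorem sqrt_add_sqrt_le_of_mul_add_le {U D Q F c K₁ K₂ x y : ℝ} (hU : 0 ≤ U) (hD : 0 ≤ D)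
    (hQ : 0 ≤ Q) (hF : 0 ≤ F) (hc : 0 < c) (hK₁ : 0 ≤ K₁) (hK₂ : 0 ≤ K₂) (hx : 0 ≤ x) (hy : 0 ≤ y)
    (h : c * (U + D) ≤ K₁ * x ^ 2 * Q + K₂ * y ^ 2 * F) :
    √U + √D ≤ (√(2 * K₁ / c) + √(2 * K₂ / c)) * x * √Q
      + (√(2 * K₁ / c) + √(2 * K₂ / c)) * y * √F := by
  have h1 : √U + √D ≤ √(2 * K₁ / c) * x * √Q + √(2 * K₂ / c) * y * √F := by
    refine abs_le_of_sq_le_sq' ?_ (by positivity) |>.2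
    have e1 : √(2 * K₁ / c) ^ 2 = 2 * K₁ / c := Real.sq_sqrt (by positivity)
    have e2 : √(2 * K₂ / c) ^ 2 = 2 * K₂ / c := Real.sq_sqrt (by positivity)
    have e3 : 0 ≤ √(2 * K₁ / c) * x * √Q * (√(2 * K₂ / c) * y * √F) := by positivity
    calc (√U + √D) ^ 2 ≤ 2 * (√U ^ 2 + √D ^ 2) := by linarith [sq_nonneg (√U - √D)]
      _ = 2 / c * (c * (U + D)) := by
        rw [Real.sq_sqrt hU, Real.sq_sqrt hD]
        field_simp
      _ ≤ 2 / c * (K₁ * x ^ 2 * Q + K₂ * y ^ 2 * F) := by gcongr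
      _ = √(2 * K₁ / c) ^ 2 * x ^ 2 * √Q ^ 2 + √(2 * K₂ / c) ^ 2 * y ^ 2 * √F ^ 2 := by
        rw [e1, e2, Real.sq_sqrt hQ, Real.sq_sqrt hF]
        ring
      _ ≤ _ := by linarith
  have h2 : 0 ≤ √(2 * K₂ / c) * x * √Q := by positivity
  have h3 : 0 ≤ √(2 * K₁ / c) * y * √F := by positivity
  linarith

/-- The global Carleman estimate of Theorem 4.1 in the Hölder case. -/
theorem stmt_17 (d : ℕ) (hd : 3 ≤ d) (E α : ℝ) (hE : 0 < E) (hα : 0 < α) (hα1 : α < 1)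
    (V : EuclideanSpace ℝ (Fin d) → ℝ) (hVb : ∃ M, ∀ x, |V x| ≤ M) (hVm : Measurable V)
    (p : ℝ → ℝ) (hp_pos : ∀ r : ℝ, 0 ≤ r → 0 < p r)
    (hp_mono : ∀ r r' : ℝ, 0 ≤ r → r ≤ r' → p r' ≤ p r)
    (hp_lim : Filter.Tendsto p Filter.atTop (nhds 0))
    (hVp : ∀ x, V x ≤ p ‖x‖)
    (C₁ : ℝ) (hC₁ : 0 < C₁)
    (hVhold : ∀ w : EuclideanSpace ℝ (Fin d), ‖w‖ = 1 →
      ∀ r r' : ℝ, 0 ≤ r → 0 ≤ r' → 0 < |r - r'| → |r - r'| ≤ 1 →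
        |V (r • w) - V (r' • w)| ≤ C₁ * (r + 1) ^ (-(4:ℝ)) * |r - r'| ^ α)
    (s ℓ : ℝ) (hs1 : 1/2 < s) (hs2 : s < 3/4) (hℓ1 : 2 < ℓ) (hℓ2 : (2 - 2*s) * ℓ > 2) :
    ∃ τ₀ : ℝ, 1 ≤ τ₀ ∧ ∃ C > 0, ∀ h ε : ℝ, 0 < h → h ≤ 1 → 0 < ε → ε ≤ 1 →
      ∀ θ τ a : ℝ, θ = h ^ (2/(α+3)) → τ = τ₀ * θ ^ (2*α/3) * h ^ (-(1/3) : ℝ) →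
        a = τ₀ ^ ℓ * h ^ (-(2:ℝ)) →
        ∀ sgn : ℝ, (sgn = 1 ∨ sgn = -1) →
          ∀ f : EuclideanSpace ℝ (Fin d) → ℂ, ContDiff ℝ (⊤ : ℕ∞) f → HasCompactSupport f →
            Real.sqrt (∫ x, (‖x‖ + 1) ^ (-(2*s)) * Real.exp (2 * phi 1 τ a ‖x‖ / h) * ‖f x‖ ^ 2)
              + Real.sqrt (∫ x, (‖x‖ + 1) ^ (-(2*s)) * Real.exp (2 * phi 1 τ a ‖x‖ / h)
                  * ‖radialDeriv h f x‖ ^ 2)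
            ≤ C * a ^ 2 * h⁻¹ *
                Real.sqrt (∫ x, (‖x‖ + 1) ^ (2*s) * Real.exp (2 * phi 1 τ a ‖x‖ / h) *
                  ‖-(h:ℂ)^2 * lap f x
                    + ((V x : ℂ) - (E:ℂ) + (sgn:ℂ) * (ε:ℂ) * Complex.I) * f x‖ ^ 2)
              + C * τ * a * Real.sqrt (ε / h) *
                Real.sqrt (∫ x, Real.exp (2 * phi 1 τ a ‖x‖ / h) * ‖f x‖ ^ 2) := by
  obtain ⟨M, hM⟩ := hVb
  have hM0 : 0 ≤ M := (abs_nonneg _).trans (hM 0)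
  obtain ⟨T, hT⟩ := (eventually_phaseConstant (C₁ := C₁) (K := 2 + 1 / (2 * s - 1)) hE hℓ1
    hp_lim).exists
  have hK : 0 < 1 / (2 * s - 1) := one_div_pos.2 (by linarith)
  set c₀ := min (1 / 2) (E / 2)
  have hc₀ : 0 < c₀ := lt_min (by norm_num) (by positivity)
  have hm : (1:ℝ) ≤ ((d : ℝ) - 1) / 2 := by
    have : (3:ℝ) ≤ d := by exact_mod_cast hd
    linarith
  have hc : 0 < c₀ / (48 * (1 + (((d : ℝ) - 1) / 2) ^ 2)) := by positivity
  refine ⟨T, hT.one_le, _, add_pos_of_pos_of_nonneg (Real.sqrt_pos.2 (div_pos (mul_pos two_pos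
    (by positivity : 0 < 5 / c₀ * (2 + 1 / (2 * s - 1)) ^ 2)) hc)) (Real.sqrt_nonneg
    (2 * ((2 + 1 / (2 * s - 1)) * (2 + E + M)) / (c₀ / (48 * (1 + (((d : ℝ) - 1) / 2) ^ 2))))), ?_⟩
  intro h ε hh hh1 hε hε1 θ τ a hθ hτ ha σ hσ f hf hfs
  have key := fun (v : ℝ → ℝ) hvp hv => exists_carlemanForm (v := v) (c₀ := c₀)
    (cd := ((d : ℝ) - 1) / 2 * (((d : ℝ) - 1) / 2 - 1)) hE hα hα1 hp_pos hp_mono hC₁ hvp hv hs1 hs2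
    hℓ1 hT hh hh1 (mul_nonneg (by linarith) (by linarith)) (min_le_left _ _) (min_le_right _ _)
    hθ hτ ha
  obtain ⟨hτ1, ha1, -⟩ := key 0 (fun r hr => (hp_pos r hr).le) (fun r r' hr _ _ _ => by
    simp only [Pi.zero_apply, sub_zero, abs_zero]
    positivity)
  have hform := fun (ω : EuclideanSpace ℝ (Fin d)) (hω : ‖ω‖ = 1) =>
    (key (fun r => V (r • ω)) (fun r hr => by
      simpa [norm_smul, hω, abs_of_nonneg hr] using hVp (r • ω)) (hVhold ω hω)).2.2
  have hmain := integral_carleman hd hs1 hh hτ1 ha1 hE hc₀ hε hε1 hσ hVm hM hform hf hfs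
  have hpow : (ε / h) * (a * τ) ^ 2 = (τ * a * √(ε / h)) ^ 2 := by
    rw [mul_pow _ (√(ε / h)), Real.sq_sqrt (by positivity)]
    ring
  rw [mul_assoc _ (ε / h), hpow] at hmain
  refine (sqrt_add_sqrt_le_of_mul_add_le ?_ ?_ ?_ ?_ hc (by positivity) (by positivity)
    (by positivity) (by positivity) hmain).trans_eq ?_
  any_goals exact integral_nonneg fun x => by positivity
  ring
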